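/- For every ε ∈ (0,1) there exists a positive integer K (depending only on ε) with the following property. Let W, H be positive integers and let R be a finite family of rectangles. Suppose there exist orientations σ_i ∈ {0,1} for the rectangles (σ_i = 1 meaning R_i is rotated by 90°, i.e., its width and height are exchanged) such that each oriented rectangle has width at most W and the oriented family admits a feasible packing into [0,W]×[0,H]. Then there exist (possibly different) orientations τ_i ∈ {0,1} with each τ-oriented rectangle of width at most W, a feasible packing of all the τ-oriented rectangles into [0,W]×[0,⌈(4/3+ε)·H⌉], and at most K axis-aligned rectangular containers with pairwise disjoint interiors in [0,W]×[0,⌈(4/3+ε)·H⌉], each labeled horizontal or vertical, such that every τ-oriented rectangle with oriented height > ε·H or oriented width > ε·W is packed inside one of the containers, any vertical line intersects the interior of at most one rectangle packed in each vertical container, and any horizontal line intersects the interior of at most one rectangle packed in each horizontal container. -/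

import Mathlib

open scoped Classical

/-- Open axis-aligned rectangles `(x₁, x₁+w₁) × (y₁, y₁+h₁)` and `(x₂, x₂+w₂) × (y₂, y₂+h₂)`
are disjoint. -/
def RectDisjoint (x₁ y₁ w₁ h₁ x₂ y₂ w₂ h₂ : ℕ) : Prop :=
  x₁ + w₁ ≤ x₂ ∨ x₂ + w₂ ≤ x₁ ∨ y₁ + h₁ ≤ y₂ ∨ y₂ + h₂ ≤ y₁

/-- A feasible packing of the family of rectangles `(w i, h i)` at positions `(x i, y i)`
inside `[0,W]×[0,H]`. -/
def IsPacking {ι : Type*} (w h x y : ι → ℕ) (W H : ℕ) : Prop :=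
  (∀ i, x i + w i ≤ W ∧ y i + h i ≤ H) ∧
  Pairwise fun i j => RectDisjoint (x i) (y i) (w i) (h i) (x j) (y j) (w j) (h j)

/-- Two axis-aligned rectangular regions (real coordinates) have disjoint interiors. -/
def RegionDisjoint (cx cy cw ch cx' cy' cw' ch' : ℝ) : Prop :=
  cx + cw ≤ cx' ∨ cx' + cw' ≤ cx ∨ cy + ch ≤ cy' ∨ cy' + ch' ≤ cy

/-- The rectangle of width `wi`, height `hi` placed at `(x,y)` lies inside the region with
bottom-left corner `(cx,cy)`, width `cw` and height `ch`. -/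
def InRegion (x y wi hi : ℕ) (cx cy cw ch : ℝ) : Prop :=
  cx ≤ (x : ℝ) ∧ (x : ℝ) + wi ≤ cx + cw ∧ cy ≤ (y : ℝ) ∧ (y : ℝ) + hi ≤ cy + ch

/-- The width of rectangle `(w,h)` under orientation `b` (`b = true` means rotated by 90°). -/
def orientW (w h : ℕ) (b : Bool) : ℕ := if b then h else w

/-- The height of rectangle `(w,h)` under orientation `b` (`b = true` means rotated by 90°). -/
def orientH (w h : ℕ) (b : Bool) : ℕ := if b then w else h



/-- An axis-parallel integer rectangle. -/
structure Rec where
  x : ℕ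
  y : ℕ
  w : ℕ
  h : ℕ

namespace Rec

/-- unit cell `(i,j)` belongs to the rectangle -/
def mem (r : Rec) (i j : ℕ) : Prop := r.x ≤ i ∧ i < r.x + r.w ∧ r.y ≤ j ∧ j < r.y + r.h

/-- no common cell -/
def Dj (r s : Rec) : Prop := ∀ i j, r.mem i j → s.mem i j → False

/-- cell containment -/
def Sub (r s : Rec) : Prop := ∀ i j, r.mem i j → s.mem i j

theorem Dj.symm {r s : Rec} (h : r.Dj s) : s.Dj r := fun i j a b => h i j b a

theorem Dj.mono {r s r' s' : Rec} (h : r.Dj s) (h1 : r'.Sub r) (h2 : s'.Sub s) : r'.Dj s' :=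
  fun i j a b => h i j (h1 i j a) (h2 i j b)

theorem Sub.trans {r s t : Rec} (h : r.Sub s) (h' : s.Sub t) : r.Sub t :=
  fun i j a => h' i j (h i j a)

end Rec

/-- The greedy filling lemma. -/
theorem fill_lemma {I S : Type*} [Nonempty S] (A : Finset I) (B : Finset S)
    (w : I → ℕ) (cap : S → ℕ) (ω : ℕ) (hw : ∀ i ∈ A, w i ≤ ω + 1) :
    ∃ (A' : Finset I) (f : I → S), A' ⊆ A ∧ (∀ i ∈ A', f i ∈ B) ∧
      (∀ s ∈ B, ∑ i ∈ A' with f i = s, w i ≤ cap s) ∧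
      (A' = A ∨ ∑ s ∈ B, cap s ≤ ∑ i ∈ A', w i + B.card * ω) := by
  induction A using Finset.induction_on with
  | empty =>
    obtain ⟨s0⟩ := ‹Nonempty S›
    exact ⟨∅, fun _ => s0, by simp, by simp, by simp, Or.inl rfl⟩
  | insert a A ha ih =>
    obtain ⟨A', f, h1, h2, h3, h4⟩ := ih (fun i hi => hw i (Finset.mem_insert_of_mem hi))
    rcases h4 with h4 | h4
    · subst h4
      by_cases hs : ∃ s ∈ B, ∑ i ∈ A' with f i = s, w i + w a ≤ cap s
      · obtain ⟨s, hs, hle⟩ := hs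
        refine ⟨insert a A', Function.update f a s, subset_rfl, ?_, ?_, Or.inl rfl⟩
        · intro i hi
          rcases Finset.mem_insert.1 hi with rfl | hi'
          · simpa using hs
          · rw [Function.update_of_ne (by rintro rfl; exact ha hi')]
            exact h2 i hi'
        · intro s' hs'
          have e : ∑ i ∈ A' with Function.update f a s i = s', w i
              = ∑ i ∈ A' with f i = s', w i := by
            congr 1
            apply Finset.filter_congr
            intro i hi
            rw [Function.update_of_ne (by rintro rfl; exact ha hi)]
          rw [Finset.filter_insert]
          by_cases hss : s = s'
          · subst hss
            rw [if_pos (by simp), Finset.sum_insert (by simp [ha]), e]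
            omega
          · rw [if_neg (by simpa using hss), e]
            exact h3 s' hs'
      · push Not at hs
        refine ⟨A', f, Finset.subset_insert _ _, h2, h3, Or.inr ?_⟩
        have hwa := hw a (Finset.mem_insert_self _ _)
        calc ∑ s ∈ B, cap s ≤ ∑ s ∈ B, (∑ i ∈ A' with f i = s, w i + ω) :=
              Finset.sum_le_sum (fun s hs' => by have := hs s hs'; omega)
          _ = ∑ i ∈ A', w i + B.card * ω := by
              rw [Finset.sum_add_distrib, Finset.sum_fiberwise_of_maps_to h2]
              simp
    · exact ⟨A', f, h1.trans (Finset.subset_insert _ _), h2, h3, Or.inr h4⟩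

/-- Complete version of the filling lemma. -/
theorem fill_all {I S : Type*} [Nonempty S] (A : Finset I) (B : Finset S)
    (w : I → ℕ) (cap : S → ℕ) (ω : ℕ) (hw : ∀ i ∈ A, w i ≤ ω) (hpos : ∀ i ∈ A, 0 < w i)
    (hsum : ∑ i ∈ A, w i + B.card * ω ≤ ∑ s ∈ B, cap s) :
    ∃ f : I → S, (∀ i ∈ A, f i ∈ B) ∧ (∀ s ∈ B, ∑ i ∈ A with f i = s, w i ≤ cap s) := by
  obtain ⟨A', f, h1, h2, h3, h4⟩ := fill_lemma A B w cap ω (fun i hi => (hw i hi).trans (by omega))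
  rcases h4 with h4 | h4
  · subst h4; exact ⟨f, h2, h3⟩
  · by_cases hA : A' = A
    · subst hA; exact ⟨f, h2, h3⟩
    · exfalso
      have : ∑ i ∈ A', w i < ∑ i ∈ A, w i := by
        obtain ⟨a, haA, haA'⟩ := Finset.exists_of_ssubset (lt_of_le_of_ne h1 hA)
        exact Finset.sum_lt_sum_of_subset h1 haA haA' (hpos a haA) (fun _ _ _ => Nat.zero_le _)
      omega

/-- Initial part lemma: a maximal initial part in decreasing order of `key`. -/
theorem prefix_lemma {I : Type*} (S : Finset I) (key w : I → ℕ) (A : ℕ) :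
    ∃ P ⊆ S, ∑ i ∈ P, w i ≤ A ∧ (∀ i ∈ P, ∀ j ∈ S, j ∉ P → key j ≤ key i) ∧
      (P = S ∨ ∃ j ∈ S, j ∉ P ∧ A < ∑ i ∈ P, w i + w j) := by
  let good : Finset (Finset I) := S.powerset.filter
    (fun P => ∑ i ∈ P, w i ≤ A ∧ ∀ i ∈ P, ∀ j ∈ S, j ∉ P → key j ≤ key i)
  have hne : good.Nonempty := ⟨∅, by simp [good]⟩
  obtain ⟨P, hP, hmax⟩ := good.exists_max_image Finset.card hne
  simp only [good, Finset.mem_filter, Finset.mem_powerset] at hP hmax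
  refine ⟨P, hP.1, hP.2.1, hP.2.2, ?_⟩
  by_cases hPS : P = S
  · exact Or.inl hPS
  right
  have hne' : (S \ P).Nonempty := by
    obtain ⟨a, ha, ha'⟩ := Finset.exists_of_ssubset (lt_of_le_of_ne hP.1 hPS)
    exact ⟨a, by simp [ha, ha']⟩
  obtain ⟨j, hj, hjmax⟩ := (S \ P).exists_max_image key hne'
  simp only [Finset.mem_sdiff] at hj hjmax
  refine ⟨j, hj.1, hj.2, ?_⟩
  by_contra hlt
  push Not at hlt
  have := hmax (insert j P) ⟨Finset.insert_subset hj.1 hP.1, by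
      rw [Finset.sum_insert hj.2]; omega, ?_⟩
  · rw [Finset.card_insert_of_notMem hj.2] at this
    omega
  · intro i hi l hl hlP
    simp only [Finset.mem_insert, not_or] at hlP
    rcases Finset.mem_insert.1 hi with rfl | hi
    · exact hjmax l ⟨hl, hlP.2⟩
    · exact hP.2.2 i hi l hl hlP.2

/-! ### slabs -/

/-- largest element of `X` that is at most `x` -/
def lo (X : Finset ℕ) (x : ℕ) : ℕ := (X.filter (· ≤ x)).sup id

/-- least element of `X` above `x` -/
noncomputable def hi (X : Finset ℕ) (x : ℕ) : ℕ := sInf {t | t ∈ X ∧ x < t}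

theorem lo_le (X : Finset ℕ) (x : ℕ) : lo X x ≤ x := by
  unfold lo
  apply Finset.sup_le
  intro b hb
  exact (Finset.mem_filter.1 hb).2

theorem le_lo {X : Finset ℕ} {x t : ℕ} (ht : t ∈ X) (htx : t ≤ x) : t ≤ lo X x := by
  unfold lo
  exact Finset.le_sup (f := id) (Finset.mem_filter.2 ⟨ht, htx⟩)

theorem lo_mem {X : Finset ℕ} (h0 : 0 ∈ X) (x : ℕ) : lo X x ∈ X := by
  unfold lo
  have hne : (X.filter (· ≤ x)).Nonempty := ⟨0, by simp [h0]⟩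
  obtain ⟨t, ht, he⟩ := Finset.exists_mem_eq_sup _ hne (id : ℕ → ℕ)
  rw [he]
  exact (Finset.mem_filter.1 ht).1

theorem hi_spec {X : Finset ℕ} {x W : ℕ} (hW : W ∈ X) (hx : x < W) : hi X x ∈ X ∧ x < hi X x :=
  Nat.sInf_mem (s := {t | t ∈ X ∧ x < t}) ⟨W, hW, hx⟩

theorem hi_le {X : Finset ℕ} {x t : ℕ} (ht : t ∈ X) (htx : x < t) : hi X x ≤ t :=
  Nat.sInf_le (s := {t | t ∈ X ∧ x < t}) ⟨ht, htx⟩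

theorem lo_self {X : Finset ℕ} {a : ℕ} (ha : a ∈ X) : lo X a = a :=
  le_antisymm (lo_le X a) (le_lo ha le_rfl)

/-- points of the same slab -/
theorem slab_eq {X : Finset ℕ} {W a y : ℕ} (hW : W ∈ X) (haW : a < W) (ha : a ∈ X)
    (h1 : a ≤ y) (h2 : y < hi X a) : lo X y = a ∧ hi X y = hi X a := by
  have hs := hi_spec hW haW
  constructor
  · apply le_antisymm _ (le_lo ha h1)
    by_contra hlt
    push Not at hlt
    have h3 := hi_le (lo_mem (X := X) (x := y) (by
      by_contra h0
      have : lo X y ∈ X := by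
        unfold lo at hlt ⊢
        have hne : (X.filter (· ≤ y)).Nonempty := ⟨a, by simp [ha, h1]⟩
        obtain ⟨t, ht, he⟩ := Finset.exists_mem_eq_sup _ hne (id : ℕ → ℕ)
        rw [he]
        exact (Finset.mem_filter.1 ht).1
      have h4 := hi_le this hlt
      have h5 := lo_le X y
      omega)) hlt
    have := lo_le X y
    omega
  · apply le_antisymm
    · exact hi_le hs.1 h2
    · have hyW : y < W := lt_of_lt_of_le h2 (hi_le hW haW)
      have := hi_spec hW hyW
      exact hi_le this.1 (lt_of_le_of_lt h1 this.2)

theorem lo_hi {X : Finset ℕ} {W x : ℕ} (h0 : 0 ∈ X) (hW : W ∈ X) (hx : x < W) :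
    x < hi X (lo X x) ∧ hi X (lo X x) = hi X x := by
  have h1 := lo_le X x
  have h2 := hi_spec hW (lt_of_le_of_lt h1 hx)
  have h3 : x < hi X (lo X x) := by
    by_contra h
    push Not at h
    have := le_lo h2.1 h
    omega
  exact ⟨h3, (slab_eq hW (lt_of_le_of_lt h1 hx) (lo_mem h0 x) h1 h3).2.symm⟩

/-- the uncovered part of an interval whose covering pieces all reach one of the ends -/
theorem ends_lemma (a b : ℕ) (hab : a ≤ b) (cov : ℕ → Prop)
    (h : ∀ x, a ≤ x → x < b → cov x → (∀ y, a ≤ y → y ≤ x → cov y) ∨ (∀ y, x ≤ y → y < b → cov y)) :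
    ∃ p q, a ≤ p ∧ p ≤ q ∧ q ≤ b ∧ ∀ x, a ≤ x → x < b → (cov x ↔ (x < p ∨ q ≤ x)) := by
  by_cases hall : ∀ x, a ≤ x → x < b → cov x
  · exact ⟨b, b, hab, le_rfl, le_rfl, fun x hx hxb => ⟨fun _ => Or.inl hxb, fun _ => hall x hx hxb⟩⟩
  push Not at hall
  let N : Finset ℕ := (Finset.Ico a b).filter (fun x => ¬ cov x)
  have hN : N.Nonempty := by
    obtain ⟨x, h1, h2, h3⟩ := hall
    exact ⟨x, by simp [N, h1, h2, h3]⟩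
  have hmemN : ∀ y, y ∈ N → a ≤ y ∧ y < b ∧ ¬ cov y := by
    intro y hy
    simp only [N, Finset.mem_filter, Finset.mem_Ico] at hy
    exact ⟨hy.1.1, hy.1.2, hy.2⟩
  have hmin := hmemN _ (N.min'_mem hN)
  have hmax := hmemN _ (N.max'_mem hN)
  have hmm := N.min'_le_max' hN
  refine ⟨N.min' hN, N.max' hN + 1, ?_, ?_, ?_, ?_⟩
  · exact hmin.1
  · omega
  · omega
  · intro x hx hxb
    constructor
    · intro hc
      by_contra hcon
      push Not at hcon
      rcases h x hx hxb hc with h' | h'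
      · exact hmin.2.2 (h' _ hmin.1 hcon.1)
      · exact hmax.2.2 (h' _ (by omega) hmax.2.1)
    · intro hor
      by_contra hc
      have hxN : x ∈ N := by simp [N, hx, hxb, hc]
      have h1 := N.min'_le x hxN
      have h2 := N.le_max' x hxN
      omega



/-- Input of the core rearrangement: a packing of blocks `B` and vertical items `V`
into a `W × (3 * m)` grid. -/
structure CoreIn (α : Type) where
  m : ℕ
  W : ℕ
  B : Finset α
  V : Finset α
  x : α → ℕ
  w : α → ℕ
  r : α → ℕ
  k : α → ℕ
  hm : 2 ≤ m
  hW : 0 < W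
  hBV : Disjoint B V
  hin : ∀ i ∈ B ∪ V, x i + w i ≤ W ∧ r i + k i ≤ 3 * m ∧ 0 < w i ∧ 0 < k i
  hdj : ∀ i ∈ B ∪ V, ∀ j ∈ B ∪ V, i ≠ j → ∀ c, x i ≤ c → c < x i + w i → x j ≤ c →
    c < x j + w j → r i + k i ≤ r j ∨ r j + k j ≤ r i

namespace CoreIn

variable {α : Type} (I : CoreIn α)

/-- all items -/
noncomputable def J : Finset α := I.B ∪ I.V

/-- item `i` covers column `c` -/
def col (i : α) (c : ℕ) : Prop := I.x i ≤ c ∧ c < I.x i + I.w i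

def Tall (i : α) : Prop := I.m < I.k i

def above (i j : α) : Prop :=
  i ∈ I.J ∧ j ∈ I.J ∧ I.r j + I.k j ≤ I.r i ∧ ∃ c, I.col i c ∧ I.col j c

def Up (u : α) : Prop := I.Tall u ∧ ∃ j, I.Tall j ∧ I.above u j

/-- the items to be lifted -/
def U (i : α) : Prop := ∃ u, I.Up u ∧ Relation.ReflTransGen (fun a b => I.above b a) u i

/-- the new row -/
noncomputable def r' (i : α) : ℕ := if I.U i then I.r i + I.m else I.r i

theorem Up.U {I : CoreIn α} {u : α} (h : I.Up u) : I.U u := ⟨u, h, Relation.ReflTransGen.refl⟩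

theorem U_above {i j : α} (h : I.U i) (ha : I.above j i) : I.U j := by
  obtain ⟨u, hu, hr⟩ := h
  exact ⟨u, hu, hr.tail ha⟩

theorem U_cases {i : α} (h : I.U i) : (I.Up i ∧ I.m + 1 ≤ I.r i) ∨ 2 * I.m + 2 ≤ I.r i := by
  obtain ⟨u, hu, hr⟩ := h
  induction hr with
  | refl =>
    left
    refine ⟨hu, ?_⟩
    obtain ⟨h1, j, hj, ha⟩ := hu
    have := ha.2.2.1
    unfold Tall at hj
    omega
  | tail _ hbc ih =>
    right
    have := hbc.2.2.1
    rcases ih with ih | ih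
    · have := ih.1.1
      unfold Tall at this
      omega
    · omega

theorem r'_U {i : α} (h : I.U i) : I.r' i = I.r i + I.m := by simp [r', h]
theorem r'_nU {i : α} (h : ¬ I.U i) : I.r' i = I.r i := by simp [r', h]

theorem r'_le {i : α} (hi : i ∈ I.J) : I.r' i + I.k i ≤ 4 * I.m := by
  have := (I.hin i hi).2.1
  unfold r'
  split_ifs <;> omega

theorem wpos {i : α} (hi : i ∈ I.J) : 0 < I.w i := (I.hin i hi).2.2.1
theorem kpos {i : α} (hi : i ∈ I.J) : 0 < I.k i := (I.hin i hi).2.2.2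

theorem memJB {i : α} (hi : i ∈ I.B) : i ∈ I.J := Finset.mem_union_left _ hi
theorem memJV {i : α} (hi : i ∈ I.V) : i ∈ I.J := Finset.mem_union_right _ hi

theorem col_lt {i : α} (hi : i ∈ I.J) {c : ℕ} (hc : I.col i c) : c < I.W := by
  have := (I.hin i hi).1
  unfold col at hc
  omega

theorem U_r' {i : α} (h : I.U i) : 2 * I.m + 1 ≤ I.r' i := by
  rw [I.r'_U h]
  rcases I.U_cases h with h | h <;> omega

theorem r'_dj {i j : α} (hi : i ∈ I.J) (hj : j ∈ I.J) (hij : i ≠ j) {c : ℕ}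
    (hic : I.col i c) (hjc : I.col j c) :
    I.r' i + I.k i ≤ I.r' j ∨ I.r' j + I.k j ≤ I.r' i := by
  have key : ∀ i j : α, i ∈ I.J → j ∈ I.J → I.col i c → I.col j c → I.r i + I.k i ≤ I.r j →
      I.r' i + I.k i ≤ I.r' j := by
    intro i j hi hj hic hjc h
    have hab : I.above j i := ⟨hj, hi, h, c, hjc, hic⟩
    by_cases hU : I.U i
    · rw [I.r'_U hU, I.r'_U (I.U_above hU hab)]; omega
    · rw [I.r'_nU hU]
      unfold r'
      split_ifs <;> omega
  rcases I.hdj i hi j hj hij c hic.1 hic.2 hjc.1 hjc.2 with h | h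
  · exact Or.inl (key i j hi hj hic hjc h)
  · exact Or.inr (key j i hj hi hjc hic h)

theorem DU_gap {i j : α} (hi : i ∈ I.J) (hj : j ∈ I.J) {c : ℕ}
    (hic : I.col i c) (hjc : I.col j c) (hUi : ¬ I.U i) (hUj : I.U j) :
    I.r' i + I.k i + I.m ≤ I.r' j := by
  rw [I.r'_U hUj, I.r'_nU hUi]
  have hij : i ≠ j := by rintro rfl; exact hUi hUj
  rcases I.hdj i hi j hj hij c hic.1 hic.2 hjc.1 hjc.2 with h | h
  · omega
  · exact absurd (I.U_above hUj ⟨hi, hj, h, c, hic, hjc⟩) hUi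

theorem two_talls {i j : α} (hi : i ∈ I.J) (hj : j ∈ I.J) {c : ℕ}
    (hic : I.col i c) (hjc : I.col j c) (hti : I.Tall i) (htj : I.Tall j)
    (h : I.r i + I.k i ≤ I.r j) : I.U j ∧ ¬ I.U i ∧ I.r' i + I.k i < 2 * I.m := by
  have hab : I.above j i := ⟨hj, hi, h, c, hjc, hic⟩
  have hup : I.Up j := ⟨htj, i, hti, hab⟩
  have h1 := (I.hin j hj).2.1
  unfold Tall at hti htj
  have hU : ¬ I.U i := by
    intro hU
    rcases I.U_cases hU with h' | h' <;> omega
  refine ⟨hup.U, hU, ?_⟩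
  rw [I.r'_nU hU]; omega

/-- of two different talls in a column exactly one is lifted -/
theorem two_talls' {i j : α} (hi : i ∈ I.J) (hj : j ∈ I.J) (hij : i ≠ j) {c : ℕ}
    (hic : I.col i c) (hjc : I.col j c) (hti : I.Tall i) (htj : I.Tall j) :
    (I.U j ∧ ¬ I.U i ∧ I.r' i + I.k i < 2 * I.m) ∨ (I.U i ∧ ¬ I.U j ∧ I.r' j + I.k j < 2 * I.m) := by
  rcases I.hdj i hi j hj hij c hic.1 hic.2 hjc.1 hjc.2 with h | h
  · exact Or.inl (I.two_talls hi hj hic hjc hti htj h)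
  · exact Or.inr (I.two_talls hj hi hjc hic htj hti h)

/-! ### slabs -/

noncomputable def X : Finset ℕ :=
  {0, I.W} ∪ (I.B.image I.x ∪ I.B.image (fun b => I.x b + I.w b))

theorem X0 : 0 ∈ I.X := by simp [X]
theorem XW : I.W ∈ I.X := by simp [X]
theorem Xl {b : α} (hb : b ∈ I.B) : I.x b ∈ I.X := by
  simp only [X, Finset.mem_union, Finset.mem_image]; right; left; exact ⟨b, hb, rfl⟩
theorem Xr {b : α} (hb : b ∈ I.B) : I.x b + I.w b ∈ I.X := by
  simp only [X, Finset.mem_union, Finset.mem_image]; right; right; exact ⟨b, hb, rfl⟩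

theorem Xcard : I.X.card ≤ 2 * I.B.card + 2 := by
  unfold X
  refine (Finset.card_union_le _ _).trans ?_
  have h1 := Finset.card_le_two (a := 0) (b := I.W)
  have h2 := Finset.card_union_le (I.B.image I.x) (I.B.image (fun b => I.x b + I.w b))
  have h3 := Finset.card_image_le (s := I.B) (f := I.x)
  have h4 := Finset.card_image_le (s := I.B) (f := fun b => I.x b + I.w b)
  omega

/-- the slab of a column -/
noncomputable def sl (c : ℕ) : ℕ := lo I.X c

/-- the end of a slab -/
noncomputable def en (a : ℕ) : ℕ := hi I.X a

theorem sl_mem (c : ℕ) : I.sl c ∈ I.X := lo_mem I.X0 c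
theorem sl_le (c : ℕ) : I.sl c ≤ c := lo_le _ _
theorem lt_en {c : ℕ} (hc : c < I.W) : c < I.en (I.sl c) := (lo_hi I.X0 I.XW hc).1
theorem sl_eq {a c : ℕ} (ha : a ∈ I.X) (haW : a < I.W) (h1 : a ≤ c) (h2 : c < I.en a) : I.sl c = a :=
  (slab_eq I.XW haW ha h1 h2).1
theorem en_le {a : ℕ} (haW : a < I.W) : I.en a ≤ I.W := hi_le I.XW haW
theorem en_mem {a : ℕ} (haW : a < I.W) : I.en a ∈ I.X := (hi_spec I.XW haW).1
theorem lt_en' {a : ℕ} (haW : a < I.W) : a < I.en a := (hi_spec I.XW haW).2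

theorem block_sl {b : α} (hb : b ∈ I.B) {c : ℕ} (hc : c < I.W) :
    I.col b c ↔ I.col b (I.sl c) := by
  have h1 := I.sl_le c
  have h2 := I.lt_en hc
  constructor
  · rintro ⟨h3, h4⟩
    exact ⟨le_lo (I.Xl hb) h3, by omega⟩
  · rintro ⟨h3, h4⟩
    refine ⟨by omega, ?_⟩
    have : I.en (I.sl c) ≤ I.x b + I.w b := hi_le (I.Xr hb) h4
    omega

/-! ### the middle box -/

noncomputable def d (a : ℕ) : ℕ :=
  (I.B.filter (fun b => I.col b a ∧ ¬ I.U b)).sup (fun b => I.r' b + I.k b)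

noncomputable def u (a : ℕ) : ℕ :=
  4 * I.m - (I.B.filter (fun b => I.col b a ∧ I.U b)).sup (fun b => 4 * I.m - I.r' b)

noncomputable def mid (a : ℕ) : ℕ := max (I.d a + 1) (2 * I.m)

theorem le_d {a : ℕ} {b : α} (hb : b ∈ I.B) (hc : I.col b a) (hU : ¬ I.U b) :
    I.r' b + I.k b ≤ I.d a :=
  Finset.le_sup (f := fun b => I.r' b + I.k b) (by simp [hb, hc, hU])

theorem d_cases (a : ℕ) : I.d a = 0 ∨
    ∃ b ∈ I.B, I.col b a ∧ ¬ I.U b ∧ I.d a = I.r' b + I.k b := by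
  by_cases hne : (I.B.filter (fun b => I.col b a ∧ ¬ I.U b)).Nonempty
  · right
    obtain ⟨b, hb, he⟩ := Finset.exists_mem_eq_sup _ hne (fun b => I.r' b + I.k b)
    simp only [Finset.mem_filter] at hb
    exact ⟨b, hb.1, hb.2.1, hb.2.2, he⟩
  · left
    unfold d
    rw [Finset.not_nonempty_iff_eq_empty.1 hne]; simp

theorem u_le {a : ℕ} {b : α} (hb : b ∈ I.B) (hc : I.col b a) (hU : I.U b) : I.u a ≤ I.r' b := by
  have := Finset.le_sup (s := I.B.filter (fun b => I.col b a ∧ I.U b))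
    (f := fun b => 4 * I.m - I.r' b) (b := b) (by simp [hb, hc, hU])
  have h2 := I.r'_le (I.memJB hb)
  unfold u; omega

theorem u_le4 (a : ℕ) : I.u a ≤ 4 * I.m := by unfold u; omega

theorem u_cases (a : ℕ) : I.u a = 4 * I.m ∨
    ∃ b ∈ I.B, I.col b a ∧ I.U b ∧ I.u a = I.r' b := by
  by_cases hne : (I.B.filter (fun b => I.col b a ∧ I.U b)).Nonempty
  · right
    obtain ⟨b, hb, he⟩ := Finset.exists_mem_eq_sup _ hne (fun b => 4 * I.m - I.r' b)
    simp only [Finset.mem_filter] at hb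
    refine ⟨b, hb.1, hb.2.1, hb.2.2, ?_⟩
    have := I.r'_le (I.memJB hb.1)
    unfold u; rw [he]; omega
  · left
    unfold u
    rw [Finset.not_nonempty_iff_eq_empty.1 hne]; simp

/-- non-lifted items end `m` below `u` -/
theorem D_top {i : α} (hi : i ∈ I.J) {c : ℕ} (hc : I.col i c) (hU : ¬ I.U i) :
    I.r' i + I.k i + I.m ≤ I.u (I.sl c) := by
  rcases I.u_cases (I.sl c) with h | ⟨b, hb, hbc, hbU, h⟩
  · rw [h, I.r'_nU hU]
    have := (I.hin i hi).2.1
    omega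
  · rw [h]
    exact I.DU_gap hi (I.memJB hb) hc ((I.block_sl hb (I.col_lt hi hc)).2 hbc) hU hbU

/-- lifted items start `m` above `d` -/
theorem U_bot {i : α} (hi : i ∈ I.J) {c : ℕ} (hc : I.col i c) (hU : I.U i) :
    I.d (I.sl c) + I.m ≤ I.r' i := by
  rcases I.d_cases (I.sl c) with h | ⟨b, hb, hbc, hbU, h⟩
  · rw [h, I.r'_U hU]; omega
  · rw [h]
    exact I.DU_gap (I.memJB hb) hi ((I.block_sl hb (I.col_lt hi hc)).2 hbc) hc hbU hU

theorem d_u (a : ℕ) : I.d a + I.m ≤ I.u a := by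
  rcases I.u_cases a with h | ⟨b, hb, hbc, hbU, h⟩
  · rcases I.d_cases a with h' | ⟨b', hb', hbc', hbU', h'⟩
    · omega
    · rw [h, h', I.r'_nU hbU']
      have := (I.hin b' (I.memJB hb')).2.1
      omega
  · rcases I.d_cases a with h' | ⟨b', hb', hbc', hbU', h'⟩
    · rw [h', h, I.r'_U hbU]; omega
    · rw [h, h']
      exact I.DU_gap (I.memJB hb') (I.memJB hb) hbc' hbc hbU' hbU

theorem u_big (a : ℕ) : 2 * I.m + 1 ≤ I.u a := by
  rcases I.u_cases a with h | ⟨b, hb, hbc, hbU, h⟩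
  · have := I.hm; omega
  · rw [h]; exact I.U_r' hbU

theorem d_mid (a : ℕ) : I.d a < I.mid a := by unfold mid; omega
theorem mid_u (a : ℕ) : I.mid a < I.u a := by
  have := I.d_u a
  have := I.u_big a
  have := I.hm
  unfold mid; omega
theorem m2_mid (a : ℕ) : 2 * I.m ≤ I.mid a := by unfold mid; omega

end CoreIn



/-- disjoint intervals inside `[e,t)` -/
theorem sum_intervals {α : Type} (S : Finset α) (r k : α → ℕ) (e t : ℕ)
    (hin : ∀ i ∈ S, e ≤ r i ∧ r i + k i ≤ t)
    (hdj : ∀ i ∈ S, ∀ j ∈ S, i ≠ j → r i + k i ≤ r j ∨ r j + k j ≤ r i) :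
    ∑ i ∈ S, k i ≤ t - e := by
  have h1 : (S.biUnion (fun i => Finset.Ico (r i) (r i + k i))).card = ∑ i ∈ S, k i := by
    rw [Finset.card_biUnion]
    · simp
    · intro i hi j hj hij
      simp only [Function.onFun]
      rw [Finset.disjoint_left]
      intro y hy hy'
      simp only [Finset.mem_Ico] at hy hy'
      rcases hdj i hi j hj hij with h | h <;> omega
  rw [← h1, ← Nat.card_Ico]
  apply Finset.card_le_card
  intro y hy
  simp only [Finset.mem_biUnion, Finset.mem_Ico] at hy ⊢
  obtain ⟨i, hi, h⟩ := hy
  have := hin i hi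
  omega

/-- splitting small pieces into two bins -/
theorem two_bins {α : Type} (S : Finset α) (k : α → ℕ) (m c1 c2 : ℕ)
    (hk : ∀ i ∈ S, k i ≤ m) (hs : ∑ i ∈ S, k i + m ≤ c1 + c2) :
    ∃ S1 ⊆ S, ∑ i ∈ S1, k i ≤ c1 ∧ ∑ i ∈ S \ S1, k i ≤ c2 := by
  obtain ⟨P, hP, h1, -, h3⟩ := prefix_lemma S (fun _ => 0) k c1
  refine ⟨P, hP, h1, ?_⟩
  have h4 := Finset.sum_sdiff (f := k) hP
  rcases h3 with rfl | ⟨j, hj, -, h5⟩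
  · simp
  · have := hk j hj
    omega

namespace CoreIn

variable {α : Type} (I : CoreIn α)

noncomputable def Y (a : ℕ) : Finset ℕ :=
  {0, 4 * I.m, I.mid a} ∪ ((I.B.filter (fun b => I.col b a)).image I.r' ∪
    (I.B.filter (fun b => I.col b a)).image (fun b => I.r' b + I.k b))

theorem mem_Y {a y : ℕ} : y ∈ I.Y a ↔ (y = 0 ∨ y = 4 * I.m ∨ y = I.mid a) ∨
    ∃ b ∈ I.B, I.col b a ∧ (y = I.r' b ∨ y = I.r' b + I.k b) := by
  simp only [Y, Finset.mem_union, Finset.mem_insert, Finset.mem_singleton, Finset.mem_image,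
    Finset.mem_filter]
  constructor
  · rintro (h | ⟨b, hb, h⟩ | ⟨b, hb, h⟩)
    · exact Or.inl h
    · exact Or.inr ⟨b, hb.1, hb.2, Or.inl h.symm⟩
    · exact Or.inr ⟨b, hb.1, hb.2, Or.inr h.symm⟩
  · rintro (h | ⟨b, hb, hc, h | h⟩)
    · exact Or.inl h
    · exact Or.inr (Or.inl ⟨b, ⟨hb, hc⟩, h.symm⟩)
    · exact Or.inr (Or.inr ⟨b, ⟨hb, hc⟩, h.symm⟩)

theorem Y_le {a y : ℕ} (hy : y ∈ I.Y a) : y ≤ 4 * I.m := by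
  rw [mem_Y] at hy
  rcases hy with (h | h | h) | ⟨b, hb, hc, h⟩
  · omega
  · omega
  · have := I.mid_u a
    have := I.u_le4 a
    omega
  · have := I.r'_le (I.memJB hb)
    omega

theorem Ycard (a : ℕ) : (I.Y a).card ≤ 4 * I.m + 1 := by
  have : I.Y a ⊆ Finset.range (4 * I.m + 1) := by
    intro y hy
    have := I.Y_le hy
    simp; omega
  simpa using Finset.card_le_card this

theorem Y0 (a : ℕ) : 0 ∈ I.Y a := by rw [mem_Y]; simp
theorem Y4 (a : ℕ) : 4 * I.m ∈ I.Y a := by rw [mem_Y]; simp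
theorem Ymid (a : ℕ) : I.mid a ∈ I.Y a := by rw [mem_Y]; simp
theorem Yd (a : ℕ) : I.d a ∈ I.Y a := by
  rw [mem_Y]
  rcases I.d_cases a with h | ⟨b, hb, h1, h2, h3⟩
  · exact Or.inl (Or.inl h)
  · exact Or.inr ⟨b, hb, h1, Or.inr h3⟩
theorem Yu (a : ℕ) : I.u a ∈ I.Y a := by
  rw [mem_Y]
  rcases I.u_cases a with h | ⟨b, hb, h1, h2, h3⟩
  · exact Or.inl (Or.inr (Or.inl h))
  · exact Or.inr ⟨b, hb, h1, Or.inl h3⟩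

theorem Y_mid {a y : ℕ} (hy : y ∈ I.Y a) (h1 : I.d a < y) (h2 : y < I.u a) : y = I.mid a := by
  rw [mem_Y] at hy
  rcases hy with (h | h | h) | ⟨b, hb, hc, h⟩
  · omega
  · have := I.u_le4 a
    omega
  · exact h
  · exfalso
    by_cases hU : I.U b
    · have := I.u_le hb hc hU
      omega
    · have := I.le_d hb hc hU
      omega

/-- top of a layer -/
noncomputable def tp (a e : ℕ) : ℕ := hi (I.Y a) e

theorem tp_mem {a e : ℕ} (he : e < 4 * I.m) : I.tp a e ∈ I.Y a := (hi_spec (I.Y4 a) he).1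
theorem lt_tp {a e : ℕ} (he : e < 4 * I.m) : e < I.tp a e := (hi_spec (I.Y4 a) he).2
theorem tp_le {a e y : ℕ} (hy : y ∈ I.Y a) (h : e < y) : I.tp a e ≤ y := hi_le hy h
theorem tp_le4 {a e : ℕ} (he : e < 4 * I.m) : I.tp a e ≤ 4 * I.m := hi_le (I.Y4 a) he

theorem d_lt4 (a : ℕ) : I.d a < 4 * I.m := by
  have := I.d_mid a; have := I.mid_u a; have := I.u_le4 a; omega
theorem mid_lt4 (a : ℕ) : I.mid a < 4 * I.m := by
  have := I.mid_u a; have := I.u_le4 a; omega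

theorem tp_d (a : ℕ) : I.tp a (I.d a) = I.mid a := by
  have h1 := I.tp_le (I.Ymid a) (I.d_mid a)
  have h2 := I.lt_tp (a := a) (I.d_lt4 a)
  have := I.mid_u a
  exact I.Y_mid (I.tp_mem (I.d_lt4 a)) h2 (by omega)

theorem tp_mid (a : ℕ) : I.tp a (I.mid a) = I.u a := by
  have h1 := I.tp_le (I.Yu a) (I.mid_u a)
  have h2 := I.lt_tp (a := a) (I.mid_lt4 a)
  have h3 := I.d_mid a
  by_contra h
  have := I.Y_mid (I.tp_mem (a := a) (I.mid_lt4 a)) (by omega) (by omega)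
  omega

/-- position of a layer -/
theorem layer_cases {a e : ℕ} (he : e ∈ I.Y a) :
    I.tp a e ≤ I.d a ∨ e = I.d a ∨ e = I.mid a ∨ I.u a ≤ e := by
  by_cases h1 : e < I.d a
  · exact Or.inl (I.tp_le (I.Yd a) h1)
  by_cases h2 : e = I.d a
  · exact Or.inr (Or.inl h2)
  by_cases h3 : I.u a ≤ e
  · exact Or.inr (Or.inr (Or.inr h3))
  exact Or.inr (Or.inr (Or.inl (I.Y_mid he (by omega) (by omega))))

/-- layers of one slab are row-disjoint -/
theorem layer_dj {a e e' : ℕ} (he : e ∈ I.Y a) (he' : e' ∈ I.Y a) (h : e ≠ e') :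
    I.tp a e ≤ e' ∨ I.tp a e' ≤ e := by
  rcases lt_or_gt_of_ne h with h | h
  · exact Or.inl (I.tp_le he' h)
  · exact Or.inr (I.tp_le he h)

theorem nocross {i : α} (hi : i ∈ I.V) {c y : ℕ} (hc : I.col i c) (hy : y ∈ I.Y (I.sl c))
    (hym : y ≠ I.mid (I.sl c)) : y ≤ I.r' i ∨ I.r' i + I.k i ≤ y := by
  have hiJ := I.memJV hi
  have h4 := I.r'_le hiJ
  rw [mem_Y] at hy
  rcases hy with (h | h | h) | ⟨b, hb, hcb, h⟩
  · omega
  · omega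
  · exact absurd h hym
  · have hbi : b ≠ i := by
      rintro rfl
      exact (Finset.disjoint_left.1 I.hBV) hb hi
    have := I.r'_dj (I.memJB hb) hiJ hbi ((I.block_sl hb (I.col_lt hiJ hc)).2 hcb) hc
    have := I.kpos (I.memJB hb)
    have := I.kpos hiJ
    omega

def Touch (i : α) (a e : ℕ) : Prop := I.r' i < I.tp a e ∧ e < I.r' i + I.k i

/-- a layer touched by an item contains no block -/
theorem block_layer {i b : α} (hi : i ∈ I.V) (hb : b ∈ I.B) {c e : ℕ} (hc : I.col i c)
    (hbc : I.col b (I.sl c)) (he : e ∈ I.Y (I.sl c)) (he4 : e < 4 * I.m)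
    (ht : I.Touch i (I.sl c) e) : I.r' b + I.k b ≤ e ∨ I.tp (I.sl c) e ≤ I.r' b := by
  have hiJ := I.memJV hi
  have hbi : b ≠ i := by
    rintro rfl
    exact (Finset.disjoint_left.1 I.hBV) hb hi
  have hdj := I.r'_dj (I.memJB hb) hiJ hbi ((I.block_sl hb (I.col_lt hiJ hc)).2 hbc) hc
  obtain ⟨h1, h2⟩ := ht
  have h3 : I.r' b ∈ I.Y (I.sl c) := by rw [mem_Y]; exact Or.inr ⟨b, hb, hbc, Or.inl rfl⟩
  have h4 : I.r' b + I.k b ∈ I.Y (I.sl c) := by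
    rw [mem_Y]; exact Or.inr ⟨b, hb, hbc, Or.inr rfl⟩
  rcases hdj with h | h
  · left
    by_contra hcon
    have := I.tp_le (e := e) h4 (by omega)
    omega
  · right
    exact I.tp_le (e := e) h3 (by omega)

theorem Q_noblock {b : α} (hb : b ∈ I.B) {a : ℕ} (hbc : I.col b a) :
    I.r' b + I.k b ≤ I.d a ∨ I.u a ≤ I.r' b := by
  by_cases hU : I.U b
  · exact Or.inr (I.u_le hb hbc hU)
  · exact Or.inl (I.le_d hb hbc hU)

theorem inQ_top {i : α} (hi : i ∈ I.V) {c : ℕ} (hc : I.col i c) (h : I.r' i < I.u (I.sl c)) :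
    I.r' i + I.k i ≤ I.u (I.sl c) := by
  rcases I.nocross hi hc (I.Yu _) (by have := I.mid_u (I.sl c); omega) with h' | h'
  · omega
  · exact h'

theorem touch_d {i : α} (hi : i ∈ I.V) {c : ℕ} (hc : I.col i c)
    (h : I.Touch i (I.sl c) (I.d (I.sl c))) : I.d (I.sl c) ≤ I.r' i ∧ I.r' i < I.mid (I.sl c) := by
  obtain ⟨h1, h2⟩ := h
  rw [I.tp_d] at h1
  rcases I.nocross hi hc (I.Yd _) (by have := I.d_mid (I.sl c); omega) with h' | h'
  · exact ⟨h', h1⟩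
  · omega

theorem touch_mid {i : α} (hi : i ∈ I.V) {c : ℕ} (hc : I.col i c)
    (h : I.Touch i (I.sl c) (I.mid (I.sl c))) :
    I.d (I.sl c) ≤ I.r' i ∧ I.r' i + I.k i ≤ I.u (I.sl c) := by
  obtain ⟨h1, h2⟩ := h
  rw [I.tp_mid] at h1
  refine ⟨?_, I.inQ_top hi hc h1⟩
  rcases I.nocross hi hc (I.Yd _) (by have := I.d_mid (I.sl c); omega) with h' | h'
  · exact h'
  · have := I.d_mid (I.sl c)
    omega

/-- at most one tall per column and layer -/
theorem touch_unique {i j : α} (hi : i ∈ I.V) (hj : j ∈ I.V) {c e : ℕ} (hic : I.col i c)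
    (hjc : I.col j c) (hti : I.Tall i) (htj : I.Tall j) (he : e ∈ I.Y (I.sl c))
    (he4 : e < 4 * I.m) (h1 : I.Touch i (I.sl c) e) (h2 : I.Touch j (I.sl c) e) : i = j := by
  by_contra hij
  have key : ∀ i j : α, i ∈ I.V → j ∈ I.V → I.col i c → I.col j c → I.Touch i (I.sl c) e →
      I.Touch j (I.sl c) e → ¬ (I.U j ∧ ¬ I.U i ∧ I.r' i + I.k i < 2 * I.m) := by
    rintro i j hi hj hic hjc ⟨h1, h2⟩ ⟨h3, h4⟩ ⟨hU, hnU, hlt⟩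
    have h5 := I.U_r' hU
    have h6 := I.U_bot (I.memJV hj) hjc hU
    have h7 := I.D_top (I.memJV hi) hic hnU
    have h8 := I.m2_mid (I.sl c)
    have h9 := I.hm
    rcases I.layer_cases he with h | h | h | h
    · omega
    · rw [h, I.tp_d] at h3
      unfold mid at h3 h8
      omega
    · omega
    · omega
  rcases I.two_talls' (I.memJV hi) (I.memJV hj) hij hic hjc hti htj with h | h
  · exact key i j hi hj hic hjc h1 h2 h
  · exact key j i hj hi hjc hic h2 h1 h

/-- height of the tall of column `c` in layer `(a,e)` -/
noncomputable def T (a e c : ℕ) : ℕ :=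
  (I.V.filter (fun i => I.Tall i ∧ I.col i c ∧ I.Touch i a e)).sup I.k

theorem T_eq {i : α} (hi : i ∈ I.V) {c e : ℕ} (hic : I.col i c)
    (hti : I.Tall i) (he : e ∈ I.Y (I.sl c))
    (he4 : e < 4 * I.m) (h1 : I.Touch i (I.sl c) e) : I.T (I.sl c) e c = I.k i := by
  have : I.V.filter (fun i => I.Tall i ∧ I.col i c ∧ I.Touch i (I.sl c) e) = {i} := by
    ext j
    simp only [Finset.mem_filter, Finset.mem_singleton]
    constructor
    · rintro ⟨hj, h2, h3, h4⟩
      exact I.touch_unique hj hi h3 hic h2 hti he he4 h4 h1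
    · rintro rfl
      exact ⟨hi, hti, hic, h1⟩
  unfold T
  rw [this]; simp

theorem T_cases (a e c : ℕ) : I.T a e c = 0 ∨
    ∃ i ∈ I.V, I.Tall i ∧ I.col i c ∧ I.Touch i a e ∧ I.T a e c = I.k i := by
  by_cases hne : (I.V.filter (fun i => I.Tall i ∧ I.col i c ∧ I.Touch i a e)).Nonempty
  · right
    obtain ⟨b, hb, he⟩ := Finset.exists_mem_eq_sup _ hne I.k
    simp only [Finset.mem_filter] at hb
    exact ⟨b, hb.1, hb.2.1, hb.2.2.1, hb.2.2.2, he⟩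
  · left
    unfold T
    rw [Finset.not_nonempty_iff_eq_empty.1 hne]; simp

theorem T_le (a e c : ℕ) : I.T a e c ≤ 4 * I.m := by
  rcases I.T_cases a e c with h | ⟨i, hi, -, -, -, h⟩
  · omega
  · have := I.r'_le (I.memJV hi)
    omega

end CoreIn



namespace CoreIn

variable {α : Type} (I : CoreIn α)

/-- column `c` of slab `a` is covered by a tall touching both middle layers -/
def hug (a c : ℕ) : Prop :=
  ∃ i ∈ I.V, I.Tall i ∧ I.col i c ∧ I.Touch i a (I.d a) ∧ I.Touch i a (I.mid a)

noncomputable def Foff (a e c : ℕ) : ℕ := if e = I.mid a ∧ I.hug a c then 0 else I.T a e c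

noncomputable def Sq (c : ℕ) : Finset α :=
  I.V.filter (fun i => ¬ I.Tall i ∧ I.col i c ∧ I.d (I.sl c) ≤ I.r' i ∧ I.r' i < I.u (I.sl c))

theorem Qsum {c : ℕ} :
    I.T (I.sl c) (I.d (I.sl c)) c + I.Foff (I.sl c) (I.mid (I.sl c)) c + ∑ i ∈ I.Sq c, I.k i + I.m
      ≤ I.u (I.sl c) - I.d (I.sl c) := by
  let A := I.V.filter (fun i => I.col i c ∧ I.d (I.sl c) ≤ I.r' i ∧ I.r' i < I.u (I.sl c))
  have hA : ∑ i ∈ A, I.k i ≤ (I.u (I.sl c) - I.m) - I.d (I.sl c) := by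
    apply sum_intervals A I.r
    · intro i hi
      simp only [A, Finset.mem_filter] at hi
      obtain ⟨hiV, hic, h1, h2⟩ := hi
      by_cases hU : I.U i
      · have h3 := I.U_bot (I.memJV hiV) hic hU
        have h4 := I.inQ_top hiV hic h2
        have h5 := I.r'_U hU
        omega
      · have h3 := I.D_top (I.memJV hiV) hic hU
        have h5 := I.r'_nU hU
        omega
    · intro i hi j hj hij
      simp only [A, Finset.mem_filter] at hi hj
      exact I.hdj i (I.memJV hi.1) j (I.memJV hj.1) hij c hi.2.1.1 hi.2.1.2 hj.2.1.1 hj.2.1.2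
  have hsplit := Finset.sum_filter_add_sum_filter_not A (fun i => I.Tall i) I.k
  have hSq : A.filter (fun i => ¬ I.Tall i) = I.Sq c := by
    ext i
    simp only [A, Sq, Finset.mem_filter]
    tauto
  rw [hSq] at hsplit
  have hdu := I.d_u (I.sl c)
  have hmem1 : ∀ i ∈ I.V, I.Tall i → I.col i c → I.Touch i (I.sl c) (I.d (I.sl c)) →
      i ∈ A.filter (fun i => I.Tall i) := by
    intro i hi ht hc htc
    have h1 := I.touch_d hi hc htc
    have := I.mid_u (I.sl c)
    simp only [A, Finset.mem_filter]
    exact ⟨⟨hi, hc, h1.1, by omega⟩, ht⟩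
  have hmem2 : ∀ i ∈ I.V, I.Tall i → I.col i c → I.Touch i (I.sl c) (I.mid (I.sl c)) →
      i ∈ A.filter (fun i => I.Tall i) := by
    intro i hi ht hc htc
    have h1 := I.touch_mid hi hc htc
    have := I.kpos (I.memJV hi)
    simp only [A, Finset.mem_filter]
    exact ⟨⟨hi, hc, h1.1, by omega⟩, ht⟩
  have hT : I.T (I.sl c) (I.d (I.sl c)) c + I.Foff (I.sl c) (I.mid (I.sl c)) c ≤ ∑ i ∈ A with I.Tall i, I.k i := by
    have hF : I.Foff (I.sl c) (I.mid (I.sl c)) c = 0 ∨ ¬ I.hug (I.sl c) c ∧ ∃ i ∈ I.V, I.Tall i ∧ I.col i c ∧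
        I.Touch i (I.sl c) (I.mid (I.sl c)) ∧ I.Foff (I.sl c) (I.mid (I.sl c)) c = I.k i := by
      unfold Foff
      by_cases hh : I.hug (I.sl c) c
      · simp [hh]
      · simp only [hh, and_false, if_false]
        rcases I.T_cases (I.sl c) (I.mid (I.sl c)) c with h | h
        · exact Or.inl h
        · exact Or.inr ⟨not_false, h⟩
    rcases I.T_cases (I.sl c) (I.d (I.sl c)) c with h1 | ⟨i, hi, hti, hci, htc, h1⟩
    · rw [h1]
      rcases hF with h2 | ⟨-, j, hj, htj, hcj, htcj, h2⟩
      · omega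
      · rw [h2, zero_add]
        exact Finset.single_le_sum (fun _ _ => Nat.zero_le _) (hmem2 j hj htj hcj htcj)
    · rw [h1]
      rcases hF with h2 | ⟨hh, j, hj, htj, hcj, htcj, h2⟩
      · rw [h2, add_zero]
        exact Finset.single_le_sum (fun _ _ => Nat.zero_le _) (hmem1 i hi hti hci htc)
      · rw [h2]
        have hij : i ≠ j := by
          rintro rfl
          exact hh ⟨i, hi, hti, hci, htc, htcj⟩
        rw [← Finset.sum_pair hij]
        apply Finset.sum_le_sum_of_subset
        intro l hl
        simp only [Finset.mem_insert, Finset.mem_singleton] at hl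
        rcases hl with rfl | rfl
        · exact hmem1 _ hi hti hci htc
        · exact hmem2 _ hj htj hcj htcj
  omega

noncomputable def c1 (c : ℕ) : ℕ :=
  (I.mid (I.sl c) - I.d (I.sl c)) - I.T (I.sl c) (I.d (I.sl c)) c

noncomputable def c2 (c : ℕ) : ℕ :=
  if I.hug (I.sl c) c then
    min (I.u (I.sl c) - I.mid (I.sl c))
      (I.u (I.sl c) - I.d (I.sl c) - I.T (I.sl c) (I.d (I.sl c)) c)
  else (I.u (I.sl c) - I.mid (I.sl c)) - I.T (I.sl c) (I.mid (I.sl c)) c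

/-- a tall of the lower middle layer that is not huge stays below `mid` -/
theorem low_le {c : ℕ} (hh : ¬ I.hug (I.sl c) c) :
    I.T (I.sl c) (I.d (I.sl c)) c ≤ I.mid (I.sl c) - I.d (I.sl c) := by
  rcases I.T_cases (I.sl c) (I.d (I.sl c)) c with h1 | ⟨i, hi, hti, hci, htc, h1⟩
  · omega
  · have h2 := I.touch_d hi hci htc
    have h3 : ¬ I.Touch i (I.sl c) (I.mid (I.sl c)) := fun h => hh ⟨i, hi, hti, hci, htc, h⟩
    unfold Touch at h3
    rw [I.tp_mid] at h3
    have := I.mid_u (I.sl c)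
    omega

theorem upp_le {c : ℕ} (hh : ¬ I.hug (I.sl c) c) :
    I.T (I.sl c) (I.mid (I.sl c)) c ≤ I.u (I.sl c) - I.mid (I.sl c) := by
  rcases I.T_cases (I.sl c) (I.mid (I.sl c)) c with h1 | ⟨i, hi, hti, hci, htc, h1⟩
  · omega
  · have h2 := I.touch_mid hi hci htc
    have h3 : ¬ I.Touch i (I.sl c) (I.d (I.sl c)) := fun h => hh ⟨i, hi, hti, hci, h, htc⟩
    unfold Touch at h3
    rw [I.tp_d] at h3
    have := I.mid_u (I.sl c)
    have := I.d_mid (I.sl c)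
    have := I.kpos (I.memJV hi)
    omega

theorem bins (c : ℕ) : ∃ S1 ⊆ I.Sq c, ∑ i ∈ S1, I.k i ≤ I.c1 c ∧ ∑ i ∈ I.Sq c \ S1, I.k i ≤ I.c2 c := by
  apply two_bins _ _ I.m
  · intro i hi
    have := (Finset.mem_filter.1 hi).2.1
    unfold Tall at this
    omega
  · have h1 := I.Qsum (c := c)
    have h2 := I.d_mid (I.sl c)
    have h3 := I.mid_u (I.sl c)
    unfold c1 c2
    unfold Foff at h1
    split_ifs with hh
    · omega
    · have h4 := I.low_le hh
      have h5 := I.upp_le hh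
      rw [if_neg (by tauto)] at h1
      omega

noncomputable def S1 (c : ℕ) : Finset α := (I.bins c).choose
theorem S1_sub (c : ℕ) : I.S1 c ⊆ I.Sq c := (I.bins c).choose_spec.1
theorem S1_sum (c : ℕ) : ∑ i ∈ I.S1 c, I.k i ≤ I.c1 c := (I.bins c).choose_spec.2.1
theorem S2_sum (c : ℕ) : ∑ i ∈ I.Sq c \ I.S1 c, I.k i ≤ I.c2 c := (I.bins c).choose_spec.2.2

/-- the layer of the slice of item `i` in column `c` -/
noncomputable def lay (c : ℕ) (i : α) : ℕ :=
  if i ∈ I.Sq c then (if i ∈ I.S1 c then I.d (I.sl c) else I.mid (I.sl c))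
  else lo (I.Y (I.sl c)) (I.r' i)

noncomputable def NT (e c : ℕ) : Finset α :=
  I.V.filter (fun i => ¬ I.Tall i ∧ I.col i c ∧ I.lay c i = e)

noncomputable def z (e c : ℕ) : ℕ := ∑ i ∈ I.NT e c, I.k i

theorem lay_mem {i : α} (hi : i ∈ I.V) (c : ℕ) :
    I.lay c i ∈ I.Y (I.sl c) ∧ I.lay c i < 4 * I.m := by
  unfold lay
  split_ifs
  · exact ⟨I.Yd _, I.d_lt4 _⟩
  · exact ⟨I.Ymid _, I.mid_lt4 _⟩
  · refine ⟨lo_mem (I.Y0 _) _, ?_⟩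
    have := lo_le (I.Y (I.sl c)) (I.r' i)
    have := I.r'_le (I.memJV hi)
    have := I.kpos (I.memJV hi)
    omega

theorem lo_range {i : α} (hi : i ∈ I.V) (c : ℕ) : lo (I.Y (I.sl c)) (I.r' i) ≤ I.r' i ∧
    I.r' i < I.tp (I.sl c) (lo (I.Y (I.sl c)) (I.r' i)) := by
  have := I.r'_le (I.memJV hi)
  have := I.kpos (I.memJV hi)
  exact ⟨lo_le _ _, (lo_hi (I.Y0 _) (I.Y4 _) (by omega)).1⟩

theorem NT_d (c : ℕ) : I.NT (I.d (I.sl c)) c ⊆ I.S1 c := by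
  intro i hi
  simp only [NT, Finset.mem_filter] at hi
  obtain ⟨hiV, ht, hc, hl⟩ := hi
  have h1 := I.d_mid (I.sl c)
  have h2 := I.mid_u (I.sl c)
  unfold lay at hl
  split_ifs at hl with h3 h4
  · exact h4
  · omega
  · exfalso
    have h5 := I.lo_range hiV c
    rw [hl, I.tp_d] at h5
    apply h3
    simp only [Sq, Finset.mem_filter]
    exact ⟨hiV, ht, hc, h5.1, by omega⟩

theorem NT_mid (c : ℕ) : I.NT (I.mid (I.sl c)) c ⊆ I.Sq c \ I.S1 c := by
  intro i hi
  simp only [NT, Finset.mem_filter] at hi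
  obtain ⟨hiV, ht, hc, hl⟩ := hi
  have h1 := I.d_mid (I.sl c)
  have h2 := I.mid_u (I.sl c)
  unfold lay at hl
  split_ifs at hl with h3 h4
  · omega
  · simp [h3, h4]
  · exfalso
    have h5 := I.lo_range hiV c
    rw [hl, I.tp_mid] at h5
    apply h3
    simp only [Sq, Finset.mem_filter]
    exact ⟨hiV, ht, hc, by omega, by omega⟩

theorem z_d (c : ℕ) : I.z (I.d (I.sl c)) c ≤ I.c1 c :=
  (Finset.sum_le_sum_of_subset (I.NT_d c)).trans (I.S1_sum c)

theorem z_mid (c : ℕ) : I.z (I.mid (I.sl c)) c ≤ I.c2 c :=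
  (Finset.sum_le_sum_of_subset (I.NT_mid c)).trans (I.S2_sum c)

/-- average free space -/
theorem z_total (c : ℕ) :
    (I.T (I.sl c) (I.d (I.sl c)) c + I.z (I.d (I.sl c)) c) +
    (I.Foff (I.sl c) (I.mid (I.sl c)) c + I.z (I.mid (I.sl c)) c) + I.m
      ≤ I.u (I.sl c) - I.d (I.sl c) := by
  have h1 := I.Qsum (c := c)
  have h2 := Finset.sum_sdiff (f := I.k) (I.S1_sub c)
  have h3 := Finset.sum_le_sum_of_subset (f := I.k) (I.NT_d c)
  have h4 := Finset.sum_le_sum_of_subset (f := I.k) (I.NT_mid c)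
  unfold z
  omega

/-- items outside of the middle box stay in their layer -/
theorem touch_O {i : α} (hi : i ∈ I.V) {c e : ℕ} (hc : I.col i c) (he : e ∈ I.Y (I.sl c))
    (hed : e ≠ I.d (I.sl c)) (hem : e ≠ I.mid (I.sl c)) (he4 : e < 4 * I.m)
    (ht : I.Touch i (I.sl c) e) : e ≤ I.r' i ∧ I.r' i + I.k i ≤ I.tp (I.sl c) e := by
  obtain ⟨h1, h2⟩ := ht
  have h3 : e ≤ I.r' i := by
    rcases I.nocross hi hc he hem with h | h
    · exact h
    · omega
  refine ⟨h3, ?_⟩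
  by_cases h4 : I.tp (I.sl c) e = I.mid (I.sl c)
  · exfalso
    have h5 := I.lt_tp (a := I.sl c) he4
    have h6 := I.mid_u (I.sl c)
    have h7 := I.d_mid (I.sl c)
    rcases I.layer_cases he with h | h | h | h <;> omega
  · rcases I.nocross hi hc (I.tp_mem he4) h4 with h | h
    · omega
    · exact h

theorem z_O {c e : ℕ} (he : e ∈ I.Y (I.sl c))
    (hed : e ≠ I.d (I.sl c)) (hem : e ≠ I.mid (I.sl c)) (he4 : e < 4 * I.m) :
    I.T (I.sl c) e c + I.z e c ≤ I.tp (I.sl c) e - e := by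
  let A := I.V.filter (fun i => I.col i c ∧ I.Touch i (I.sl c) e)
  have hA : ∑ i ∈ A, I.k i ≤ I.tp (I.sl c) e - e := by
    apply sum_intervals A I.r'
    · intro i hi
      simp only [A, Finset.mem_filter] at hi
      exact I.touch_O hi.1 hi.2.1 he hed hem he4 hi.2.2
    · intro i hi j hj hij
      simp only [A, Finset.mem_filter] at hi hj
      exact I.r'_dj (I.memJV hi.1) (I.memJV hj.1) hij hi.2.1 hj.2.1
  have hsplit := Finset.sum_filter_add_sum_filter_not A (fun i => I.Tall i) I.k
  have h1 : I.NT e c ⊆ A.filter (fun i => ¬ I.Tall i) := by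
    intro i hi
    simp only [NT, Finset.mem_filter] at hi
    simp only [A, Finset.mem_filter]
    obtain ⟨hiV, ht, hc, hl⟩ := hi
    refine ⟨⟨hiV, hc, ?_⟩, ht⟩
    unfold lay at hl
    split_ifs at hl with h3 h4
    · exact absurd hl.symm hed
    · exact absurd hl.symm hem
    · have h5 := I.lo_range hiV c
      rw [hl] at h5
      have := I.kpos (I.memJV hiV)
      exact ⟨h5.2, by omega⟩
  have h2 : I.z e c ≤ _ := Finset.sum_le_sum_of_subset h1
  have h3 : I.T (I.sl c) e c ≤ ∑ i ∈ A with I.Tall i, I.k i := by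
    rcases I.T_cases (I.sl c) e c with h | ⟨i, hi, hti, hci, htc, h⟩
    · omega
    · rw [h]
      apply Finset.single_le_sum (f := I.k) (fun _ _ => Nat.zero_le _)
      simp only [A, Finset.mem_filter]
      exact ⟨⟨hi, hci, htc⟩, hti⟩
  omega

/-- uniform capacity statement -/
theorem cap_low {c e : ℕ} (he : e ∈ I.Y (I.sl c)) (hem : e ≠ I.mid (I.sl c)) (he4 : e < 4 * I.m)
    (hz : 0 < I.z e c) : I.T (I.sl c) e c + I.z e c ≤ I.tp (I.sl c) e - e := by
  by_cases hed : e = I.d (I.sl c)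
  · have h := I.z_d c
    rw [← hed] at h
    unfold c1 at h
    rw [← hed] at h
    rw [hed, I.tp_d]
    rw [hed] at h hz
    omega
  · exact I.z_O he hed hem he4

theorem cap_up (c : ℕ) : I.Foff (I.sl c) (I.mid (I.sl c)) c + I.z (I.mid (I.sl c)) c ≤
    I.u (I.sl c) - I.mid (I.sl c) := by
  have h := I.z_mid c
  unfold c2 at h
  unfold Foff
  split_ifs at h with hh
  · rw [if_pos ⟨rfl, hh⟩]; omega
  · rw [if_neg (by tauto)]
    have := I.upp_le hh
    omega

theorem cap_hug (c : ℕ) :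
    I.T (I.sl c) (I.d (I.sl c)) c + I.z (I.mid (I.sl c)) c ≤ I.u (I.sl c) - I.d (I.sl c) := by
  have h := I.z_total c
  omega

/-- T in the lower layer for non-huge columns -/
theorem T_cap {c e : ℕ} (he : e ∈ I.Y (I.sl c)) (he4 : e < 4 * I.m)
    (hh : ¬ ((e = I.d (I.sl c) ∨ e = I.mid (I.sl c)) ∧ I.hug (I.sl c) c)) :
    I.T (I.sl c) e c ≤ I.tp (I.sl c) e - e := by
  by_cases hed : e = I.d (I.sl c)
  · have := I.low_le (c := c) (fun h => hh ⟨Or.inl hed, h⟩)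
    rw [hed, I.tp_d]; exact this
  · by_cases hem : e = I.mid (I.sl c)
    · have := I.upp_le (c := c) (fun h => hh ⟨Or.inr hem, h⟩)
      rw [hem, I.tp_mid]; exact this
    · have := I.z_O he hed hem he4
      omega

end CoreIn



/-! ### sorting columns by a key -/

def stt (p q : ℕ) (key : ℕ → ℕ) (c : ℕ) : ℕ := p + ((Finset.Ico p q).filter (fun x => key x < c)).card
def ctt (p q : ℕ) (key : ℕ → ℕ) (c : ℕ) : ℕ := ((Finset.Ico p q).filter (fun x => key x = c)).card

theorem stt_succ (p q : ℕ) (key : ℕ → ℕ) (c : ℕ) :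
    stt p q key c + ctt p q key c = stt p q key (c + 1) := by
  unfold stt ctt
  rw [add_assoc, ← Finset.card_union_of_disjoint]
  · congr 2
    ext x
    simp only [Finset.mem_union, Finset.mem_filter]
    constructor
    · rintro (h | h)
      · exact ⟨h.1, by omega⟩
      · exact ⟨h.1, by omega⟩
    · rintro ⟨h1, h2⟩
      rcases Nat.lt_succ_iff_lt_or_eq.1 h2 with h | h
      · exact Or.inl ⟨h1, h⟩
      · exact Or.inr ⟨h1, h⟩
  · rw [Finset.disjoint_left]
    intro x hx hx'
    simp only [Finset.mem_filter] at hx hx'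
    omega

theorem stt_mono (p q : ℕ) (key : ℕ → ℕ) {c c' : ℕ} (h : c ≤ c') : stt p q key c ≤ stt p q key c' := by
  unfold stt
  apply Nat.add_le_add_left
  apply Finset.card_le_card
  intro x hx
  simp only [Finset.mem_filter] at hx ⊢
  exact ⟨hx.1, by omega⟩

theorem stt_ge (p q : ℕ) (key : ℕ → ℕ) (c : ℕ) : p ≤ stt p q key c := by unfold stt; omega

theorem stt_le {p q : ℕ} (hpq : p ≤ q) (key : ℕ → ℕ) (c : ℕ) : stt p q key c ≤ q := by
  unfold stt
  have := Finset.card_filter_le (Finset.Ico p q) (fun x => key x < c)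
  rw [Nat.card_Ico] at this
  omega

theorem stt_dj (p q : ℕ) (key : ℕ → ℕ) {c c' j : ℕ} (h1 : stt p q key c ≤ j)
    (h2 : j < stt p q key c + ctt p q key c) (h3 : stt p q key c' ≤ j)
    (h4 : j < stt p q key c' + ctt p q key c') : c = c' := by
  rw [stt_succ] at h2 h4
  by_contra hne
  rcases lt_or_gt_of_ne hne with h | h
  · have := stt_mono p q key (c := c + 1) (c' := c') h
    omega
  · have := stt_mono p q key (c := c' + 1) (c' := c) h
    omega

theorem stt_cover (p q : ℕ) (key : ℕ → ℕ) (N : ℕ) (hN : ∀ x, p ≤ x → x < q → key x < N) {j : ℕ}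
    (h1 : p ≤ j) (h2 : j < q) :
    ∃ c < N, stt p q key c ≤ j ∧ j < stt p q key c + ctt p q key c := by
  have hlast : stt p q key N = q := by
    unfold stt
    rw [Finset.filter_true_of_mem]
    · rw [Nat.card_Ico]; omega
    · intro x hx
      simp only [Finset.mem_Ico] at hx
      exact hN x hx.1 hx.2
  have h0 : stt p q key 0 = p := by simp [stt]
  have : ∀ n, n ≤ N → j < stt p q key n →
      ∃ c < n, stt p q key c ≤ j ∧ j < stt p q key c + ctt p q key c := by
    intro n
    induction n with
    | zero => intro _ h; omega
    | succ n ih =>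
      intro hn h
      by_cases hj : j < stt p q key n
      · obtain ⟨c, hc, h'⟩ := ih (by omega) hj
        exact ⟨c, by omega, h'⟩
      · exact ⟨n, by omega, by omega, by rw [stt_succ]; exact h⟩
  exact this N le_rfl (by omega)

theorem ctt_pos {p q : ℕ} {key : ℕ → ℕ} {c j : ℕ} (h1 : stt p q key c ≤ j)
    (h2 : j < stt p q key c + ctt p q key c) : ∃ x, p ≤ x ∧ x < q ∧ key x = c := by
  have : 0 < ctt p q key c := by omega
  unfold ctt at this
  obtain ⟨x, hx⟩ := Finset.card_pos.1 this
  simp only [Finset.mem_filter, Finset.mem_Ico] at hx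
  exact ⟨x, hx.1.1, hx.1.2, hx.2⟩

/-- lexicographic refinement -/
theorem stt_lex (p q : ℕ) (t code : ℕ → ℕ) (N : ℕ) (hN : ∀ x, code x < N) (τ : ℕ) :
    stt p q (fun x => t x * N + code x) (τ * N) = stt p q t τ := by
  unfold stt
  congr 2
  apply Finset.filter_congr
  intro x _
  have := hN x
  change t x * N + code x < τ * N ↔ t x < τ
  constructor
  · intro h
    by_contra hcon
    push Not at hcon
    have := Nat.mul_le_mul_right N hcon
    omega
  · intro h
    have : (t x + 1) * N ≤ τ * N := Nat.mul_le_mul_right N h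
    rw [Nat.succ_mul] at this
    omega

theorem stt_lex_sub (p q : ℕ) (t code : ℕ → ℕ) (N : ℕ) (hN : ∀ x, code x < N) (κ : ℕ) :
    stt p q t (κ / N) ≤ stt p q (fun x => t x * N + code x) κ ∧
    stt p q (fun x => t x * N + code x) κ + ctt p q (fun x => t x * N + code x) κ
      ≤ stt p q t (κ / N) + ctt p q t (κ / N) := by
  have hN0 : 0 < N := lt_of_le_of_lt (Nat.zero_le _) (hN 0)
  rw [stt_succ, stt_succ, ← stt_lex p q t code N hN, ← stt_lex p q t code N hN]
  refine ⟨stt_mono _ _ _ (Nat.div_mul_le_self _ _), stt_mono _ _ _ ?_⟩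
  have := Nat.lt_div_mul_add (a := κ) hN0
  rw [Nat.succ_mul]
  omega

namespace CoreIn

variable {α : Type} (I : CoreIn α)

/-- talls crossing a slab boundary -/
def Fx (i : α) : Prop := i ∈ I.V ∧ I.Tall i ∧ ∃ y ∈ I.X, I.x i < y ∧ y < I.x i + I.w i

def cov (a e c : ℕ) : Prop := ∃ i, I.Fx i ∧ I.col i c ∧ I.Touch i a e

theorem PQ_ex {a : ℕ} (haW : a < I.W) (e : ℕ) :
    ∃ p q, a ≤ p ∧ p ≤ q ∧ q ≤ I.en a ∧ ∀ c, a ≤ c → c < I.en a → (I.cov a e c ↔ (c < p ∨ q ≤ c)) := by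
  apply ends_lemma a (I.en a) (I.lt_en' haW).le
  rintro c h1 h2 ⟨i, ⟨hi, hti, y, hy, h3, h4⟩, hc, ht⟩
  unfold col at hc
  by_cases hya : y ≤ a
  · left
    intro c' h5 h6
    exact ⟨i, ⟨hi, hti, y, hy, h3, h4⟩, ⟨by omega, by omega⟩, ht⟩
  · right
    intro c' h5 h6
    have : I.en a ≤ y := hi_le hy (by omega)
    exact ⟨i, ⟨hi, hti, y, hy, h3, h4⟩, ⟨by omega, by omega⟩, ht⟩

noncomputable def P (a e : ℕ) : ℕ := if h : a < I.W then (I.PQ_ex h e).choose else 0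
noncomputable def Q (a e : ℕ) : ℕ := if h : a < I.W then (I.PQ_ex h e).choose_spec.choose else 0

theorem PQ_spec {a : ℕ} (h : a < I.W) (e : ℕ) : a ≤ I.P a e ∧ I.P a e ≤ I.Q a e ∧ I.Q a e ≤ I.en a ∧
    ∀ c, a ≤ c → c < I.en a → (I.cov a e c ↔ (c < I.P a e ∨ I.Q a e ≤ c)) := by
  have := (I.PQ_ex h e).choose_spec.choose_spec
  unfold P Q
  rw [dif_pos h, dif_pos h]
  exact this

theorem PQ_cov {a : ℕ} (h : a < I.W) (e : ℕ) {c : ℕ} (h1 : a ≤ c) (h2 : c < I.en a) :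
    (I.P a e ≤ c ∧ c < I.Q a e) ↔ ¬ I.cov a e c := by
  rw [(I.PQ_spec h e).2.2.2 c h1 h2]; omega

/-- a column between `P` and `Q` is in the slab -/
theorem PQ_sl {a : ℕ} (ha : a ∈ I.X) (haW : a < I.W) {e c : ℕ} (h1 : I.P a e ≤ c) (h2 : c < I.Q a e) :
    I.sl c = a ∧ c < I.W ∧ ¬ I.cov a e c := by
  have h := I.PQ_spec haW e
  have h3 := I.en_le haW
  exact ⟨I.sl_eq ha haW (by omega) (by omega), by omega,
    (I.PQ_cov haW e (by omega) (by omega)).1 ⟨h1, h2⟩⟩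

/-- movable talls live in one slab -/
theorem mov_sl {i : α} (hi : i ∈ I.V) (hti : I.Tall i) (hf : ¬ I.Fx i) {c c' : ℕ} (hc : I.col i c)
    (hc' : I.col i c') : I.sl c = I.sl c' := by
  have key : ∀ c c', I.col i c → I.col i c' → c ≤ c' → I.sl c = I.sl c' := by
    intro c c' hc hc' hle
    have hW := I.col_lt (I.memJV hi) hc'
    have h1 := I.sl_le c'
    by_cases h2 : I.sl c' ≤ c
    · exact I.sl_eq (I.sl_mem c') (by omega) h2 (lt_of_le_of_lt hle (I.lt_en hW))
    · exfalso
      apply hf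
      unfold col at hc hc'
      exact ⟨hi, hti, I.sl c', I.sl_mem _, by omega, by omega⟩
  rcases le_total c c' with h | h
  · exact key c c' hc hc' h
  · exact (key c' c hc' hc h).symm

theorem mov_uncov {i : α} (hi : i ∈ I.V) (hti : I.Tall i) (hf : ¬ I.Fx i) {c e : ℕ} (hc : I.col i c)
    (he : e ∈ I.Y (I.sl c)) (he4 : e < 4 * I.m) (ht : I.Touch i (I.sl c) e) :
    I.P (I.sl c) e ≤ c ∧ c < I.Q (I.sl c) e := by
  have hW := I.col_lt (I.memJV hi) hc
  have h1 := I.sl_le c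
  rw [I.PQ_cov (by omega) e h1 (I.lt_en hW)]
  rintro ⟨j, hj, hjc, hjt⟩
  have := I.touch_unique hi hj.1 hc hjc hti hj.2.1 he he4 ht hjt
  exact hf (this ▸ hj)

def hugM (a c : ℕ) : Prop := ∃ i ∈ I.V, ¬ I.Fx i ∧ I.Tall i ∧ I.col i c ∧
  I.Touch i a (I.d a) ∧ I.Touch i a (I.mid a)

noncomputable def zone (a c : ℕ) : ℕ :=
  if I.hugM a c then 1 else if ∃ c', a ≤ c' ∧ c' < c ∧ I.hugM a c' then 2 else 0

def isQ (a e : ℕ) : Prop := e = I.d a ∨ e = I.mid a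

noncomputable def zn (a e c : ℕ) : ℕ := if I.isQ a e then I.zone a c else 0

noncomputable def tkey (a e c : ℕ) : ℕ := I.zn a e c * (4 * I.m + 1) + I.T a e c

theorem zone_le (a c : ℕ) : I.zone a c ≤ 2 := by unfold zone; split_ifs <;> omega
theorem zn_le (a e c : ℕ) : I.zn a e c ≤ 2 := by
  unfold zn; split_ifs
  · exact I.zone_le a c
  · omega

theorem tkey_lt (a e c : ℕ) : I.tkey a e c < 3 * (4 * I.m + 1) := by
  have := I.zn_le a e c
  have := I.T_le a e c
  unfold tkey
  nlinarith

theorem tkey_div (a e c : ℕ) : I.tkey a e c / (4 * I.m + 1) = I.zn a e c := by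
  have := I.T_le a e c
  unfold tkey
  rw [Nat.add_comm, Nat.add_mul_div_right _ _ (by omega), Nat.div_eq_of_lt (by omega)]
  omega

theorem tkey_mod (a e c : ℕ) : I.tkey a e c % (4 * I.m + 1) = I.T a e c := by
  have := I.T_le a e c
  unfold tkey
  rw [Nat.add_comm, Nat.add_mul_mod_self_right, Nat.mod_eq_of_lt (by omega)]

/-- the key is constant on movable talls -/
theorem tkey_const {i : α} (hi : i ∈ I.V) (hti : I.Tall i) (hf : ¬ I.Fx i) {c c' e : ℕ}
    (hc : I.col i c) (hc' : I.col i c') (he : e ∈ I.Y (I.sl c)) (he4 : e < 4 * I.m)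
    (ht : I.Touch i (I.sl c) e) : I.tkey (I.sl c) e c = I.tkey (I.sl c) e c' := by
  have hsl := I.mov_sl hi hti hf hc hc'
  have hT : I.T (I.sl c) e c = I.T (I.sl c) e c' := by
    rw [I.T_eq hi hc hti he he4 ht]
    rw [hsl] at he ht ⊢
    rw [I.T_eq hi hc' hti he he4 ht]
  have hz : I.zn (I.sl c) e c = I.zn (I.sl c) e c' := by
    unfold zn
    split_ifs with hQ
    swap
    · rfl
    by_cases hh : I.Touch i (I.sl c) (I.d (I.sl c)) ∧ I.Touch i (I.sl c) (I.mid (I.sl c))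
    · have h1 : I.hugM (I.sl c) c := ⟨i, hi, hf, hti, hc, hh.1, hh.2⟩
      have h2 : I.hugM (I.sl c) c' := ⟨i, hi, hf, hti, hc', hh.1, hh.2⟩
      unfold zone
      rw [if_pos h1, if_pos h2]
    · have hno : ∀ c'', I.col i c'' → ¬ I.hugM (I.sl c) c'' := by
        rintro c'' hc'' ⟨j, hj, hjf, hjt, hjc, hj1, hj2⟩
        have hsl' := I.mov_sl hi hti hf hc hc''
        have : i = j := by
          rw [hsl'] at he ht hj1 hj2 hQ
          rcases hQ with hQ | hQ
          · exact I.touch_unique hi hj hc'' hjc hti hjt he he4 ht (hQ ▸ hj1)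
          · exact I.touch_unique hi hj hc'' hjc hti hjt he he4 ht (hQ ▸ hj2)
        subst this
        exact hh ⟨hj1, hj2⟩
      unfold zone
      rw [if_neg (hno c hc), if_neg (hno c' hc')]
      have hcc : ∀ c c', I.col i c → I.col i c' → ∀ c0, I.hugM (I.sl c) c0 →
          (∀ c'', I.col i c'' → ¬ I.hugM (I.sl c) c'') → c0 < c → c0 < c' := by
        intro c c' hc hc' c0 h0 hno h1
        by_contra h2
        exact hno c0 ⟨by unfold col at hc'; omega, by unfold col at hc; omega⟩ h0
      congr 1
      apply propext
      constructor
      · rintro ⟨c0, h1, h2, h3⟩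
        exact ⟨c0, h1, hcc c c' hc hc' c0 h3 hno h2, h3⟩
      · rintro ⟨c0, h1, h2, h3⟩
        rw [hsl] at hno h3
        exact ⟨c0, h1, hcc c' c hc' hc c0 h3 hno h2, by rw [hsl]; exact h3⟩
  unfold tkey
  rw [hT, hz]

/-! ### configurations -/

noncomputable def cnt (e c k : ℕ) : ℕ := ((I.NT e c).filter (fun i => I.k i = k)).card

theorem z_le (e c : ℕ) : I.z e c ≤ 4 * I.m := by
  have := sum_intervals (I.NT e c) I.r' I.k 0 (4 * I.m) (fun i hi => ⟨Nat.zero_le _,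
    I.r'_le (I.memJV (Finset.mem_filter.1 hi).1)⟩) (fun i hi j hj hij => by
      simp only [NT, Finset.mem_filter] at hi hj
      exact I.r'_dj (I.memJV hi.1) (I.memJV hj.1) hij hi.2.2.1 hj.2.2.1)
  simpa [z] using this

theorem cnt_le (e c k : ℕ) : I.cnt e c k ≤ 4 * I.m := by
  refine le_trans ?_ (I.z_le e c)
  unfold cnt z
  refine (Finset.card_filter_le _ _).trans ?_
  rw [Finset.card_eq_sum_ones]
  apply Finset.sum_le_sum
  intro i hi
  exact I.kpos (I.memJV (Finset.mem_filter.1 hi).1)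

theorem z_eq (e c : ℕ) : I.z e c = ∑ k ∈ Finset.range (I.m + 1), k * I.cnt e c k := by
  unfold z cnt
  rw [← Finset.sum_fiberwise_of_maps_to (s := I.NT e c) (t := Finset.range (I.m + 1)) (g := I.k)]
  · apply Finset.sum_congr rfl
    intro k _
    rw [Finset.sum_congr rfl (g := fun _ => k) (fun i hi => (Finset.mem_filter.1 hi).2)]
    rw [Finset.sum_const, smul_eq_mul, mul_comm]
  · intro i hi
    have := (Finset.mem_filter.1 hi).2.1
    unfold Tall at this
    simp only [Finset.mem_range]
    omega

abbrev Cfg (m : ℕ) : Type := Fin (m + 1) → Fin (4 * m + 1)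

/-- number of configurations -/
noncomputable def _root_.Ncfg (m : ℕ) : ℕ := Fintype.card (Cfg m)

noncomputable def cfg (e c : ℕ) : Cfg I.m :=
  fun k => ⟨I.cnt e c k, Nat.lt_succ_of_le (I.cnt_le e c k)⟩

noncomputable def code (e c : ℕ) : ℕ := (Fintype.equivFin (Cfg I.m) (I.cfg e c)).val

noncomputable def dec (n k : ℕ) : ℕ :=
  if h : n < Ncfg I.m ∧ k < I.m + 1 then
    ((Fintype.equivFin (Cfg I.m)).symm ⟨n, h.1⟩ ⟨k, h.2⟩).val else 0

theorem code_lt (e c : ℕ) : I.code e c < Ncfg I.m := (Fintype.equivFin (Cfg I.m) (I.cfg e c)).isLt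

theorem dec_code (e c k : ℕ) (hk : k ≤ I.m) : I.dec (I.code e c) k = I.cnt e c k := by
  unfold dec
  rw [dif_pos ⟨I.code_lt e c, by omega⟩]
  simp [code, cfg]

theorem dec_le (n k : ℕ) : I.dec n k ≤ 4 * I.m := by
  unfold dec
  split_ifs with h
  · have := ((Fintype.equivFin (Cfg I.m)).symm ⟨n, h.1⟩ ⟨k, h.2⟩).isLt
    omega
  · omega

noncomputable def key (a e c : ℕ) : ℕ := I.tkey a e c * Ncfg I.m + I.code e c

theorem Ncfg_pos : 0 < Ncfg I.m := lt_of_le_of_lt (Nat.zero_le _) (I.code_lt 0 0)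

theorem key_lt (a e c : ℕ) : I.key a e c < 3 * (4 * I.m + 1) * Ncfg I.m := by
  have h1 := I.tkey_lt a e c
  have h2 := I.code_lt e c
  unfold key
  nlinarith

theorem key_div (a e c : ℕ) : I.key a e c / Ncfg I.m = I.tkey a e c := by
  have h2 := I.code_lt e c
  unfold key
  rw [Nat.add_comm, Nat.add_mul_div_right _ _ I.Ncfg_pos, Nat.div_eq_of_lt h2]
  omega

theorem key_mod (a e c : ℕ) : I.key a e c % Ncfg I.m = I.code e c := by
  have h2 := I.code_lt e c
  unfold key
  rw [Nat.add_comm, Nat.add_mul_mod_self_right, Nat.mod_eq_of_lt h2]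

end CoreIn



namespace CoreIn

variable {α : Type} (I : CoreIn α)

/-! ### huge talls and alignment -/

theorem isQ_mem {a e : ℕ} (h : I.isQ a e) : e ∈ I.Y a ∧ e < 4 * I.m := by
  rcases h with h | h <;> subst h
  · exact ⟨I.Yd a, I.d_lt4 a⟩
  · exact ⟨I.Ymid a, I.mid_lt4 a⟩

theorem hugM_T {a c : ℕ} (ha : I.sl c = a) (h : I.hugM a c) : I.T a (I.d a) c = I.T a (I.mid a) c := by
  obtain ⟨i, hi, hf, ht, hc, h1, h2⟩ := h
  subst ha
  rw [I.T_eq hi hc ht (I.Yd _) (I.d_lt4 _) h1, I.T_eq hi hc ht (I.Ymid _) (I.mid_lt4 _) h2]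

theorem hugM_PQ {a c e : ℕ} (ha : I.sl c = a) (h : I.hugM a c) (he : I.isQ a e) :
    I.P a e ≤ c ∧ c < I.Q a e := by
  obtain ⟨i, hi, hf, ht, hc, h1, h2⟩ := h
  subst ha
  have := I.isQ_mem he
  refine I.mov_uncov hi ht hf hc this.1 this.2 ?_
  rcases he with he | he <;> subst he <;> assumption

theorem hugM_hug {a c : ℕ} (h : I.hugM a c) : I.hug a c := by
  obtain ⟨i, hi, hf, ht, hc, h1, h2⟩ := h
  exact ⟨i, hi, ht, hc, h1, h2⟩

theorem hug_hugM {a c e : ℕ} (hq : I.isQ a e) (h : I.hug a c) (hn : ¬ I.cov a e c) : I.hugM a c := by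
  obtain ⟨i, hi, ht, hc, h1, h2⟩ := h
  refine ⟨i, hi, ?_, ht, hc, h1, h2⟩
  intro hf
  apply hn
  refine ⟨i, hf, hc, ?_⟩
  rcases hq with h | h <;> subst h <;> assumption

theorem zone_one {a c : ℕ} : I.zone a c = 1 ↔ I.hugM a c := by
  unfold zone
  split_ifs <;> simp_all

theorem zn_Q {a e c : ℕ} (hq : I.isQ a e) : I.zn a e c = I.zone a c := by
  unfold zn; rw [if_pos hq]

/-- the sorted start of a huge class, in terms independent of the layer -/
theorem huge_stt {a e c0 : ℕ} (ha : a ∈ I.X) (haW : a < I.W) (hq : I.isQ a e) (h0 : I.hugM a c0)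
    (hs0 : I.sl c0 = a) (hmin : ∀ c', a ≤ c' → c' < c0 → ¬ I.hugM a c') {τ : ℕ}
    (hτ : τ / (4 * I.m + 1) = 1) :
    stt (I.P a e) (I.Q a e) (I.tkey a e) τ =
      c0 + ((Finset.Ico a (I.en a)).filter (fun c => I.hugM a c ∧ I.T a (I.d a) c < τ % (4 * I.m + 1))).card
    ∧ ctt (I.P a e) (I.Q a e) (I.tkey a e) τ =
      ((Finset.Ico a (I.en a)).filter (fun c => I.hugM a c ∧ I.T a (I.d a) c = τ % (4 * I.m + 1))).card := by
  have hPQ := I.PQ_spec haW e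
  have hdm := Nat.div_add_mod τ (4 * I.m + 1)
  have hml := Nat.mod_lt τ (show 4 * I.m + 1 > 0 by omega)
  rw [hτ] at hdm
  have hP0 := I.hugM_PQ hs0 h0 hq
  have hzone : ∀ c, a ≤ c → c < c0 → I.zone a c = 0 := by
    intro c h1 h2
    unfold zone
    rw [if_neg (hmin c h1 h2), if_neg]
    rintro ⟨c', h3, h4, h5⟩
    exact hmin c' h3 (by omega) h5
  have hzone2 : ∀ c, c0 ≤ c → ¬ I.hugM a c → I.zone a c = 2 := by
    intro c h1 h2
    unfold zone
    rw [if_neg h2, if_pos]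
    refine ⟨c0, by have := I.sl_le c0; omega, ?_, h0⟩
    rcases Nat.lt_or_ge c0 c with h | h
    · exact h
    · have : c = c0 := by omega
      subst this; exact absurd h0 h2
  have hT : ∀ c, I.sl c = a → I.hugM a c → I.T a e c = I.T a (I.d a) c := by
    intro c h1 h2
    rcases hq with h | h
    · rw [h]
    · rw [h, I.hugM_T h1 h2]
  constructor
  · unfold stt
    have : (Finset.Ico (I.P a e) (I.Q a e)).filter (fun x => I.tkey a e x < τ) =
        Finset.Ico (I.P a e) c0 ∪ (Finset.Ico a (I.en a)).filter
          (fun c => I.hugM a c ∧ I.T a (I.d a) c < τ % (4 * I.m + 1)) := by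
      ext x
      simp only [Finset.mem_union, Finset.mem_filter, Finset.mem_Ico]
      constructor
      · rintro ⟨⟨h1, h2⟩, h3⟩
        by_cases hx : x < c0
        · exact Or.inl ⟨h1, hx⟩
        · right
          refine ⟨⟨by omega, by omega⟩, ?_⟩
          by_cases hh : I.hugM a x
          · refine ⟨hh, ?_⟩
            rw [← hT x (I.PQ_sl ha haW h1 h2).1 hh]
            unfold tkey at h3
            rw [I.zn_Q hq, I.zone_one.2 hh] at h3
            omega
          · exfalso
            unfold tkey at h3
            rw [I.zn_Q hq, hzone2 x (by omega) hh] at h3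
            omega
      · rintro (⟨h1, h2⟩ | ⟨⟨h1, h2⟩, h3, h4⟩)
        · refine ⟨⟨h1, by omega⟩, ?_⟩
          unfold tkey
          rw [I.zn_Q hq, hzone x (by omega) h2]
          have := I.T_le a e x
          omega
        · have hsx := I.sl_eq ha haW h1 h2
          refine ⟨I.hugM_PQ hsx h3 hq, ?_⟩
          unfold tkey
          rw [I.zn_Q hq, I.zone_one.2 h3, hT x hsx h3]
          omega
    rw [this, Finset.card_union_of_disjoint, Nat.card_Ico]
    · omega
    · rw [Finset.disjoint_left]
      intro x hx hx'
      simp only [Finset.mem_filter, Finset.mem_Ico] at hx hx'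
      exact hmin x (by omega) (by omega) hx'.2.1
  · unfold ctt
    congr 1
    ext x
    simp only [Finset.mem_filter, Finset.mem_Ico]
    constructor
    · rintro ⟨⟨h1, h2⟩, h3⟩
      have hd := I.tkey_div a e x
      have hm := I.tkey_mod a e x
      rw [h3] at hd hm
      rw [hτ, I.zn_Q hq] at hd
      have hh := I.zone_one.1 hd.symm
      exact ⟨⟨by omega, by omega⟩, hh, by rw [← hT x (I.PQ_sl ha haW h1 h2).1 hh]; omega⟩
    · rintro ⟨⟨h1, h2⟩, h3, h4⟩
      have hsx := I.sl_eq ha haW h1 h2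
      refine ⟨I.hugM_PQ hsx h3 hq, ?_⟩
      unfold tkey
      rw [I.zn_Q hq, I.zone_one.2 h3, hT x hsx h3]
      omega

/-- alignment of the huge classes in the two middle layers -/
theorem align {a e e' j : ℕ} (ha : a ∈ I.X) (haW : a < I.W) (hq : I.isQ a e) (hq' : I.isQ a e') {τ : ℕ}
    (hτ : τ / (4 * I.m + 1) = 1) (h1 : stt (I.P a e) (I.Q a e) (I.tkey a e) τ ≤ j)
    (h2 : j < stt (I.P a e) (I.Q a e) (I.tkey a e) τ + ctt (I.P a e) (I.Q a e) (I.tkey a e) τ) :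
    stt (I.P a e') (I.Q a e') (I.tkey a e') τ ≤ j ∧
    j < stt (I.P a e') (I.Q a e') (I.tkey a e') τ + ctt (I.P a e') (I.Q a e') (I.tkey a e') τ := by
  obtain ⟨x, hx1, hx2, hx3⟩ := ctt_pos h1 h2
  have hPQ := I.PQ_spec haW e
  have hd := I.tkey_div a e x
  rw [hx3, hτ, I.zn_Q hq] at hd
  have hex : ∃ c, a ≤ c ∧ I.hugM a c := ⟨x, by omega, I.zone_one.1 hd.symm⟩
  have hs := Nat.find_spec hex
  have hmin : ∀ c', a ≤ c' → c' < Nat.find hex → ¬ I.hugM a c' :=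
    fun c' h3 h4 h5 => Nat.find_min hex h4 ⟨h3, h5⟩
  have hle := Nat.find_le (h := hex) (n := x) ⟨by omega, I.zone_one.1 hd.symm⟩
  have hsl := I.sl_eq ha haW hs.1 (by omega)
  have e1 := I.huge_stt ha haW hq hs.2 hsl hmin hτ
  have e2 := I.huge_stt ha haW hq' hs.2 hsl hmin hτ
  rw [e1.1, e1.2] at h2
  rw [e1.1] at h1
  rw [e2.1, e2.2]
  exact ⟨h1, h2⟩

/-! ### values of keys -/

noncomputable def hfT (a e τ : ℕ) : ℕ :=
  if e = I.mid a ∧ τ / (4 * I.m + 1) = 1 then 0 else τ % (4 * I.m + 1)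

noncomputable def hf (a e κ : ℕ) : ℕ := I.hfT a e (κ / Ncfg I.m)

noncomputable def off (a e κ k l : ℕ) : ℕ :=
  I.hf a e κ + ∑ k' ∈ Finset.range k, k' * I.dec (κ % Ncfg I.m) k' + l * k

noncomputable def val (a e κ : ℕ) : ℕ :=
  I.hf a e κ + ∑ k' ∈ Finset.range (I.m + 1), k' * I.dec (κ % Ncfg I.m) k'

theorem hf_rep {a e c : ℕ} (hn : ¬ I.cov a e c) : I.hf a e (I.key a e c) = I.Foff a e c := by
  unfold hf hfT Foff
  rw [I.key_div, I.tkey_div, I.tkey_mod]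
  by_cases he : e = I.mid a
  · have hq : I.isQ a e := Or.inr he
    rw [I.zn_Q hq]
    by_cases hh : I.hug a c
    · rw [if_pos ⟨he, I.zone_one.2 (I.hug_hugM hq hh hn)⟩, if_pos ⟨he, hh⟩]
    · rw [if_neg (fun h => hh (I.hugM_hug (I.zone_one.1 h.2))), if_neg (fun h => hh h.2)]
  · rw [if_neg (fun h => he h.1), if_neg (fun h => he h.1)]

theorem val_rep {a e c : ℕ} (hn : ¬ I.cov a e c) :
    I.val a e (I.key a e c) = I.Foff a e c + I.z e c := by
  unfold val
  rw [I.hf_rep hn, I.z_eq, I.key_mod]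
  congr 1
  apply Finset.sum_congr rfl
  intro k hk
  rw [I.dec_code _ _ _ (by simp at hk; omega)]

theorem off_lt {a e κ k k' l l' : ℕ} (h : k < k') (hl : l < I.dec (κ % Ncfg I.m) k) :
    I.off a e κ k l + k ≤ I.off a e κ k' l' := by
  unfold off
  have h1 : ∑ k'' ∈ Finset.range (k + 1), k'' * I.dec (κ % Ncfg I.m) k'' ≤
      ∑ k'' ∈ Finset.range k', k'' * I.dec (κ % Ncfg I.m) k'' :=
    Finset.sum_le_sum_of_subset (Finset.range_subset_range.2 h)
  rw [Finset.sum_range_succ] at h1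
  have : (l + 1) * k ≤ k * I.dec (κ % Ncfg I.m) k := by
    rw [mul_comm]; exact Nat.mul_le_mul_left _ hl
  rw [Nat.succ_mul] at this
  omega

theorem off_val {a e κ k l : ℕ} (hk : k ≤ I.m) (hl : l < I.dec (κ % Ncfg I.m) k) :
    I.off a e κ k l + k ≤ I.val a e κ := by
  have h := I.off_lt (a := a) (e := e) (k' := I.m + 1) (l' := 0) (by omega) hl
  unfold off at h ⊢
  unfold val
  omega

theorem off_lt' {a e κ k l l' : ℕ} (h : l < l') : I.off a e κ k l + k ≤ I.off a e κ k l' := by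
  unfold off
  have := Nat.mul_le_mul_right k (Nat.succ_le_of_lt h)
  rw [Nat.succ_mul] at this
  omega

theorem hf_off (a e κ k l : ℕ) : I.hf a e κ ≤ I.off a e κ k l := by unfold off; omega
theorem hf_val (a e κ : ℕ) : I.hf a e κ ≤ I.val a e κ := by unfold val; omega

end CoreIn



namespace CoreIn

variable {α : Type} (I : CoreIn α)

noncomputable def tallR (a e τ : ℕ) : Rec :=
  ⟨stt (I.P a e) (I.Q a e) (I.tkey a e) τ, if e = I.mid a then I.tp a e - I.hfT a e τ else e,
    ctt (I.P a e) (I.Q a e) (I.tkey a e) τ, I.hfT a e τ⟩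

noncomputable def slotR (a e κ k l : ℕ) : Rec :=
  ⟨stt (I.P a e) (I.Q a e) (I.key a e) κ,
    if e = I.mid a then I.tp a e - (I.off a e κ k l + k) else e + I.off a e κ k l,
    ctt (I.P a e) (I.Q a e) (I.key a e) κ,
    if k ≤ I.m ∧ l < I.dec (κ % Ncfg I.m) k then k else 0⟩

noncomputable def ks (a e κ : ℕ) : ℕ := stt (I.P a e) (I.Q a e) (I.key a e) κ
noncomputable def ke (a e κ : ℕ) : ℕ := ks I a e κ + ctt (I.P a e) (I.Q a e) (I.key a e) κ

noncomputable def freeR (a κ κ' : ℕ) : Rec :=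
  ⟨max (I.ks a (I.d a) κ) (I.ks a (I.mid a) κ'), I.d a + I.val a (I.d a) κ,
    min (I.ke a (I.d a) κ) (I.ke a (I.mid a) κ') - max (I.ks a (I.d a) κ) (I.ks a (I.mid a) κ'),
    if I.val a (I.d a) κ + I.val a (I.mid a) κ' + I.m ≤ I.u a - I.d a then I.m else 0⟩

/-- position `j` of layer `(a,e)` carries key `κ` -/
def At (a e κ j : ℕ) : Prop := I.ks a e κ ≤ j ∧ j < I.ke a e κ

def Att (a e τ j : ℕ) : Prop := stt (I.P a e) (I.Q a e) (I.tkey a e) τ ≤ j ∧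
  j < stt (I.P a e) (I.Q a e) (I.tkey a e) τ + ctt (I.P a e) (I.Q a e) (I.tkey a e) τ

theorem At_uniq {a e κ κ' j : ℕ} (h : I.At a e κ j) (h' : I.At a e κ' j) : κ = κ' :=
  stt_dj _ _ _ h.1 h.2 h'.1 h'.2

theorem Att_uniq {a e κ κ' j : ℕ} (h : I.Att a e κ j) (h' : I.Att a e κ' j) : κ = κ' :=
  stt_dj _ _ _ h.1 h.2 h'.1 h'.2

theorem At_Att {a e κ j : ℕ} (h : I.At a e κ j) : I.Att a e (κ / Ncfg I.m) j := by
  have := stt_lex_sub (I.P a e) (I.Q a e) (I.tkey a e) (I.code e) (Ncfg I.m) (I.code_lt e) κ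
  unfold At ks ke ks at h
  unfold Att
  change _ ≤ stt (I.P a e) (I.Q a e) (I.key a e) κ ∧ stt (I.P a e) (I.Q a e) (I.key a e) κ +
    ctt (I.P a e) (I.Q a e) (I.key a e) κ ≤ _ at this
  omega

theorem Att_pos {a e τ j : ℕ} (ha : a ∈ I.X) (haW : a < I.W) (h : I.Att a e τ j) :
    I.sl j = a ∧ j < I.W ∧ ¬ I.cov a e j ∧ ∃ c, I.sl c = a ∧ ¬ I.cov a e c ∧ I.tkey a e c = τ := by
  have hPQ := I.PQ_spec haW e
  have h1 := stt_ge (I.P a e) (I.Q a e) (I.tkey a e) τ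
  have h2 := stt_le hPQ.2.1 (I.tkey a e) (τ + 1)
  rw [← stt_succ] at h2
  have h3 := I.PQ_sl ha haW (c := j) (e := e) (le_trans h1 h.1) (lt_of_lt_of_le h.2 h2)
  obtain ⟨c, hc1, hc2, hc3⟩ := ctt_pos h.1 h.2
  have h4 := I.PQ_sl ha haW hc1 hc2
  exact ⟨h3.1, h3.2.1, h3.2.2, c, h4.1, h4.2.2, hc3⟩

theorem At_pos {a e κ j : ℕ} (ha : a ∈ I.X) (haW : a < I.W) (h : I.At a e κ j) :
    I.sl j = a ∧ j < I.W ∧ ¬ I.cov a e j ∧ ∃ c, I.sl c = a ∧ ¬ I.cov a e c ∧ I.key a e c = κ := by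
  have h0 := I.Att_pos ha haW (I.At_Att h)
  obtain ⟨c, hc1, hc2, hc3⟩ := ctt_pos h.1 h.2
  have h4 := I.PQ_sl ha haW hc1 hc2
  exact ⟨h0.1, h0.2.1, h0.2.2.1, c, h4.1, h4.2.2, hc3⟩

def Good (j ρ : ℕ) : Prop := j < I.W ∧ ∃ e ∈ I.Y (I.sl j), e < 4 * I.m ∧ e ≤ ρ ∧ ρ < I.tp (I.sl j) e ∧
  ¬ I.cov (I.sl j) e j ∧ ∀ b ∈ I.B, I.col b (I.sl j) → ¬ (I.r' b ≤ ρ ∧ ρ < I.r' b + I.k b)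

theorem goodQ {j ρ : ℕ} (hj : j < I.W) (h1 : ¬ I.cov (I.sl j) (I.d (I.sl j)) j)
    (h2 : ¬ I.cov (I.sl j) (I.mid (I.sl j)) j) (h3 : I.d (I.sl j) ≤ ρ) (h4 : ρ < I.u (I.sl j)) :
    I.Good j ρ := by
  have hb : ∀ b ∈ I.B, I.col b (I.sl j) → ¬ (I.r' b ≤ ρ ∧ ρ < I.r' b + I.k b) := by
    intro b hb hbc
    have := I.Q_noblock hb hbc
    omega
  refine ⟨hj, ?_⟩
  by_cases h : ρ < I.mid (I.sl j)
  · exact ⟨_, I.Yd _, I.d_lt4 _, h3, by rw [I.tp_d]; exact h, h1, hb⟩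
  · exact ⟨_, I.Ymid _, I.mid_lt4 _, by omega, by rw [I.tp_mid]; exact h4, h2, hb⟩

theorem good_in {j ρ : ℕ} (h : I.Good j ρ) : j < I.W ∧ ρ < 4 * I.m := by
  obtain ⟨h0, e, he, he4, h1, h2, -⟩ := h
  have := I.tp_le4 (a := I.sl j) he4
  exact ⟨h0, by omega⟩

theorem good_block {j ρ : ℕ} (h : I.Good j ρ) {b : α} (hb : b ∈ I.B)
    (hm : (⟨I.x b, I.r' b, I.w b, I.k b⟩ : Rec).mem j ρ) : False := by
  obtain ⟨h0, e, he, he4, h1, h2, h3, h4⟩ := h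
  exact h4 b hb ((I.block_sl hb h0).1 ⟨hm.1, hm.2.1⟩) ⟨hm.2.2.1, hm.2.2.2⟩

theorem good_fix {j ρ : ℕ} (h : I.Good j ρ) {i : α} (hi : I.Fx i)
    (hm : (⟨I.x i, I.r' i, I.w i, I.k i⟩ : Rec).mem j ρ) : False := by
  obtain ⟨h0, e, he, he4, h1, h2, h3, h4⟩ := h
  obtain ⟨m1, m2, m3, m4⟩ := hm
  dsimp only at m1 m2 m3 m4
  exact h3 ⟨i, hi, ⟨m1, m2⟩, by omega, by omega⟩

theorem slot_mem {a e κ k l j ρ : ℕ} (ha : a ∈ I.X) (haW : a < I.W) (he : e ∈ I.Y a) (he4 : e < 4 * I.m)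
    (h : (I.slotR a e κ k l).mem j ρ) :
    I.At a e κ j ∧ k ≤ I.m ∧ l < I.dec (κ % Ncfg I.m) k ∧ I.val a e κ ≤ I.tp a e - e ∧
    (e = I.mid a → I.tp a e ≤ ρ + I.off a e κ k l + k ∧ ρ + I.off a e κ k l < I.tp a e) ∧
    (e ≠ I.mid a → e + I.off a e κ k l ≤ ρ ∧ ρ < e + I.off a e κ k l + k) ∧
    e ≤ ρ ∧ ρ < I.tp a e ∧ I.Good j ρ := by
  obtain ⟨m1, m2, m3, m4⟩ := h
  unfold slotR at m1 m2 m3 m4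
  dsimp only at m1 m2 m3 m4
  have hAt : I.At a e κ j := ⟨m1, m2⟩
  by_cases hkl : k ≤ I.m ∧ l < I.dec (κ % Ncfg I.m) k
  swap
  · rw [if_neg hkl] at m4; omega
  rw [if_pos hkl] at m4
  obtain ⟨hj, hjW, hnj, c, hc, hnc, hκ⟩ := I.At_pos ha haW hAt
  have hk0 : 0 < k := by omega
  have hcnt : 0 < I.cnt e c k := by
    rw [← I.dec_code e c k hkl.1, ← I.key_mod a e c, hκ]; omega
  obtain ⟨i, hi⟩ := Finset.card_pos.1 hcnt
  have hi1 := (Finset.mem_filter.1 hi).1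
  have hz : 0 < I.z e c := by
    have h1 := Finset.single_le_sum (f := I.k) (fun _ _ => Nat.zero_le _) hi1
    have h2 := I.kpos (I.memJV (Finset.mem_filter.1 hi1).1)
    unfold z; omega
  have hv : I.val a e κ ≤ I.tp a e - e := by
    rw [← hκ, I.val_rep hnc]
    subst hc
    by_cases hem : e = I.mid (I.sl c)
    · have := I.cap_up c
      rw [hem, I.tp_mid]; exact this
    · have := I.cap_low he hem he4 hz
      unfold Foff
      rw [if_neg (fun h => hem h.1)]
      exact this
  have ho := I.off_val (a := a) (e := e) hkl.1 hkl.2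
  have htp := I.lt_tp (a := a) he4
  have hr1 : e = I.mid a → I.tp a e ≤ ρ + I.off a e κ k l + k ∧ ρ + I.off a e κ k l < I.tp a e := by
    intro hem
    rw [if_pos hem] at m3 m4
    omega
  have hr2 : e ≠ I.mid a → e + I.off a e κ k l ≤ ρ ∧ ρ < e + I.off a e κ k l + k := by
    intro hem
    rw [if_neg hem] at m3 m4
    omega
  have hr3 : e ≤ ρ ∧ ρ < I.tp a e := by
    by_cases hem : e = I.mid a
    · have := hr1 hem; omega
    · have := hr2 hem; omega
  refine ⟨hAt, hkl.1, hkl.2, hv, hr1, hr2, hr3.1, hr3.2, hjW, e, hj ▸ he, he4, hr3.1, hj ▸ hr3.2, hj ▸ hnj, ?_⟩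
  rw [hj]
  intro b hb hbc hbρ
  simp only [NT, Finset.mem_filter] at hi1
  obtain ⟨hiV, hit, hic, hil⟩ := hi1
  have hiS : i ∈ I.Sq c → e = I.d a ∨ e = I.mid a := by
    intro hS
    unfold lay at hil
    rw [if_pos hS, hc] at hil
    split_ifs at hil
    · exact Or.inl hil.symm
    · exact Or.inr hil.symm
  by_cases hQ : e = I.d a ∨ e = I.mid a
  · have h1 := I.Q_noblock hb hbc
    have h2 := I.d_mid a
    have h3 := I.mid_u a
    have h4 := I.tp_d a
    have h5 := I.tp_mid a
    rcases hQ with hQ | hQ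
    · rw [← hQ] at h4 h1 h2; omega
    · rw [← hQ] at h5 h2 h3; omega
  · have hnS : i ∉ I.Sq c := fun h => hQ (hiS h)
    unfold lay at hil
    rw [if_neg hnS] at hil
    have h1 := I.lo_range hiV c
    have h2 := I.kpos (I.memJV hiV)
    rw [hil] at h1
    have := I.block_layer hiV hb hic (hc ▸ hbc) (hc ▸ he) he4 ⟨h1.2, by omega⟩
    rw [hc] at this
    omega

theorem tall_mem {a e τ j ρ : ℕ} (ha : a ∈ I.X) (haW : a < I.W) (he : e ∈ I.Y a) (he4 : e < 4 * I.m)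
    (h : (I.tallR a e τ).mem j ρ) :
    I.Att a e τ j ∧ I.Good j ρ ∧
    (e = I.mid a → I.tp a e ≤ ρ + I.hfT a e τ) ∧ (e ≠ I.mid a → ρ < e + I.hfT a e τ) ∧
    ((e ≤ ρ ∧ ρ < I.tp a e) ∨ (e = I.d a ∧ τ / (4 * I.m + 1) = 1 ∧ e ≤ ρ ∧ ρ < I.u a)) := by
  obtain ⟨m1, m2, m3, m4⟩ := h
  unfold tallR at m1 m2 m3 m4
  dsimp only at m1 m2 m3 m4
  have hAt : I.Att a e τ j := ⟨m1, m2⟩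
  obtain ⟨hj, hjW, hnj, c, hc, hnc, hκ⟩ := I.Att_pos ha haW hAt
  have hτ1 : τ / (4 * I.m + 1) = I.zn a e c := by rw [← hκ, I.tkey_div]
  have hτ2 : τ % (4 * I.m + 1) = I.T a e c := by rw [← hκ, I.tkey_mod]
  have hT : I.hfT a e τ = I.T a e c ∧ ¬ (e = I.mid a ∧ τ / (4 * I.m + 1) = 1) := by
    unfold hfT at m3 m4 ⊢
    by_cases hh : e = I.mid a ∧ τ / (4 * I.m + 1) = 1
    · rw [if_pos hh] at m3 m4; omega
    · rw [if_neg hh]; exact ⟨hτ2, hh⟩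
  obtain ⟨hT, hnh⟩ := hT
  have hT0 : I.T a e c ≠ 0 := by omega
  rcases I.T_cases a e c with h0 | ⟨i, hiV, hit, hic, hiT, hik⟩
  · exact absurd h0 hT0
  have htp := I.lt_tp (a := a) he4
  by_cases hhuge : e = I.d a ∧ τ / (4 * I.m + 1) = 1
  · have hq : I.isQ a e := Or.inl hhuge.1
    have hqm : I.isQ a (I.mid a) := Or.inr rfl
    have hem : e ≠ I.mid a := by have := I.d_mid a; omega
    rw [if_neg hem] at m3 m4
    have hal := I.align ha haW hq hqm hhuge.2 hAt.1 hAt.2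
    obtain ⟨-, -, hnm, -⟩ := I.Att_pos ha haW (e := I.mid a) (τ := τ) hal
    have hub : ρ < I.u a := by
      have h1 := I.touch_d hiV hic (by rw [hc]; rw [← hhuge.1]; exact hiT)
      rw [hc] at h1
      have h2 := I.inQ_top hiV hic (by rw [hc]; have := I.mid_u a; omega)
      rw [hc] at h2
      omega
    have hd := hhuge.1
    refine ⟨hAt, ?_, fun h => absurd h hem, fun _ => m4, Or.inr ⟨hhuge.1, hhuge.2, m3, hub⟩⟩
    apply I.goodQ hjW
    · rw [hj, ← hd]; exact hnj
    · rw [hj]; exact hnm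
    · rw [hj, ← hd]; exact m3
    · rw [hj]; exact hub
  · have hcap : I.T a e c ≤ I.tp a e - e := by
      have := I.T_cap (c := c) (e := e) (hc ▸ he) he4 (by
        rw [hc]
        rintro ⟨hq, hh⟩
        have h1 := I.hug_hugM hq hh hnc
        have h2 : τ / (4 * I.m + 1) = 1 := by rw [hτ1, I.zn_Q hq, I.zone_one.2 h1]
        rcases hq with h | h
        · exact hhuge ⟨h, h2⟩
        · exact hnh ⟨h, h2⟩)
      rw [hc] at this
      exact this
    have hr : e ≤ ρ ∧ ρ < I.tp a e ∧ (e = I.mid a → I.tp a e ≤ ρ + I.hfT a e τ) ∧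
        (e ≠ I.mid a → ρ < e + I.hfT a e τ) := by
      by_cases hem : e = I.mid a
      · rw [if_pos hem] at m3 m4
        refine ⟨by omega, by omega, fun _ => by omega, fun h => absurd hem h⟩
      · rw [if_neg hem] at m3 m4
        refine ⟨by omega, by omega, fun h => absurd h hem, fun _ => m4⟩
    refine ⟨hAt, ⟨hjW, e, hj ▸ he, he4, hr.1, hj ▸ hr.2.1, hj ▸ hnj, ?_⟩, hr.2.2.1, hr.2.2.2, Or.inl ⟨hr.1, hr.2.1⟩⟩
    rw [hj]
    intro b hb hbc hbρ
    have := I.block_layer hiV hb hic (hc ▸ hbc) (hc ▸ he) he4 (hc ▸ hiT)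
    rw [hc] at this
    omega

theorem free_mem {a κ κ' j ρ : ℕ} (ha : a ∈ I.X) (haW : a < I.W)
    (h : (I.freeR a κ κ').mem j ρ) :
    I.At a (I.d a) κ j ∧ I.At a (I.mid a) κ' j ∧ I.Good j ρ ∧ I.d a + I.val a (I.d a) κ ≤ ρ ∧
    ρ + I.val a (I.mid a) κ' < I.u a := by
  obtain ⟨m1, m2, m3, m4⟩ := h
  unfold freeR at m1 m2 m3 m4
  dsimp only at m1 m2 m3 m4
  split_ifs at m4 with hv
  swap
  · omega
  have h1 : I.At a (I.d a) κ j := ⟨by omega, by omega⟩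
  have h2 : I.At a (I.mid a) κ' j := ⟨by omega, by omega⟩
  obtain ⟨hj, hjW, hn1, -⟩ := I.At_pos ha haW h1
  obtain ⟨-, -, hn2, -⟩ := I.At_pos ha haW h2
  have := I.d_u a
  refine ⟨h1, h2, ?_, m3, by omega⟩
  subst hj
  exact I.goodQ hjW hn1 hn2 (by omega) (by omega)

end CoreIn



/-- names of containers -/
inductive Cid (α : Type) where
  | fix (i : α)
  | tall (a e τ : ℕ)
  | slot (a e κ k l : ℕ)
  | free (a κ κ' : ℕ)

namespace CoreIn

variable {α : Type} (I : CoreIn α)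

noncomputable def CR : Cid α → Rec
  | .fix i => ⟨I.x i, I.r' i, I.w i, I.k i⟩
  | .tall a e τ => I.tallR a e τ
  | .slot a e κ k l => I.slotR a e κ k l
  | .free a κ κ' => I.freeR a κ κ'

def Ok : Cid α → Prop
  | .fix i => I.Fx i
  | .tall a e _ => a ∈ I.X ∧ a < I.W ∧ e ∈ I.Y a ∧ e < 4 * I.m
  | .slot a e _ _ _ => a ∈ I.X ∧ a < I.W ∧ e ∈ I.Y a ∧ e < 4 * I.m
  | .free a _ _ => a ∈ I.X ∧ a < I.W

theorem CR_good {s : Cid α} (hs : I.Ok s) {j ρ : ℕ} (h : (I.CR s).mem j ρ) :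
    I.Good j ρ ∨ ∃ i, s = .fix i := by
  cases s with
  | fix i => exact Or.inr ⟨i, rfl⟩
  | tall a e τ =>
    obtain ⟨h1, h2, h3, h4⟩ := hs
    exact Or.inl (I.tall_mem h1 h2 h3 h4 h).2.1
  | slot a e κ k l =>
    obtain ⟨h1, h2, h3, h4⟩ := hs
    exact Or.inl (I.slot_mem h1 h2 h3 h4 h).2.2.2.2.2.2.2.2
  | free a κ κ' =>
    obtain ⟨h1, h2⟩ := hs
    exact Or.inl (I.free_mem h1 h2 h).2.2.1

theorem CR_in {s : Cid α} (hs : I.Ok s) {j ρ : ℕ} (h : (I.CR s).mem j ρ) : j < I.W ∧ ρ < 4 * I.m := by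
  rcases I.CR_good hs h with h' | ⟨i, rfl⟩
  · exact I.good_in h'
  · have hi := I.memJV hs.1
    have h1 := (I.hin i hi).1
    have h2 := I.r'_le hi
    obtain ⟨m1, m2, m3, m4⟩ := h
    simp only [CR] at m1 m2 m3 m4
    omega

theorem CR_block {s : Cid α} (hs : I.Ok s) {b : α} (hb : b ∈ I.B) :
    (I.CR s).Dj ⟨I.x b, I.r' b, I.w b, I.k b⟩ := by
  intro j ρ h h'
  rcases I.CR_good hs h with h1 | ⟨i, rfl⟩
  · exact I.good_block h1 hb h'
  · have hi := I.memJV hs.1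
    have hne : i ≠ b := by
      rintro rfl
      exact Finset.disjoint_left.1 I.hBV hb hs.1
    obtain ⟨m1, m2, m3, m4⟩ := h
    obtain ⟨n1, n2, n3, n4⟩ := h'
    simp only [CR] at m1 m2 m3 m4 n1 n2 n3 n4
    have := I.r'_dj hi (I.memJB hb) hne (c := j) ⟨m1, m2⟩ ⟨n1, n2⟩
    omega

/-- position of layers relative to the middle box -/
theorem layer_out {a e : ℕ} (he : e ∈ I.Y a) (hd : e ≠ I.d a) (hm : e ≠ I.mid a) :
    I.tp a e ≤ I.d a ∨ I.u a ≤ e := by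
  rcases I.layer_cases he with h | h | h | h
  · exact Or.inl h
  · exact absurd h hd
  · exact absurd h hm
  · exact Or.inr h

/-- height of a huge tall plus the upper slots -/
theorem huge_val {a κ : ℕ} {j : ℕ} (ha : a ∈ I.X) (haW : a < I.W) (hAt : I.At a (I.mid a) κ j)
    (h1 : κ / Ncfg I.m / (4 * I.m + 1) = 1) :
    I.hfT a (I.d a) (κ / Ncfg I.m) + I.val a (I.mid a) κ ≤ I.u a - I.d a := by
  obtain ⟨hj, hjW, hnj, c, hc, hnc, hκ⟩ := I.At_pos ha haW hAt
  have hq : I.isQ a (I.mid a) := Or.inr rfl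
  have hz : I.hugM a c := by
    rw [← hκ, I.key_div, I.tkey_div, I.zn_Q hq] at h1
    exact I.zone_one.1 h1
  have hdm := I.d_mid a
  have e1 : I.hfT a (I.d a) (κ / Ncfg I.m) = I.T a (I.d a) c := by
    unfold hfT
    rw [if_neg (by omega), ← hκ, I.key_div, I.tkey_mod, I.hugM_T hc hz]
  rw [e1, ← hκ, I.val_rep hnc]
  unfold Foff
  rw [if_pos ⟨rfl, I.hugM_hug hz⟩]
  have := I.cap_hug c
  rw [hc] at this
  omega

theorem dj_tall_tall {a e τ a' e' τ' j ρ : ℕ} (ha : a ∈ I.X) (haW : a < I.W) (he : e ∈ I.Y a)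
    (he4 : e < 4 * I.m) (ha' : a' ∈ I.X) (haW' : a' < I.W) (he' : e' ∈ I.Y a')
    (he4' : e' < 4 * I.m) (h : (I.tallR a e τ).mem j ρ) (h' : (I.tallR a' e' τ').mem j ρ) :
    a = a' ∧ e = e' ∧ τ = τ' := by
  obtain ⟨t1, t2, t3, t4, t5⟩ := I.tall_mem ha haW he he4 h
  obtain ⟨s1, s2, s3, s4, s5⟩ := I.tall_mem ha' haW' he' he4' h'
  have haa : a = a' := by
    rw [← (I.Att_pos ha haW t1).1, ← (I.Att_pos ha' haW' s1).1]
  subst haa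
  by_cases hee : e = e'
  · subst hee
    exact ⟨rfl, rfl, I.Att_uniq t1 s1⟩
  exfalso
  have h1 := I.d_mid a
  have h2 := I.mid_u a
  -- huge against others
  have key : ∀ e τ e' τ', e' ∈ I.Y a → e ≠ e' → I.Att a e τ j → I.Att a e' τ' j →
      e = I.d a ∧ τ / (4 * I.m + 1) = 1 ∧ e ≤ ρ ∧ ρ < I.u a → (e' ≤ ρ ∧ ρ < I.tp a e') →
      (I.tallR a e' τ').mem j ρ → False := by
    intro e τ e' τ' he' hne hA hA' hh hr hmem
    by_cases hm : e' = I.mid a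
    · have hal := I.align ha haW (e := e) (Or.inl hh.1) (e' := e') (Or.inr hm) hh.2.1 hA.1 hA.2
      have : τ' = τ := I.Att_uniq hA' hal
      subst this
      obtain ⟨-, -, m3, m4⟩ := hmem
      have h0 : I.hfT a e' τ' = 0 := by unfold hfT; rw [if_pos ⟨hm, hh.2.1⟩]
      unfold tallR at m3 m4
      dsimp only at m3 m4
      rw [h0] at m3 m4
      omega
    · have := I.layer_out he' (by omega) hm
      omega
  rcases t5 with t5 | t5
  · rcases s5 with s5 | s5
    · have := I.layer_dj he he' hee
      omega
    · exact key e' τ' e τ he (fun h => hee h.symm) s1 t1 s5 t5 h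
  · rcases s5 with s5 | s5
    · exact key e τ e' τ' he' hee t1 s1 t5 s5 h'
    · omega

theorem dj_tall_slot {a e τ a' e' κ k l j ρ : ℕ} (ha : a ∈ I.X) (haW : a < I.W) (he : e ∈ I.Y a)
    (he4 : e < 4 * I.m) (ha' : a' ∈ I.X) (haW' : a' < I.W) (he' : e' ∈ I.Y a')
    (he4' : e' < 4 * I.m) (h : (I.tallR a e τ).mem j ρ) (h' : (I.slotR a' e' κ k l).mem j ρ) : False := by
  obtain ⟨t1, t2, t3, t4, t5⟩ := I.tall_mem ha haW he he4 h
  obtain ⟨s1, s2, s3, s4, s5, s6, s7, s8, s9⟩ := I.slot_mem ha' haW' he' he4' h'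
  have haa : a = a' := by
    rw [← (I.Att_pos ha haW t1).1, ← (I.At_pos ha' haW' s1).1]
  subst haa
  have h1 := I.d_mid a
  have h2 := I.mid_u a
  by_cases hee : e = e'
  · subst hee
    have hτ : τ = κ / Ncfg I.m := I.Att_uniq t1 (I.At_Att s1)
    have := I.hf_off a e κ k l
    unfold hf at this
    rw [← hτ] at this
    by_cases hm : e = I.mid a
    · have := t3 hm; have := s5 hm; omega
    · have := t4 hm; have := s6 hm; omega
  rcases t5 with t5 | t5
  · have := I.layer_dj he he' hee
    omega
  · by_cases hm : e' = I.mid a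
    · have hal := I.align ha haW (e := e) (Or.inl t5.1) (e' := e') (Or.inr hm) t5.2.1 t1.1 t1.2
      have hτ : κ / Ncfg I.m = τ := I.Att_uniq (I.At_Att s1) hal
      subst hm
      have h3 := I.huge_val ha haW s1 (by rw [hτ]; exact t5.2.1)
      rw [hτ, ← t5.1] at h3
      have h4 := t4 (by omega)
      have h5 := s5 rfl
      have h6 := I.off_val (a := a) (e := I.mid a) s2 s3
      rw [I.tp_mid] at h5
      omega
    · have := I.layer_out he' (by omega) hm
      omega

theorem dj_slot_slot {a e κ k l a' e' κ' k' l' j ρ : ℕ} (ha : a ∈ I.X) (haW : a < I.W) (he : e ∈ I.Y a)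
    (he4 : e < 4 * I.m) (ha' : a' ∈ I.X) (haW' : a' < I.W) (he' : e' ∈ I.Y a')
    (he4' : e' < 4 * I.m) (h : (I.slotR a e κ k l).mem j ρ) (h' : (I.slotR a' e' κ' k' l').mem j ρ) :
    a = a' ∧ e = e' ∧ κ = κ' ∧ k = k' ∧ l = l' := by
  obtain ⟨t1, t2, t3, t4, t5, t6, t7, t8, t9⟩ := I.slot_mem ha haW he he4 h
  obtain ⟨s1, s2, s3, s4, s5, s6, s7, s8, s9⟩ := I.slot_mem ha' haW' he' he4' h'
  have haa : a = a' := by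
    rw [← (I.At_pos ha haW t1).1, ← (I.At_pos ha' haW' s1).1]
  subst haa
  by_cases hee : e = e'
  swap
  · have := I.layer_dj he he' hee
    omega
  subst hee
  have hκ : κ = κ' := I.At_uniq t1 s1
  subst hκ
  have key : ¬ (I.off a e κ k l + k ≤ I.off a e κ k' l') ∧
      ¬ (I.off a e κ k' l' + k' ≤ I.off a e κ k l) := by
    by_cases hm : e = I.mid a
    · have := t5 hm; have := s5 hm; omega
    · have := t6 hm; have := s6 hm; omega
  have hk : k = k' := by
    by_contra hne
    rcases lt_or_gt_of_ne hne with h | h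
    · exact key.1 (I.off_lt h t3)
    · exact key.2 (I.off_lt h s3)
  subst hk
  refine ⟨rfl, rfl, rfl, rfl, ?_⟩
  by_contra hne
  rcases lt_or_gt_of_ne hne with h | h
  · exact key.1 (I.off_lt' h)
  · exact key.2 (I.off_lt' h)

theorem dj_tall_free {a e τ a' κ κ' j ρ : ℕ} (ha : a ∈ I.X) (haW : a < I.W) (he : e ∈ I.Y a)
    (he4 : e < 4 * I.m) (ha' : a' ∈ I.X) (haW' : a' < I.W)
    (h : (I.tallR a e τ).mem j ρ) (h' : (I.freeR a' κ κ').mem j ρ) : False := by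
  obtain ⟨t1, t2, t3, t4, t5⟩ := I.tall_mem ha haW he he4 h
  obtain ⟨s1, s2, s3, s4, s5⟩ := I.free_mem ha' haW' h'
  have haa : a = a' := by
    rw [← (I.Att_pos ha haW t1).1, ← (I.At_pos ha' haW' s1).1]
  subst haa
  have h1 := I.d_mid a
  have h2 := I.mid_u a
  by_cases hd : e = I.d a
  · subst hd
    have hτ : τ = κ / Ncfg I.m := I.Att_uniq t1 (I.At_Att s1)
    have h3 := I.hf_val a (I.d a) κ
    unfold hf at h3
    rw [← hτ] at h3
    have := t4 (by omega)
    omega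
  by_cases hm : e = I.mid a
  · subst hm
    have hτ : τ = κ' / Ncfg I.m := I.Att_uniq t1 (I.At_Att s2)
    have h3 := I.hf_val a (I.mid a) κ'
    unfold hf at h3
    rw [← hτ] at h3
    have h4 := t3 rfl
    rw [I.tp_mid] at h4
    omega
  have := I.layer_out he hd hm
  rcases t5 with t5 | t5
  · omega
  · exact hd t5.1

theorem dj_slot_free {a e μ k l a' κ κ' j ρ : ℕ} (ha : a ∈ I.X) (haW : a < I.W) (he : e ∈ I.Y a)
    (he4 : e < 4 * I.m) (ha' : a' ∈ I.X) (haW' : a' < I.W)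
    (h : (I.slotR a e μ k l).mem j ρ) (h' : (I.freeR a' κ κ').mem j ρ) : False := by
  obtain ⟨t1, t2, t3, t4, t5, t6, t7, t8, t9⟩ := I.slot_mem ha haW he he4 h
  obtain ⟨s1, s2, s3, s4, s5⟩ := I.free_mem ha' haW' h'
  have haa : a = a' := by
    rw [← (I.At_pos ha haW t1).1, ← (I.At_pos ha' haW' s1).1]
  subst haa
  have h1 := I.d_mid a
  have h2 := I.mid_u a
  have h3 := I.off_val (a := a) (e := e) t2 t3
  by_cases hd : e = I.d a
  · subst hd
    have hτ : μ = κ := I.At_uniq t1 s1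
    subst hτ
    have := t6 (by omega)
    omega
  by_cases hm : e = I.mid a
  · subst hm
    have hτ : μ = κ' := I.At_uniq t1 s2
    subst hτ
    have h4 := t5 rfl
    rw [I.tp_mid] at h4
    omega
  have := I.layer_out he hd hm
  omega

theorem CR_dj {s t : Cid α} (hs : I.Ok s) (ht : I.Ok t) (hst : s ≠ t) : (I.CR s).Dj (I.CR t) := by
  intro j ρ h h'
  cases s with
  | fix i =>
    cases t with
    | fix i' =>
      have hne : i ≠ i' := by rintro rfl; exact hst rfl
      obtain ⟨m1, m2, m3, m4⟩ := h
      obtain ⟨n1, n2, n3, n4⟩ := h'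
      simp only [CR] at m1 m2 m3 m4 n1 n2 n3 n4
      have := I.r'_dj (I.memJV hs.1) (I.memJV ht.1) hne (c := j) ⟨m1, m2⟩ ⟨n1, n2⟩
      omega
    | tall a e τ =>
      rcases I.CR_good ht h' with g | ⟨_, g⟩
      · exact I.good_fix g hs h
      · simp at g
    | slot a e κ k l =>
      rcases I.CR_good ht h' with g | ⟨_, g⟩
      · exact I.good_fix g hs h
      · simp at g
    | free a κ κ' =>
      rcases I.CR_good ht h' with g | ⟨_, g⟩
      · exact I.good_fix g hs h
      · simp at g
  | tall a e τ =>
    have hs' := hs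
    obtain ⟨h1, h2, h3, h4⟩ := hs'
    cases t with
    | fix i' =>
      rcases I.CR_good hs h with g | ⟨_, g⟩
      · exact I.good_fix g ht h'
      · simp at g
    | tall a' e' τ' =>
      obtain ⟨k1, k2, k3, k4⟩ := ht
      obtain ⟨e1, e2, e3⟩ := I.dj_tall_tall h1 h2 h3 h4 k1 k2 k3 k4 h h'
      subst e1 e2 e3
      exact hst rfl
    | slot a' e' κ k l =>
      obtain ⟨k1, k2, k3, k4⟩ := ht
      exact I.dj_tall_slot h1 h2 h3 h4 k1 k2 k3 k4 h h'
    | free a' κ κ' => exact I.dj_tall_free h1 h2 h3 h4 ht.1 ht.2 h h'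
  | slot a e κ k l =>
    have hs' := hs
    obtain ⟨h1, h2, h3, h4⟩ := hs'
    cases t with
    | fix i' =>
      rcases I.CR_good hs h with g | ⟨_, g⟩
      · exact I.good_fix g ht h'
      · simp at g
    | tall a' e' τ' =>
      obtain ⟨k1, k2, k3, k4⟩ := ht
      exact I.dj_tall_slot k1 k2 k3 k4 h1 h2 h3 h4 h' h
    | slot a' e' κ' k' l' =>
      obtain ⟨k1, k2, k3, k4⟩ := ht
      obtain ⟨e1, e2, e3, e4, e5⟩ := I.dj_slot_slot h1 h2 h3 h4 k1 k2 k3 k4 h h'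
      subst e1 e2 e3 e4 e5
      exact hst rfl
    | free a' κ1 κ2 => exact I.dj_slot_free h1 h2 h3 h4 ht.1 ht.2 h h'
  | free a κ κ' =>
    cases t with
    | fix i' =>
      rcases I.CR_good hs h with g | ⟨_, g⟩
      · exact I.good_fix g ht h'
      · simp at g
    | tall a' e' τ' =>
      obtain ⟨k1, k2, k3, k4⟩ := ht
      exact I.dj_tall_free k1 k2 k3 k4 hs.1 hs.2 h' h
    | slot a' e' κ' k' l' =>
      obtain ⟨k1, k2, k3, k4⟩ := ht
      exact I.dj_slot_free k1 k2 k3 k4 hs.1 hs.2 h' h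
    | free a' κ1 κ2 =>
      obtain ⟨t1, t2, -⟩ := I.free_mem hs.1 hs.2 h
      obtain ⟨s1, s2, -⟩ := I.free_mem ht.1 ht.2 h'
      have haa : a = a' := by
        rw [← (I.At_pos hs.1 hs.2 t1).1, ← (I.At_pos ht.1 ht.2 s1).1]
      subst haa
      have e1 := I.At_uniq t1 s1
      have e2 := I.At_uniq t2 s2
      subst e1 e2
      exact hst rfl

end CoreIn



theorem sort_pos (p q : ℕ) (hpq : p ≤ q) (key : ℕ → ℕ) (N : ℕ) (hN : ∀ x, key x < N) :
    ∃ kap : ℕ → ℕ, (∀ j, p ≤ j → j < q → kap j < N ∧ stt p q key (kap j) ≤ j ∧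
        j < stt p q key (kap j) + ctt p q key (kap j)) ∧
      ∀ f : ℕ → ℕ, ∑ j ∈ Finset.Ico p q, f (kap j) = ∑ c ∈ Finset.Ico p q, f (key c) := by
  have hex : ∀ j, ∃ κ, p ≤ j → j < q → κ < N ∧ stt p q key κ ≤ j ∧
        j < stt p q key κ + ctt p q key κ := by
    intro j
    by_cases h : p ≤ j ∧ j < q
    · obtain ⟨κ, h1, h2, h3⟩ := stt_cover p q key N (fun x _ _ => hN x) h.1 h.2
      exact ⟨κ, fun _ _ => ⟨h1, h2, h3⟩⟩
    · exact ⟨0, fun h1 h2 => absurd ⟨h1, h2⟩ h⟩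
  choose kap hkap using hex
  refine ⟨kap, hkap, fun f => ?_⟩
  rw [← Finset.sum_fiberwise_of_maps_to (s := Finset.Ico p q) (t := Finset.range N) (g := kap)]
  swap
  · intro j hj
    simp only [Finset.mem_Ico] at hj
    simpa using (hkap j hj.1 hj.2).1
  rw [← Finset.sum_fiberwise_of_maps_to (s := Finset.Ico p q) (t := Finset.range N) (g := key)]
  swap
  · intro j hj
    simpa using hN j
  apply Finset.sum_congr rfl
  intro κ _
  rw [Finset.sum_congr rfl (g := fun _ => f κ) (fun i hi => by rw [(Finset.mem_filter.1 hi).2]),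
    Finset.sum_congr rfl (s₁ := (Finset.Ico p q).filter (fun c => key c = κ)) (g := fun _ => f κ)
      (fun i hi => by rw [(Finset.mem_filter.1 hi).2]), Finset.sum_const, Finset.sum_const]
  congr 1
  have : (Finset.Ico p q).filter (fun j => kap j = κ) =
      Finset.Ico (stt p q key κ) (stt p q key κ + ctt p q key κ) := by
    ext j
    simp only [Finset.mem_filter, Finset.mem_Ico]
    constructor
    · rintro ⟨⟨h1, h2⟩, rfl⟩
      exact (hkap j h1 h2).2
    · rintro ⟨h1, h2⟩
      have h3 := stt_ge p q key κ
      have h4 := stt_le hpq key (κ + 1)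
      rw [← stt_succ] at h4
      have h5 := hkap j (by omega) (by omega)
      exact ⟨⟨by omega, by omega⟩, stt_dj p q key h5.2.1 h5.2.2 h1 h2⟩
  rw [this, Nat.card_Ico]
  unfold ctt
  omega

namespace CoreIn

variable {α : Type} (I : CoreIn α)

/-- the bound on keys -/
noncomputable def _root_.NK (m : ℕ) : ℕ := 3 * (4 * m + 1) * Ncfg m

noncomputable def A : Finset ℕ := I.X.filter (· < I.W)

theorem mem_A {a : ℕ} : a ∈ I.A ↔ a ∈ I.X ∧ a < I.W := by simp [A]

noncomputable def Fs : Finset α := I.V.filter I.Fx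

noncomputable def s : ℕ := ∑ i ∈ I.Fs, I.w i

/-- covered columns -/
noncomputable def Cv : Finset ℕ := (Finset.range I.W).filter (fun c => ∃ i, I.Fx i ∧ I.col i c)

theorem Cv_card : I.Cv.card ≤ I.s := by
  have h : I.Cv ⊆ I.Fs.biUnion (fun i => Finset.Ico (I.x i) (I.x i + I.w i)) := by
    intro c hc
    simp only [Cv, Finset.mem_filter] at hc
    obtain ⟨-, i, hi, h⟩ := hc
    simp only [Finset.mem_biUnion, Finset.mem_Ico, Fs, Finset.mem_filter]
    exact ⟨i, ⟨hi.1, hi⟩, h⟩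
  refine (Finset.card_le_card h).trans (Finset.card_biUnion_le.trans ?_)
  unfold s
  apply Finset.sum_le_sum
  intro i _
  simp

theorem Fs_card : I.Fs.card ≤ 3 * I.X.card := by
  have h1 : ∀ y, (I.Fs.filter (fun i => I.col i y)).card ≤ 3 := by
    intro y
    have := sum_intervals (I.Fs.filter (fun i => I.col i y)) I.r' I.k 0 (4 * I.m)
      (fun i hi => ⟨Nat.zero_le _, by
        simp only [Fs, Finset.mem_filter] at hi
        exact I.r'_le (I.memJV hi.1.1)⟩)
      (fun i hi j hj hij => by
        simp only [Fs, Finset.mem_filter] at hi hj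
        exact I.r'_dj (I.memJV hi.1.1) (I.memJV hj.1.1) hij hi.2 hj.2)
    have h2 : (I.Fs.filter (fun i => I.col i y)).card * (I.m + 1) ≤
        ∑ i ∈ I.Fs.filter (fun i => I.col i y), I.k i := by
      rw [← smul_eq_mul]
      apply Finset.card_nsmul_le_sum
      intro i hi
      simp only [Fs, Finset.mem_filter] at hi
      exact hi.1.2.2.1
    by_contra h3
    push Not at h3
    have := Nat.mul_le_mul_right (I.m + 1) (Nat.succ_le_of_lt h3)
    have := I.hm
    omega
  have h2 : I.Fs ⊆ I.X.biUnion (fun y => I.Fs.filter (fun i => I.col i y)) := by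
    intro i hi
    have hi' := hi
    simp only [Fs, Finset.mem_filter] at hi
    obtain ⟨-, -, -, y, hy, h3, h4⟩ := hi
    simp only [Finset.mem_biUnion, Finset.mem_filter]
    exact ⟨y, hy, hi', h3.le, h4⟩
  refine (Finset.card_le_card h2).trans (Finset.card_biUnion_le.trans ?_)
  refine (Finset.sum_le_card_nsmul _ _ 3 (fun y _ => h1 y)).trans ?_
  simp [mul_comm]

theorem s_le {β : ℕ} (hβ : ∀ i ∈ I.V, I.w i ≤ β) : I.s ≤ 3 * I.X.card * β := by
  unfold s
  refine (Finset.sum_le_card_nsmul _ _ β (fun i hi => hβ i (Finset.mem_filter.1 hi).1)).trans ?_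
  rw [smul_eq_mul]
  exact Nat.mul_le_mul_right _ I.Fs_card

/-- slab decomposition of the columns -/
theorem slab_sum (f : ℕ → ℕ) : ∑ a ∈ I.A, ∑ c ∈ Finset.Ico a (I.en a), f c = ∑ c ∈ Finset.range I.W, f c := by
  rw [← Finset.sum_fiberwise_of_maps_to (s := Finset.range I.W) (t := I.A) (g := I.sl)]
  · apply Finset.sum_congr rfl
    intro a ha
    rw [mem_A] at ha
    apply Finset.sum_congr _ (fun _ _ => rfl)
    ext c
    simp only [Finset.mem_filter, Finset.mem_Ico, Finset.mem_range]
    constructor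
    · rintro ⟨h1, h2⟩
      have := I.en_le ha.2
      exact ⟨by omega, I.sl_eq ha.1 ha.2 h1 h2⟩
    · rintro ⟨h1, h2⟩
      have h3 := I.sl_le c
      have h4 := I.lt_en h1
      rw [h2] at h3 h4
      exact ⟨h3, h4⟩
  · intro c hc
    rw [Finset.mem_range] at hc
    rw [mem_A]
    exact ⟨I.sl_mem c, lt_of_le_of_lt (I.sl_le c) hc⟩

theorem cov_Cv {a e c : ℕ} (hc : c < I.W) (h : I.cov a e c) : c ∈ I.Cv := by
  obtain ⟨i, hi, h1, -⟩ := h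
  simp only [Cv, Finset.mem_filter, Finset.mem_range]
  exact ⟨hc, i, hi, h1⟩

/-! ### the free containers -/

def okf (a κ κ' : ℕ) : Prop := I.val a (I.d a) κ + I.val a (I.mid a) κ' + I.m ≤ I.u a - I.d a

noncomputable def FI (a : ℕ) : Finset (ℕ × ℕ) :=
  (Finset.range (NK I.m) ×ˢ Finset.range (NK I.m)).filter (fun q => I.okf a q.1 q.2)

theorem free_slab {a : ℕ} (ha : a ∈ I.X) (haW : a < I.W) :
    I.en a - a ≤ (3 * I.m + 1) * (∑ q ∈ I.FI a, (I.freeR a q.1 q.2).w +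
      ((Finset.Ico a (I.en a)).filter (fun c => c ∈ I.Cv)).card) := by
  have hd := I.PQ_spec haW (I.d a)
  have hm := I.PQ_spec haW (I.mid a)
  have hen := I.en_le haW
  obtain ⟨k1, hk1, hs1⟩ := sort_pos _ _ hd.2.1 (I.key a (I.d a)) (NK I.m) (I.key_lt a _)
  obtain ⟨k2, hk2, hs2⟩ := sort_pos _ _ hm.2.1 (I.key a (I.mid a)) (NK I.m) (I.key_lt a _)
  let C := (Finset.Ico a (I.en a)).filter (fun c => c ∉ I.Cv)
  have hC1 : ∀ c ∈ C, I.P a (I.d a) ≤ c ∧ c < I.Q a (I.d a) ∧ I.P a (I.mid a) ≤ c ∧ c < I.Q a (I.mid a) := by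
    intro c hc
    simp only [C, Finset.mem_filter, Finset.mem_Ico] at hc
    have h1 := (I.PQ_cov haW (I.d a) hc.1.1 hc.1.2).2 (fun h => hc.2 (I.cov_Cv (by omega) h))
    have h2 := (I.PQ_cov haW (I.mid a) hc.1.1 hc.1.2).2 (fun h => hc.2 (I.cov_Cv (by omega) h))
    exact ⟨h1.1, h1.2, h2.1, h2.2⟩
  have hCc : C.card + ((Finset.Ico a (I.en a)).filter (fun c => c ∈ I.Cv)).card = I.en a - a := by
    rw [← Nat.card_Ico a (I.en a), add_comm]
    exact Finset.card_filter_add_card_filter_not _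
  let G := C.filter (fun c => I.okf a (k1 c) (k2 c))
  let Bd := C.filter (fun c => ¬ I.okf a (k1 c) (k2 c))
  have hGB : G.card + Bd.card = C.card := Finset.card_filter_add_card_filter_not _
  have hG : G.card ≤ ∑ q ∈ I.FI a, (I.freeR a q.1 q.2).w := by
    have : G ⊆ (I.FI a).biUnion (fun q => Finset.Ico (I.freeR a q.1 q.2).x
        ((I.freeR a q.1 q.2).x + (I.freeR a q.1 q.2).w)) := by
      intro c hc
      have hcC := (Finset.mem_filter.1 hc).1
      have hok := (Finset.mem_filter.1 hc).2
      have h1 := hC1 c hcC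
      have h2 := hk1 c h1.1 h1.2.1
      have h3 := hk2 c h1.2.2.1 h1.2.2.2
      simp only [Finset.mem_biUnion, FI, Finset.mem_filter, Finset.mem_product, Finset.mem_range,
        Finset.mem_Ico]
      refine ⟨(k1 c, k2 c), ⟨⟨h2.1, h3.1⟩, hok⟩, ?_⟩
      unfold freeR ke ks
      dsimp only
      omega
    refine (Finset.card_le_card this).trans (Finset.card_biUnion_le.trans ?_)
    apply Finset.sum_le_sum
    intro q _
    simp
  let D := I.u a - I.d a - I.m
  have hD : D ≤ 3 * I.m := by
    have := I.u_le4 a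
    simp only [D]; omega
  have hdu := I.d_u a
  -- total of the values
  have hsum : ∑ c ∈ C, (I.val a (I.d a) (k1 c) + I.val a (I.mid a) (k2 c)) ≤ (I.en a - a) * D := by
    have e1 : ∑ c ∈ C, I.val a (I.d a) (k1 c) ≤
        ∑ c ∈ Finset.Ico a (I.en a), (I.Foff a (I.d a) c + I.z (I.d a) c) := by
      calc ∑ c ∈ C, I.val a (I.d a) (k1 c)
          ≤ ∑ c ∈ Finset.Ico (I.P a (I.d a)) (I.Q a (I.d a)), I.val a (I.d a) (k1 c) := by
            apply Finset.sum_le_sum_of_subset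
            intro c hc
            have := hC1 c hc
            simp only [Finset.mem_Ico]; omega
        _ = ∑ c ∈ Finset.Ico (I.P a (I.d a)) (I.Q a (I.d a)), I.val a (I.d a) (I.key a (I.d a) c) :=
            hs1 (fun κ => I.val a (I.d a) κ)
        _ = ∑ c ∈ Finset.Ico (I.P a (I.d a)) (I.Q a (I.d a)), (I.Foff a (I.d a) c + I.z (I.d a) c) := by
            apply Finset.sum_congr rfl
            intro c hc
            rw [Finset.mem_Ico] at hc
            exact I.val_rep (I.PQ_sl ha haW hc.1 hc.2).2.2
        _ ≤ _ := by
            apply Finset.sum_le_sum_of_subset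
            apply Finset.Ico_subset_Ico <;> omega
    have e2 : ∑ c ∈ C, I.val a (I.mid a) (k2 c) ≤
        ∑ c ∈ Finset.Ico a (I.en a), (I.Foff a (I.mid a) c + I.z (I.mid a) c) := by
      calc ∑ c ∈ C, I.val a (I.mid a) (k2 c)
          ≤ ∑ c ∈ Finset.Ico (I.P a (I.mid a)) (I.Q a (I.mid a)), I.val a (I.mid a) (k2 c) := by
            apply Finset.sum_le_sum_of_subset
            intro c hc
            have := hC1 c hc
            simp only [Finset.mem_Ico]; omega
        _ = ∑ c ∈ Finset.Ico (I.P a (I.mid a)) (I.Q a (I.mid a)), I.val a (I.mid a) (I.key a (I.mid a) c) :=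
            hs2 (fun κ => I.val a (I.mid a) κ)
        _ = ∑ c ∈ Finset.Ico (I.P a (I.mid a)) (I.Q a (I.mid a)), (I.Foff a (I.mid a) c + I.z (I.mid a) c) := by
            apply Finset.sum_congr rfl
            intro c hc
            rw [Finset.mem_Ico] at hc
            exact I.val_rep (I.PQ_sl ha haW hc.1 hc.2).2.2
        _ ≤ _ := by
            apply Finset.sum_le_sum_of_subset
            apply Finset.Ico_subset_Ico <;> omega
    rw [Finset.sum_add_distrib]
    refine (Nat.add_le_add e1 e2).trans ?_
    rw [← Finset.sum_add_distrib, ← Nat.card_Ico, ← smul_eq_mul]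
    apply Finset.sum_le_card_nsmul
    intro c hc
    rw [Finset.mem_Ico] at hc
    have hsl := I.sl_eq ha haW hc.1 hc.2
    have := I.z_total c
    rw [hsl] at this
    have h1 : I.Foff a (I.d a) c = I.T a (I.d a) c := by
      unfold Foff
      rw [if_neg]
      have := I.d_mid a
      omega
    rw [h1]
    simp only [D]; omega
  have hbad : Bd.card * (D + 1) ≤ (I.en a - a) * D := by
    refine le_trans ?_ hsum
    refine le_trans ?_ (Finset.sum_le_sum_of_subset (Finset.filter_subset (fun c => ¬ I.okf a (k1 c) (k2 c)) C))
    rw [← smul_eq_mul]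
    apply Finset.card_nsmul_le_sum
    intro c hc
    have := (Finset.mem_filter.1 hc).2
    unfold okf at this
    simp only [D]; omega
  generalize ((Finset.Ico a (I.en a)).filter (fun c => c ∈ I.Cv)).card = sa at *
  generalize ∑ q ∈ I.FI a, (I.freeR a q.1 q.2).w = F at *
  have h1 : (I.en a - a) ≤ (D + 1) * (G.card + sa) := by
    have : (I.en a - a) = G.card + Bd.card + sa := by omega
    rw [this] at hbad ⊢
    nlinarith
  calc I.en a - a ≤ (D + 1) * (G.card + sa) := h1
    _ ≤ (3 * I.m + 1) * (F + sa) := Nat.mul_le_mul (by omega) (by omega)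

theorem free_total : I.W ≤ (3 * I.m + 1) * (∑ a ∈ I.A, ∑ q ∈ I.FI a, (I.freeR a q.1 q.2).w + I.s) := by
  have h1 := I.slab_sum (fun _ => 1)
  have h2 := I.slab_sum (fun c => if c ∈ I.Cv then 1 else 0)
  have h3 : ∑ c ∈ Finset.range I.W, (if c ∈ I.Cv then 1 else 0) ≤ I.s := by
    rw [← Finset.card_filter]
    refine le_trans (Finset.card_le_card ?_) I.Cv_card
    intro c hc
    exact (Finset.mem_filter.1 hc).2
  rw [← h2] at h3
  simp only [Finset.sum_const, Nat.card_Ico, Finset.card_range, smul_eq_mul, mul_one] at h1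
  rw [← h1]
  calc ∑ a ∈ I.A, (I.en a - a) ≤ ∑ a ∈ I.A, (3 * I.m + 1) * (∑ q ∈ I.FI a, (I.freeR a q.1 q.2).w +
      ((Finset.Ico a (I.en a)).filter (fun c => c ∈ I.Cv)).card) := by
        apply Finset.sum_le_sum
        intro a ha
        rw [mem_A] at ha
        exact I.free_slab ha.1 ha.2
    _ = (3 * I.m + 1) * (∑ a ∈ I.A, ∑ q ∈ I.FI a, (I.freeR a q.1 q.2).w +
        ∑ a ∈ I.A, ∑ c ∈ Finset.Ico a (I.en a), (if c ∈ I.Cv then 1 else 0)) := by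
        rw [← Finset.mul_sum, Finset.sum_add_distrib]
        simp only [Finset.card_filter]
    _ ≤ _ := Nat.mul_le_mul_left _ (Nat.add_le_add_left h3 _)

end CoreIn



namespace CoreIn

variable {α : Type} (I : CoreIn α)

/-! ### assigning the movable talls -/

noncomputable def home (i : α) : ℕ := lo (I.Y (I.sl (I.x i))) (I.r' i)

theorem home_spec {i : α} (hi : i ∈ I.V) : I.home i ∈ I.Y (I.sl (I.x i)) ∧ I.home i < 4 * I.m ∧
    I.Touch i (I.sl (I.x i)) (I.home i) := by
  have h1 := I.lo_range hi (I.x i)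
  have h2 : I.home i ∈ I.Y (I.sl (I.x i)) := lo_mem (I.Y0 _) _
  have h3 := I.kpos (I.memJV hi)
  have h4 := I.r'_le (I.memJV hi)
  refine ⟨h2, ?_, ?_⟩
  · unfold home; omega
  · unfold Touch home; omega

theorem col_x {i : α} (hi : i ∈ I.V) : I.col i (I.x i) := by
  have := I.wpos (I.memJV hi)
  unfold col; omega

noncomputable def MT : Finset α := I.V.filter (fun i => I.Tall i ∧ ¬ I.Fx i)

noncomputable def tid (i : α) : ℕ × ℕ × ℕ :=
  (I.sl (I.x i), I.home i, I.tkey (I.sl (I.x i)) (I.home i) (I.x i))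

theorem tall_fit (q : ℕ × ℕ × ℕ) :
    ∑ i ∈ I.MT.filter (fun i => I.tid i = q), I.w i ≤ (I.tallR q.1 q.2.1 q.2.2).w := by
  have hm : ∀ i ∈ I.MT.filter (fun i => I.tid i = q), ∀ c, I.col i c →
      I.sl c = q.1 ∧ q.2.1 ∈ I.Y q.1 ∧ q.2.1 < 4 * I.m ∧ I.Touch i q.1 q.2.1 ∧ i ∈ I.V ∧ I.Tall i ∧
      I.P q.1 q.2.1 ≤ c ∧ c < I.Q q.1 q.2.1 ∧ I.tkey q.1 q.2.1 c = q.2.2 := by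
    intro i hi c hc
    simp only [MT, Finset.mem_filter] at hi
    obtain ⟨⟨hV, hT, hF⟩, hq⟩ := hi
    obtain ⟨h1, h2, h3⟩ := I.home_spec hV
    have h0 := I.mov_sl hV hT hF hc (I.col_x hV)
    have h4 := I.tkey_const hV hT hF (I.col_x hV) hc h1 h2 h3
    rw [← h0] at h1 h3 h4
    have h5 := I.mov_uncov hV hT hF hc h1 h2 h3
    subst hq
    simp only [tid]
    rw [← h0]
    exact ⟨rfl, h1, h2, h3, hV, hT, h5.1, h5.2, h4.symm⟩
  have : ∑ i ∈ I.MT.filter (fun i => I.tid i = q), I.w i =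
      ((I.MT.filter (fun i => I.tid i = q)).biUnion (fun i => Finset.Ico (I.x i) (I.x i + I.w i))).card := by
    rw [Finset.card_biUnion]
    · simp
    · intro i hi j hj hij
      rw [Function.onFun, Finset.disjoint_left]
      intro c hc hc'
      rw [Finset.mem_Ico] at hc hc'
      apply hij
      obtain ⟨a1, a2, a3, a4, a5, a6, -⟩ := hm i hi c hc
      obtain ⟨b1, b2, b3, b4, b5, b6, -⟩ := hm j hj c hc'
      rw [← a1] at a2 a4 b4
      exact I.touch_unique a5 b5 hc hc' a6 b6 a2 a3 a4 b4
  rw [this]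
  change _ ≤ ctt _ _ _ _
  unfold ctt
  apply Finset.card_le_card
  intro c hc
  simp only [Finset.mem_biUnion] at hc
  obtain ⟨i, hi, hc⟩ := hc
  rw [Finset.mem_Ico] at hc
  obtain ⟨-, -, -, -, -, -, h1, h2, h3⟩ := hm i hi c hc
  simp only [Finset.mem_filter, Finset.mem_Ico]
  exact ⟨⟨h1, h2⟩, h3⟩

theorem tall_h {i : α} (hi : i ∈ I.MT) : (I.tallR (I.tid i).1 (I.tid i).2.1 (I.tid i).2.2).h = I.k i := by
  simp only [MT, Finset.mem_filter] at hi
  obtain ⟨hV, hT, hF⟩ := hi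
  obtain ⟨h1, h2, h3⟩ := I.home_spec hV
  have hT1 := I.T_eq hV (I.col_x hV) hT h1 h2 h3
  change I.hfT (I.sl (I.x i)) (I.home i) (I.tkey (I.sl (I.x i)) (I.home i) (I.x i)) = I.k i
  unfold hfT
  rw [if_neg, I.tkey_mod, hT1]
  rintro ⟨hm, hz⟩
  change _ / _ = 1 at hz
  rw [I.tkey_div] at hz
  change _ = _ at hm
  rw [I.zn_Q (Or.inr hm), I.zone_one] at hz
  obtain ⟨j, hj, hjF, hjT, hjc, hj1, hj2⟩ := hz
  rw [hm] at h3
  have : i = j := I.touch_unique hV hj (I.col_x hV) hjc hT hjT (I.Ymid _) (I.mid_lt4 _) h3 hj2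
  subst this
  have h5 := (I.touch_d hV (I.col_x hV) hj1).2
  have h6 : I.home i ≤ I.r' i := lo_le _ _
  omega

/-! ### filling the slots -/

noncomputable def Vk (k : ℕ) : Finset α := I.V.filter (fun i => ¬ I.Tall i ∧ I.k i = k)

noncomputable def SB : Finset (ℕ × ℕ × ℕ × ℕ) :=
  I.A ×ˢ Finset.range (4 * I.m) ×ˢ Finset.range (NK I.m) ×ˢ Finset.range (4 * I.m)

noncomputable def scap (k : ℕ) (q : ℕ × ℕ × ℕ × ℕ) : ℕ :=
  if q.2.1 ∈ I.Y q.1 ∧ q.2.2.2 < I.dec (q.2.2.1 % Ncfg I.m) k then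
    ctt (I.P q.1 q.2.1) (I.Q q.1 q.2.1) (I.key q.1 q.2.1) q.2.2.1 else 0

theorem sum_by_key (p q : ℕ) (key : ℕ → ℕ) (N : ℕ) (hN : ∀ x, key x < N) (f : ℕ → ℕ) :
    ∑ κ ∈ Finset.range N, f κ * ctt p q key κ = ∑ c ∈ Finset.Ico p q, f (key c) := by
  rw [← Finset.sum_fiberwise_of_maps_to (s := Finset.Ico p q) (t := Finset.range N) (g := key)]
  · apply Finset.sum_congr rfl
    intro κ _
    rw [Finset.sum_congr rfl (s₁ := (Finset.Ico p q).filter (fun c => key c = κ)) (g := fun _ => f κ)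
      (fun i hi => by rw [(Finset.mem_filter.1 hi).2]), Finset.sum_const, smul_eq_mul, mul_comm]
    rfl
  · intro c _
    simpa using hN c

theorem scap_sum {k : ℕ} (hk : k ≤ I.m) : ∑ q ∈ I.SB, I.scap k q =
    ∑ a ∈ I.A, ∑ e ∈ Finset.range (4 * I.m), if e ∈ I.Y a then
      ∑ c ∈ Finset.Ico (I.P a e) (I.Q a e), I.cnt e c k else 0 := by
  unfold SB
  rw [Finset.sum_product]
  apply Finset.sum_congr rfl
  intro a _
  rw [Finset.sum_product]
  apply Finset.sum_congr rfl
  intro e _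
  rw [Finset.sum_product]
  split_ifs with hY
  · rw [← Finset.sum_congr rfl (fun c _ => I.dec_code e c k hk)]
    simp only [← I.key_mod a e]
    rw [← sum_by_key (I.P a e) (I.Q a e) (I.key a e) (NK I.m) (I.key_lt a e)
      (fun κ => I.dec (κ % Ncfg I.m) k)]
    apply Finset.sum_congr rfl
    intro κ _
    simp only [scap, hY, true_and]
    rw [← Finset.sum_filter, Finset.sum_const, smul_eq_mul]
    congr 1
    have : (Finset.range (4 * I.m)).filter (fun l => l < I.dec (κ % Ncfg I.m) k) =
        Finset.range (I.dec (κ % Ncfg I.m) k) := by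
      ext l
      have := I.dec_le (κ % Ncfg I.m) k
      simp only [Finset.mem_filter, Finset.mem_range]
      omega
    rw [this, Finset.card_range]
  · simp [scap, hY]

theorem Vk_sum (k : ℕ) : ∑ i ∈ I.Vk k, I.w i =
    ∑ c ∈ Finset.range I.W, ∑ e ∈ Finset.range (4 * I.m), I.cnt e c k := by
  have h1 : ∀ i ∈ I.Vk k, I.w i = ∑ c ∈ Finset.range I.W, if I.col i c then 1 else 0 := by
    intro i hi
    have hV := (Finset.mem_filter.1 hi).1
    rw [← Finset.sum_filter, Finset.sum_const, smul_eq_mul, mul_one]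
    have : (Finset.range I.W).filter (fun c => I.col i c) = Finset.Ico (I.x i) (I.x i + I.w i) := by
      ext c
      simp only [Finset.mem_filter, Finset.mem_range, Finset.mem_Ico]
      exact ⟨fun h => h.2, fun h => ⟨I.col_lt (I.memJV hV) h, h⟩⟩
    rw [this]; simp
  rw [Finset.sum_congr rfl h1, Finset.sum_comm]
  apply Finset.sum_congr rfl
  intro c hc
  rw [← Finset.sum_filter, ← Finset.card_eq_sum_ones,
    Finset.card_eq_sum_card_fiberwise (f := I.lay c) (t := Finset.range (4 * I.m))]
  · apply Finset.sum_congr rfl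
    intro e _
    unfold cnt NT Vk
    congr 1
    ext i
    simp only [Finset.mem_filter]
    tauto
  · intro i hi
    have hi : i ∈ (I.Vk k).filter (fun i => I.col i c) := hi
    simp only [Vk, Finset.mem_filter] at hi
    simpa using (I.lay_mem hi.1.1 c).2

theorem cnt_Y {e c k : ℕ} (h : e ∉ I.Y (I.sl c)) : I.cnt e c k = 0 := by
  unfold cnt
  rw [Finset.card_eq_zero]
  apply Finset.filter_eq_empty_iff.2
  intro i hi
  simp only [NT, Finset.mem_filter] at hi
  exact absurd (hi.2.2.2 ▸ (I.lay_mem hi.1 c).1) h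

noncomputable def lossk (k : ℕ) : ℕ := ∑ c ∈ I.Cv, ∑ e ∈ Finset.range (4 * I.m), I.cnt e c k

theorem Vk_scap {k : ℕ} (hk : k ≤ I.m) : ∑ i ∈ I.Vk k, I.w i ≤ ∑ q ∈ I.SB, I.scap k q + I.lossk k := by
  rw [I.Vk_sum, I.scap_sum hk]
  have h1 : I.lossk k = ∑ c ∈ Finset.range I.W, if c ∈ I.Cv then
      ∑ e ∈ Finset.range (4 * I.m), I.cnt e c k else 0 := by
    rw [← Finset.sum_filter]
    unfold lossk
    apply Finset.sum_congr _ (fun _ _ => rfl)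
    ext c
    simp only [Finset.mem_filter, Cv]
    tauto
  rw [h1, ← I.slab_sum, ← I.slab_sum, ← Finset.sum_add_distrib]
  apply Finset.sum_le_sum
  intro a ha
  rw [mem_A] at ha
  have h2 : ∀ c, (if c ∈ I.Cv then ∑ e ∈ Finset.range (4 * I.m), I.cnt e c k else 0) =
      ∑ e ∈ Finset.range (4 * I.m), if c ∈ I.Cv then I.cnt e c k else 0 := by
    intro c; split_ifs <;> simp
  simp only [h2]
  rw [Finset.sum_comm, Finset.sum_comm (s := Finset.Ico a (I.en a)), ← Finset.sum_add_distrib]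
  apply Finset.sum_le_sum
  intro e he
  split_ifs with hY
  · obtain ⟨p1, p2, p3, p4⟩ := I.PQ_spec ha.2 e
    have h3 : ∑ c ∈ Finset.Ico (I.P a e) (I.Q a e), I.cnt e c k =
        ∑ c ∈ Finset.Ico a (I.en a), if I.P a e ≤ c ∧ c < I.Q a e then I.cnt e c k else 0 := by
      rw [← Finset.sum_filter]
      apply Finset.sum_congr _ (fun _ _ => rfl)
      ext c
      simp only [Finset.mem_filter, Finset.mem_Ico]
      omega
    rw [h3, ← Finset.sum_add_distrib]
    apply Finset.sum_le_sum
    intro c hc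
    rw [Finset.mem_Ico] at hc
    by_cases h4 : I.cov a e c
    · have := I.cov_Cv (lt_of_lt_of_le hc.2 (I.en_le ha.2)) h4
      rw [if_pos this]; omega
    · rw [if_pos ((I.PQ_cov ha.2 e hc.1 hc.2).2 h4)]; omega
  · rw [Finset.sum_eq_zero]
    · omega
    · intro c hc
      rw [Finset.mem_Ico] at hc
      apply I.cnt_Y
      rw [I.sl_eq ha.1 ha.2 hc.1 hc.2]
      exact hY

theorem fill_k {β k : ℕ} (hk : k ≤ I.m) (hβ : ∀ i ∈ I.V, I.w i ≤ β) :
    ∃ (V' : Finset α) (f : α → ℕ × ℕ × ℕ × ℕ), V' ⊆ I.Vk k ∧ (∀ i ∈ V', f i ∈ I.SB) ∧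
      (∀ q ∈ I.SB, ∑ i ∈ V' with f i = q, I.w i ≤ I.scap k q) ∧
      ∑ i ∈ I.Vk k \ V', I.w i ≤ I.lossk k + I.SB.card * β := by
  obtain ⟨V', f, h1, h2, h3, h4⟩ := fill_lemma (I.Vk k) I.SB I.w (I.scap k) β
    (fun i hi => (hβ i (Finset.mem_filter.1 hi).1).trans (by omega))
  refine ⟨V', f, h1, h2, fun q hq => by convert h3 q hq, ?_⟩
  have h5 := Finset.sum_sdiff h1 (f := I.w)
  have h6 := I.Vk_scap hk
  rcases h4 with h4 | h4
  · subst h4; simp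
  · omega

theorem lossk_le (k : ℕ) : I.lossk k ≤ I.s * (4 * I.m * (4 * I.m)) := by
  unfold lossk
  refine (Finset.sum_le_card_nsmul _ _ (4 * I.m * (4 * I.m)) ?_).trans ?_
  · intro c _
    refine (Finset.sum_le_card_nsmul _ _ (4 * I.m) (fun e _ => I.cnt_le e c k)).trans ?_
    simp
  · rw [smul_eq_mul]
    exact Nat.mul_le_mul_right _ I.Cv_card

end CoreIn



noncomputable def CC (m : ℕ) : ℕ :=
  (3 * m + 1) * ((m + 1) * (4 * m * (4 * m)) * (6 + 2 * NK m) + 2 * (NK m * NK m) + 6)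

noncomputable def KC (m : ℕ) : ℕ :=
  6 + 2 * (4 * m * (3 * (4 * m + 1))) + (m + 1) * (2 * (4 * m * (NK m * (4 * m)))) + 2 * (NK m * NK m)

namespace CoreIn

variable {α : Type} (I : CoreIn α)

noncomputable def FB : Finset (ℕ × ℕ × ℕ) := I.A ×ˢ Finset.range (NK I.m) ×ˢ Finset.range (NK I.m)

noncomputable def fcap (q : ℕ × ℕ × ℕ) : ℕ :=
  if I.okf q.1 q.2.1 q.2.2 then (I.freeR q.1 q.2.1 q.2.2).w else 0

theorem fcap_sum : ∑ q ∈ I.FB, I.fcap q = ∑ a ∈ I.A, ∑ q ∈ I.FI a, (I.freeR a q.1 q.2).w := by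
  unfold FB
  rw [Finset.sum_product]
  apply Finset.sum_congr rfl
  intro a _
  unfold FI
  rw [Finset.sum_filter]
  rfl

theorem A_card {nb : ℕ} (hnb : I.B.card + 1 ≤ nb) : I.A.card ≤ 2 * nb := by
  have h1 : I.A.card ≤ I.X.card := Finset.card_filter_le _ _
  have := I.Xcard
  omega

theorem SB_card : I.SB.card = I.A.card * (4 * I.m * (NK I.m * (4 * I.m))) := by
  simp [SB, Finset.card_product]

theorem FB_card : I.FB.card = I.A.card * (NK I.m * NK I.m) := by
  simp [FB, Finset.card_product]

theorem core_arith {m nk nb β W A s L F : ℕ} (hA : A ≤ 2 * nb) (hs : s ≤ 6 * nb * β)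
    (hL : L ≤ (m + 1) * (s * (4 * m * (4 * m)) + A * (4 * m * (nk * (4 * m))) * β))
    (hW : (3 * m + 1) * ((m + 1) * (4 * m * (4 * m)) * (6 + 2 * nk) + 2 * (nk * nk) + 6) * nb * β ≤ W)
    (hF : W ≤ (3 * m + 1) * (F + s)) : L + A * (nk * nk) * β ≤ F ∧ m * L ≤ W := by
  have h1 : L + A * (nk * nk) * β + s ≤
      ((m + 1) * (4 * m * (4 * m)) * (6 + 2 * nk) + 2 * (nk * nk) + 6) * nb * β := by
    calc L + A * (nk * nk) * β + s ≤ (m + 1) * ((6 * nb * β) * (4 * m * (4 * m)) +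
          (2 * nb) * (4 * m * (nk * (4 * m))) * β) + (2 * nb) * (nk * nk) * β + 6 * nb * β := by
          gcongr
          refine hL.trans ?_
          gcongr
      _ = _ := by ring
  have h2 : (3 * m + 1) * (L + A * (nk * nk) * β + s) ≤ W := by
    refine (Nat.mul_le_mul_left _ h1).trans (le_trans (le_of_eq ?_) hW)
    ring
  constructor
  · have h3 := Nat.le_of_mul_le_mul_left (h2.trans hF) (by omega)
    omega
  · refine le_trans ?_ h2
    apply Nat.mul_le_mul <;> omega

theorem slot_h {k : ℕ} (hk : k ≤ I.m) {q : ℕ × ℕ × ℕ × ℕ} (h : 0 < I.scap k q) :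
    q.2.1 ∈ I.Y q.1 ∧ (I.slotR q.1 q.2.1 q.2.2.1 k q.2.2.2).h = k ∧
    I.scap k q = (I.slotR q.1 q.2.1 q.2.2.1 k q.2.2.2).w := by
  unfold scap at h ⊢
  split_ifs at h ⊢ with h1
  · refine ⟨h1.1, ?_, rfl⟩
    simp only [slotR]
    exact if_pos ⟨hk, h1.2⟩
  · omega

theorem free_h {q : ℕ × ℕ × ℕ} (h : 0 < I.fcap q) :
    (I.freeR q.1 q.2.1 q.2.2).h = I.m ∧ I.fcap q = (I.freeR q.1 q.2.1 q.2.2).w := by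
  unfold fcap at h ⊢
  split_ifs at h ⊢ with h1
  · refine ⟨?_, rfl⟩
    simp only [freeR]
    exact if_pos h1
  · omega

theorem mem_le_sum {S : Finset α} {w : α → ℕ} {i : α} (hi : i ∈ S) : w i ≤ ∑ j ∈ S, w j :=
  Finset.single_le_sum (fun _ _ => Nat.zero_le _) hi

theorem core {nb β : ℕ} (hnb : I.B.card + 1 ≤ nb) (hβ : ∀ i ∈ I.V, I.w i ≤ β)
    (hC : CC I.m * nb * β ≤ I.W) :
    ∃ a : α → Cid α, (∀ v ∈ I.V, I.Ok (a v) ∧ I.k v ≤ (I.CR (a v)).h) ∧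
      (I.V.image a).card ≤ KC I.m * nb ∧
      (∀ s, ∑ v ∈ I.V.filter (fun v => a v = s), I.w v ≤ (I.CR s).w) ∧
      ∑ v ∈ I.V, I.w v * (I.CR (a v)).h ≤ ∑ v ∈ I.V, I.w v * I.k v + I.W := by
  have hex : ∀ k, ∃ (V' : Finset α) (f : α → ℕ × ℕ × ℕ × ℕ), k ≤ I.m → V' ⊆ I.Vk k ∧
      (∀ i ∈ V', f i ∈ I.SB) ∧
      (∀ q ∈ I.SB, ∑ i ∈ V' with f i = q, I.w i ≤ I.scap k q) ∧
      ∑ i ∈ I.Vk k \ V', I.w i ≤ I.lossk k + I.SB.card * β := by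
    intro k
    by_cases hk : k ≤ I.m
    · obtain ⟨V', f, h⟩ := I.fill_k hk hβ
      exact ⟨V', f, fun _ => h⟩
    · exact ⟨∅, fun _ => (0, 0, 0, 0), fun h => absurd h hk⟩
  choose V' f hf using hex
  let Lo : Finset α := I.V.filter (fun i => ¬ I.Tall i ∧ i ∉ V' (I.k i))
  have hLo : ∑ i ∈ Lo, I.w i ≤ (I.m + 1) * (I.s * (4 * I.m * (4 * I.m)) + I.SB.card * β) := by
    have h1 : Lo ⊆ (Finset.range (I.m + 1)).biUnion (fun k => I.Vk k \ V' k) := by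
      intro i hi
      simp only [Lo, Finset.mem_filter] at hi
      simp only [Finset.mem_biUnion, Finset.mem_range, Finset.mem_sdiff, Vk, Finset.mem_filter]
      have : I.k i ≤ I.m := by have := hi.2.1; unfold Tall at this; omega
      exact ⟨I.k i, by omega, ⟨hi.1, hi.2.1, rfl⟩, hi.2.2⟩
    refine (Finset.sum_le_sum_of_subset h1).trans ?_
    rw [Finset.sum_biUnion]
    · refine (Finset.sum_le_card_nsmul _ _ (I.s * (4 * I.m * (4 * I.m)) + I.SB.card * β) ?_).trans ?_
      · intro k hk
        rw [Finset.mem_range] at hk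
        have h2 := (hf k (by omega)).2.2.2
        have h3 := I.lossk_le k
        omega
      · simp
    · intro k _ k' _ hkk
      rw [Function.onFun, Finset.disjoint_left]
      intro i hi hi'
      simp only [Finset.mem_sdiff, Vk, Finset.mem_filter] at hi hi'
      exact hkk (hi.1.2.2.symm.trans hi'.1.2.2)
  have hs : I.s ≤ 6 * nb * β := by
    refine (I.s_le hβ).trans (Nat.mul_le_mul_right _ ?_)
    have := I.Xcard
    omega
  have hA := I.A_card hnb
  rw [I.SB_card] at hLo
  obtain ⟨hfit, hmL⟩ := core_arith hA hs hLo hC I.free_total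
  rw [← I.fcap_sum, ← I.FB_card] at hfit
  obtain ⟨g, hg1, hg2⟩ := fill_all Lo I.FB I.w I.fcap β (fun i hi => hβ i (Finset.mem_filter.1 hi).1)
    (fun i hi => I.wpos (I.memJV (Finset.mem_filter.1 hi).1)) hfit
  replace hg2 : ∀ q ∈ I.FB, ∑ i ∈ Lo with g i = q, I.w i ≤ I.fcap q := fun q hq => by
    convert hg2 q hq
  let a : α → Cid α := fun v => if I.Fx v then .fix v else if I.Tall v then
    .tall (I.tid v).1 (I.tid v).2.1 (I.tid v).2.2 else if v ∈ V' (I.k v) then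
    .slot (f (I.k v) v).1 (f (I.k v) v).2.1 (f (I.k v) v).2.2.1 (I.k v) (f (I.k v) v).2.2.2
    else .free (g v).1 (g v).2.1 (g v).2.2
  have ha1 : ∀ v, I.Fx v → a v = .fix v := fun v h => if_pos h
  have ha2 : ∀ v, ¬ I.Fx v → I.Tall v → a v = .tall (I.tid v).1 (I.tid v).2.1 (I.tid v).2.2 :=
    fun v h1 h2 => by simp only [a]; rw [if_neg h1, if_pos h2]
  have ha3 : ∀ v, ¬ I.Tall v → v ∈ V' (I.k v) → a v =
      .slot (f (I.k v) v).1 (f (I.k v) v).2.1 (f (I.k v) v).2.2.1 (I.k v) (f (I.k v) v).2.2.2 :=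
    fun v h1 h2 => by simp only [a]; rw [if_neg (fun h => h1 h.2.1), if_neg h1, if_pos h2]
  have ha4 : ∀ v, ¬ I.Tall v → v ∉ V' (I.k v) → a v = .free (g v).1 (g v).2.1 (g v).2.2 :=
    fun v h1 h2 => by simp only [a]; rw [if_neg (fun h => h1 h.2.1), if_neg h1, if_neg h2]
  have hslot : ∀ v ∈ I.V, ¬ I.Tall v → v ∈ V' (I.k v) → f (I.k v) v ∈ I.SB ∧
      0 < I.scap (I.k v) (f (I.k v) v) ∧ I.k v ≤ I.m := by
    intro v hv hT hV'
    have hk : I.k v ≤ I.m := by unfold Tall at hT; omega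
    obtain ⟨h1, h2, h3, -⟩ := hf (I.k v) hk
    refine ⟨h2 v hV', ?_, hk⟩
    refine lt_of_lt_of_le (I.wpos (I.memJV hv)) (le_trans ?_ (h3 _ (h2 v hV')))
    exact mem_le_sum (Finset.mem_filter.2 ⟨hV', rfl⟩)
  have hfree : ∀ v ∈ I.V, ¬ I.Tall v → v ∉ V' (I.k v) → g v ∈ I.FB ∧ 0 < I.fcap (g v) := by
    intro v hv hT hV'
    have hL : v ∈ Lo := Finset.mem_filter.2 ⟨hv, hT, hV'⟩
    refine ⟨hg1 v hL, lt_of_lt_of_le (I.wpos (I.memJV hv)) (le_trans ?_ (hg2 _ (hg1 v hL)))⟩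
    exact mem_le_sum (Finset.mem_filter.2 ⟨hL, rfl⟩)
  have hslw : ∀ v ∈ I.V, I.sl (I.x v) < I.W := fun v hv =>
    lt_of_le_of_lt (I.sl_le _) (I.col_lt (I.memJV hv) (I.col_x hv))
  have hok : ∀ v ∈ I.V, I.Ok (a v) ∧ I.k v ≤ (I.CR (a v)).h ∧ (v ∉ Lo → (I.CR (a v)).h = I.k v) ∧
      (I.CR (a v)).h ≤ I.k v + (if v ∈ Lo then I.m else 0) := by
    intro v hv
    by_cases h1 : I.Fx v
    · rw [ha1 v h1]
      exact ⟨h1, le_rfl, fun _ => rfl, Nat.le_add_right _ _⟩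
    by_cases h2 : I.Tall v
    · rw [ha2 v h1 h2]
      obtain ⟨e1, e2, e3⟩ := I.home_spec hv
      have e4 := I.tall_h (i := v) (Finset.mem_filter.2 ⟨hv, h2, h1⟩)
      exact ⟨⟨I.sl_mem _, hslw v hv, e1, e2⟩, e4.ge, fun _ => e4, e4.le.trans (Nat.le_add_right _ _)⟩
    by_cases h3 : v ∈ V' (I.k v)
    · rw [ha3 v h2 h3]
      obtain ⟨e1, e2, e3⟩ := hslot v hv h2 h3
      obtain ⟨e4, e5, e6⟩ := I.slot_h e3 e2
      simp only [SB, Finset.mem_product, mem_A, Finset.mem_range] at e1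
      exact ⟨⟨e1.1.1, e1.1.2, e4, e1.2.1⟩, e5.ge, fun _ => e5, e5.le.trans (Nat.le_add_right _ _)⟩
    · rw [ha4 v h2 h3]
      obtain ⟨e1, e2⟩ := hfree v hv h2 h3
      obtain ⟨e3, e4⟩ := I.free_h e2
      have hL : v ∈ Lo := Finset.mem_filter.2 ⟨hv, h2, h3⟩
      simp only [FB, Finset.mem_product, mem_A, Finset.mem_range] at e1
      refine ⟨⟨e1.1.1, e1.1.2⟩, ?_, fun h => absurd hL h, ?_⟩
      · change _ ≤ (I.freeR _ _ _).h
        rw [e3]; unfold Tall at h2; omega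
      · change (I.freeR _ _ _).h ≤ _
        rw [e3, if_pos hL]; omega
  refine ⟨a, fun v hv => ⟨(hok v hv).1, (hok v hv).2.1⟩, ?_, ?_, ?_⟩
  · -- counting
    let T1 : Finset (Cid α) := I.Fs.image .fix
    let T2 : Finset (Cid α) := (I.A ×ˢ Finset.range (4 * I.m) ×ˢ Finset.range (3 * (4 * I.m + 1))).image
      (fun q => .tall q.1 q.2.1 q.2.2)
    let T3 : Finset (Cid α) := (Finset.range (I.m + 1) ×ˢ I.SB).image
      (fun q => .slot q.2.1 q.2.2.1 q.2.2.2.1 q.1 q.2.2.2.2)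
    let T4 : Finset (Cid α) := I.FB.image (fun q => .free q.1 q.2.1 q.2.2)
    have hsub : I.V.image a ⊆ T1 ∪ (T2 ∪ (T3 ∪ T4)) := by
      intro s hs
      obtain ⟨v, hv, rfl⟩ := Finset.mem_image.1 hs
      by_cases h1 : I.Fx v
      · rw [ha1 v h1]
        exact Finset.mem_union_left _ (Finset.mem_image_of_mem _ (Finset.mem_filter.2 ⟨hv, h1⟩))
      apply Finset.mem_union_right
      by_cases h2 : I.Tall v
      · rw [ha2 v h1 h2]
        apply Finset.mem_union_left
        apply Finset.mem_image.2
        refine ⟨I.tid v, ?_, rfl⟩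
        simp only [Finset.mem_product, mem_A, Finset.mem_range]
        exact ⟨⟨I.sl_mem _, hslw v hv⟩, (I.home_spec hv).2.1, I.tkey_lt _ _ _⟩
      apply Finset.mem_union_right
      by_cases h3 : v ∈ V' (I.k v)
      · rw [ha3 v h2 h3]
        apply Finset.mem_union_left
        apply Finset.mem_image.2
        obtain ⟨e1, e2, e3⟩ := hslot v hv h2 h3
        exact ⟨(I.k v, f (I.k v) v), Finset.mem_product.2 ⟨Finset.mem_range.2 (by change I.k v < _; omega), e1⟩, rfl⟩
      · rw [ha4 v h2 h3]
        apply Finset.mem_union_right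
        apply Finset.mem_image.2
        exact ⟨g v, (hfree v hv h2 h3).1, rfl⟩
    have c1 : T1.card ≤ 6 * nb := by
      refine Finset.card_image_le.trans (I.Fs_card.trans ?_)
      have := I.Xcard
      omega
    have c2 : T2.card ≤ I.A.card * (4 * I.m * (3 * (4 * I.m + 1))) := by
      refine Finset.card_image_le.trans ?_
      simp [Finset.card_product]
    have c3 : T3.card ≤ (I.m + 1) * (I.A.card * (4 * I.m * (NK I.m * (4 * I.m)))) := by
      refine Finset.card_image_le.trans ?_
      rw [← I.SB_card]
      simp [Finset.card_product]
    have c4 : T4.card ≤ I.A.card * (NK I.m * NK I.m) := by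
      refine Finset.card_image_le.trans ?_
      rw [I.FB_card]
    calc _ ≤ _ := Finset.card_le_card hsub
      _ ≤ T1.card + (T2.card + (T3.card + T4.card)) :=
        (Finset.card_union_le _ _).trans (Nat.add_le_add_left ((Finset.card_union_le _ _).trans
          (Nat.add_le_add_left (Finset.card_union_le _ _) _)) _)
      _ ≤ 6 * nb + (2 * nb * (4 * I.m * (3 * (4 * I.m + 1))) +
          ((I.m + 1) * (2 * nb * (4 * I.m * (NK I.m * (4 * I.m)))) + 2 * nb * (NK I.m * NK I.m))) := by
        gcongr
        · exact c2.trans (Nat.mul_le_mul_right _ hA)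
        · exact c3.trans (Nat.mul_le_mul_left _ (Nat.mul_le_mul_right _ hA))
        · exact c4.trans (Nat.mul_le_mul_right _ hA)
      _ = KC I.m * nb := by unfold KC; ring
  · -- widths
    intro s
    by_cases hne : ∃ v ∈ I.V, a v = s
    swap
    · push Not at hne
      rw [Finset.filter_eq_empty_iff.2 (fun {v} hv => hne v hv)]
      simp
    obtain ⟨v0, hv0, rfl⟩ := hne
    have hcase : ∀ v, (I.Fx v ∧ a v = .fix v) ∨ (¬ I.Fx v ∧ I.Tall v ∧
        a v = .tall (I.tid v).1 (I.tid v).2.1 (I.tid v).2.2) ∨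
        (¬ I.Tall v ∧ v ∈ V' (I.k v) ∧ a v =
      .slot (f (I.k v) v).1 (f (I.k v) v).2.1 (f (I.k v) v).2.2.1 (I.k v) (f (I.k v) v).2.2.2) ∨
        (¬ I.Tall v ∧ v ∉ V' (I.k v) ∧ a v = .free (g v).1 (g v).2.1 (g v).2.2) := by
      intro v
      by_cases h1 : I.Fx v
      · exact Or.inl ⟨h1, ha1 v h1⟩
      by_cases h2 : I.Tall v
      · exact Or.inr (Or.inl ⟨h1, h2, ha2 v h1 h2⟩)
      by_cases h3 : v ∈ V' (I.k v)
      · exact Or.inr (Or.inr (Or.inl ⟨h2, h3, ha3 v h2 h3⟩))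
      · exact Or.inr (Or.inr (Or.inr ⟨h2, h3, ha4 v h2 h3⟩))
    rcases hcase v0 with ⟨h1, e⟩ | ⟨h1, h2, e⟩ | ⟨h2, h3, e⟩ | ⟨h2, h3, e⟩
    · rw [e]
      have : I.V.filter (fun v => a v = .fix v0) ⊆ {v0} := by
        intro v hv
        rw [Finset.mem_filter] at hv
        rcases hcase v with ⟨-, e'⟩ | ⟨-, -, e'⟩ | ⟨-, -, e'⟩ | ⟨-, -, e'⟩ <;> rw [e'] at hv <;> simp at hv
        simpa using hv.2
      refine (Finset.sum_le_sum_of_subset this).trans ?_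
      rw [Finset.sum_singleton]
      exact le_rfl
    · rw [e]
      refine le_trans (Finset.sum_le_sum_of_subset ?_) (I.tall_fit (I.tid v0))
      intro v hv
      rw [Finset.mem_filter] at hv
      obtain ⟨hv, hv2⟩ := hv
      rcases hcase v with ⟨-, e'⟩ | ⟨q1, q2, e'⟩ | ⟨-, -, e'⟩ | ⟨-, -, e'⟩ <;> rw [e'] at hv2 <;> simp at hv2
      rw [Finset.mem_filter]
      exact ⟨Finset.mem_filter.2 ⟨hv, q2, q1⟩, Prod.ext hv2.1 (Prod.ext hv2.2.1 hv2.2.2)⟩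
    · rw [e]
      obtain ⟨e1, e2, e3⟩ := hslot v0 hv0 h2 h3
      obtain ⟨e4, e5, e6⟩ := I.slot_h e3 e2
      refine le_trans (Finset.sum_le_sum_of_subset ?_) (((hf (I.k v0) e3).2.2.1 _ e1).trans e6.le)
      intro v hv
      rw [Finset.mem_filter] at hv
      obtain ⟨hv, hv2⟩ := hv
      rcases hcase v with ⟨-, e'⟩ | ⟨q1, q2, e'⟩ | ⟨q1, q2, e'⟩ | ⟨-, -, e'⟩ <;> rw [e'] at hv2 <;> simp at hv2
      rw [Finset.mem_filter]
      obtain ⟨r1, r2, r3, r4, r5⟩ := hv2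
      rw [r4] at q2 r1 r2 r3 r5
      exact ⟨q2, Prod.ext r1 (Prod.ext r2 (Prod.ext r3 r5))⟩
    · rw [e]
      obtain ⟨e1, e2⟩ := hfree v0 hv0 h2 h3
      obtain ⟨e3, e4⟩ := I.free_h e2
      refine le_trans (Finset.sum_le_sum_of_subset ?_) ((hg2 _ e1).trans e4.le)
      intro v hv
      rw [Finset.mem_filter] at hv
      obtain ⟨hv, hv2⟩ := hv
      rcases hcase v with ⟨-, e'⟩ | ⟨q1, q2, e'⟩ | ⟨q1, q2, e'⟩ | ⟨q1, q2, e'⟩ <;> rw [e'] at hv2 <;> simp at hv2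
      rw [Finset.mem_filter]
      exact ⟨Finset.mem_filter.2 ⟨hv, q1, q2⟩, Prod.ext hv2.1 (Prod.ext hv2.2.1 hv2.2.2)⟩
  · -- area
    calc ∑ v ∈ I.V, I.w v * (I.CR (a v)).h
        ≤ ∑ v ∈ I.V, (I.w v * I.k v + (if v ∈ Lo then I.m * I.w v else 0)) := by
          apply Finset.sum_le_sum
          intro v hv
          have h1 := Nat.mul_le_mul_left (I.w v) (hok v hv).2.2.2
          refine h1.trans (le_of_eq ?_)
          split_ifs <;> ring
      _ = ∑ v ∈ I.V, I.w v * I.k v + I.m * ∑ v ∈ Lo, I.w v := by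
          rw [Finset.sum_add_distrib, ← Finset.sum_filter, Finset.mul_sum]
          congr 1
          apply Finset.sum_congr _ (fun _ _ => rfl)
          ext v
          simp only [Finset.mem_filter, Lo]
          tauto
      _ ≤ _ := Nat.add_le_add_left hmL _

end CoreIn



/-- intervals of `i` and `j` are separated -/
def ISep {ι : Type*} (x w : ι → ℕ) (i j : ι) : Prop := x i + w i ≤ x j ∨ x j + w j ≤ x i

theorem line_up {ι : Type*} (S : Finset ι) (w : ι → ℕ) :
    ∃ x : ι → ℕ, (∀ i ∈ S, x i + w i ≤ ∑ j ∈ S, w j) ∧ ∀ i ∈ S, ∀ j ∈ S, i ≠ j → ISep x w i j := by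
  induction S using Finset.induction_on with
  | empty => exact ⟨fun _ => 0, by simp, by simp⟩
  | insert a S ha ih =>
    obtain ⟨x, h1, h2⟩ := ih
    refine ⟨fun i => if i = a then ∑ j ∈ S, w j else x i, ?_, ?_⟩
    · intro i hi
      rw [Finset.sum_insert ha]
      by_cases hia : i = a
      · subst hia; simp; omega
      · simp only [hia, if_false]
        have := h1 i (by simpa [hia] using hi)
        omega
    · intro i hi j hj hij
      by_cases hia : i = a <;> by_cases hja : j = a
      · exact absurd (hia.trans hja.symm) hij
      · right; subst hia
        simp only [hja, if_false, if_true]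
        exact h1 j (by simpa [hja] using hj)
      · left; subst hja
        simp only [hia, if_false, if_true]
        exact h1 i (by simpa [hia] using hi)
      · have := h2 i (by simpa [hia] using hi) j (by simpa [hja] using hj) hij
        simpa only [ISep, hia, hja, if_false] using this

theorem nfdh {ι : Type*} (w h : ι → ℕ) (A ω : ℕ) (hω : ω < A) : ∀ (n : ℕ) (S : Finset ι), S.card ≤ n →
    ∀ D η : ℕ, (∀ i ∈ S, w i ≤ ω ∧ h i ≤ η) → ∑ i ∈ S, w i * h i ≤ (A - ω) * D →
    ∃ x y : ι → ℕ, (∀ i ∈ S, x i + w i ≤ A ∧ y i + h i ≤ η + D) ∧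
      ∀ i ∈ S, ∀ j ∈ S, i ≠ j → ISep x w i j ∨ ISep y h i j := by
  intro n
  induction n with
  | zero =>
    intro S hS D η _ _
    have : S = ∅ := Finset.card_eq_zero.1 (by omega)
    subst this
    exact ⟨fun _ => 0, fun _ => 0, by simp, by simp⟩
  | succ n ih =>
    intro S hS D η hb hsum
    obtain ⟨P, hPS, hPw, hPk, hP⟩ := prefix_lemma S h w A
    obtain ⟨x0, hx0, hx0'⟩ := line_up P w
    by_cases hPeq : P = S
    · subst hPeq
      refine ⟨x0, fun _ => 0, ?_, fun i hi j hj hij => Or.inl (hx0' i hi j hj hij)⟩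
      intro i hi
      have := hx0 i hi
      have := (hb i hi).2
      simp only
      omega
    · obtain ⟨j0, hj0, hj0P, hA⟩ := hP.resolve_left hPeq
      have hwj := (hb j0 hj0).1
      have hne : P.Nonempty := by
        by_contra hne
        rw [Finset.not_nonempty_iff_eq_empty] at hne
        subst hne
        simp at hA; omega
      have hne' : (S \ P).Nonempty := ⟨j0, Finset.mem_sdiff.2 ⟨hj0, hj0P⟩⟩
      obtain ⟨jm, hjm, hmax⟩ := (S \ P).exists_max_image h hne'
      have hjm' := Finset.mem_sdiff.1 hjm
      have harea : (A - ω) * h jm ≤ ∑ i ∈ P, w i * h i := by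
        calc (A - ω) * h jm ≤ (∑ i ∈ P, w i) * h jm := Nat.mul_le_mul_right _ (by omega)
          _ = ∑ i ∈ P, w i * h jm := Finset.sum_mul _ _ _
          _ ≤ _ := Finset.sum_le_sum (fun i hi => Nat.mul_le_mul_left _ (hPk i hi jm hjm'.1 hjm'.2))
      have hsp := Finset.sum_sdiff hPS (f := fun i => w i * h i)
      have hle : h jm ≤ D := by
        have : (A - ω) * h jm ≤ (A - ω) * D := by omega
        exact Nat.le_of_mul_le_mul_left this (by omega)
      have hcard : (S \ P).card ≤ n := by
        have h1 := Finset.card_sdiff_add_card_eq_card hPS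
        have h2 := hne.card_pos
        omega
      obtain ⟨x1, y1, h1, h2⟩ := ih (S \ P) hcard (D - h jm) (h jm)
        (fun i hi => ⟨(hb i (Finset.mem_sdiff.1 hi).1).1, hmax i hi⟩) (by
          rw [Nat.mul_sub]; omega)
      refine ⟨fun i => if i ∈ P then x0 i else x1 i, fun i => if i ∈ P then 0 else η + y1 i, ?_, ?_⟩
      · intro i hi
        have hbi := hb i hi
        by_cases hiP : i ∈ P
        · simp only [hiP, if_true]
          have := hx0 i hiP
          omega
        · simp only [hiP, if_false]
          have := h1 i (Finset.mem_sdiff.2 ⟨hi, hiP⟩)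
          omega
      · intro i hi j hj hij
        by_cases hiP : i ∈ P <;> by_cases hjP : j ∈ P
        · left
          have := hx0' i hiP j hjP hij
          simpa only [ISep, hiP, hjP, if_true] using this
        · right; left
          simp only [hiP, hjP, if_true, if_false]
          have := (hb i hi).2
          omega
        · right; right
          simp only [hiP, hjP, if_true, if_false]
          have := (hb j hj).2
          omega
        · have := h2 i (Finset.mem_sdiff.2 ⟨hi, hiP⟩) j (Finset.mem_sdiff.2 ⟨hj, hjP⟩) hij
          rcases this with h | h
          · left; simpa only [ISep, hiP, hjP, if_false] using h
          · right
            simp only [ISep, hiP, hjP, if_false] at h ⊢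
            omega

/-- separated boxes -/
theorem Rec.Dj.sep {r s : Rec} (h : r.Dj s) (h1 : 0 < r.w) (h2 : 0 < r.h) (h3 : 0 < s.w) (h4 : 0 < s.h) :
    r.x + r.w ≤ s.x ∨ s.x + s.w ≤ r.x ∨ r.y + r.h ≤ s.y ∨ s.y + s.h ≤ r.y := by
  by_contra hc
  push Not at hc
  refine h (max r.x s.x) (max r.y s.y) ?_ ?_ <;> unfold Rec.mem <;> omega

/-- items inside a vertical box -/
def VFit {ι : Type*} (S : Finset ι) (w h : ι → ℕ) (R : Rec) : Prop :=
  ∑ i ∈ S, w i ≤ R.w ∧ ∀ i ∈ S, h i ≤ R.h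
/-- items inside a horizontal box -/
def HFit {ι : Type*} (S : Finset ι) (w h : ι → ℕ) (R : Rec) : Prop :=
  ∑ i ∈ S, h i ≤ R.h ∧ ∀ i ∈ S, w i ≤ R.w
/-- items packed by area -/
def AFit {ι : Type*} (S : Finset ι) (w h : ι → ℕ) (R : Rec) : Prop :=
  ∃ ω η, (∀ i ∈ S, w i ≤ ω ∧ h i ≤ η ∧ 0 < w i * h i) ∧ ∑ i ∈ S, w i * h i ≤ (R.w - ω) * (R.h - η)

theorem box_pack {ι : Type*} (S : Finset ι) (w h : ι → ℕ) (R : Rec)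
    (hfit : VFit S w h R ∨ HFit S w h R ∨ AFit S w h R) :
    ∃ x y : ι → ℕ, (∀ i ∈ S, R.x ≤ x i ∧ x i + w i ≤ R.x + R.w ∧ R.y ≤ y i ∧ y i + h i ≤ R.y + R.h) ∧
      (∀ i ∈ S, ∀ j ∈ S, i ≠ j → ISep x w i j ∨ ISep y h i j) ∧
      (VFit S w h R → ∀ i ∈ S, ∀ j ∈ S, i ≠ j → ISep x w i j) ∧
      (¬ VFit S w h R → HFit S w h R → ∀ i ∈ S, ∀ j ∈ S, i ≠ j → ISep y h i j) := by
  by_cases hV : VFit S w h R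
  · obtain ⟨x, h1, h2⟩ := line_up S w
    have h3 : ∀ i ∈ S, ∀ j ∈ S, i ≠ j → ISep (fun i => R.x + x i) w i j := by
      intro i hi j hj hij
      have := h2 i hi j hj hij
      unfold ISep at *
      beta_reduce
      omega
    refine ⟨fun i => R.x + x i, fun _ => R.y, ?_, fun i hi j hj hij => Or.inl (h3 i hi j hj hij),
      fun _ => h3, fun h => absurd hV h⟩
    intro i hi
    have := h1 i hi
    have := hV.1
    have := hV.2 i hi
    simp only
    omega
  by_cases hH : HFit S w h R
  · obtain ⟨y, h1, h2⟩ := line_up S h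
    have h3 : ∀ i ∈ S, ∀ j ∈ S, i ≠ j → ISep (fun i => R.y + y i) h i j := by
      intro i hi j hj hij
      have := h2 i hi j hj hij
      unfold ISep at *
      beta_reduce
      omega
    refine ⟨fun i => R.x, fun i => R.y + y i, ?_, fun i hi j hj hij => Or.inr (h3 i hi j hj hij),
      fun h => absurd h hV, fun _ _ => h3⟩
    intro i hi
    have := h1 i hi
    have := hH.1
    have := hH.2 i hi
    simp only
    omega
  obtain ⟨ω, η, h1, h2⟩ := (hfit.resolve_left hV).resolve_left hH
  rcases S.eq_empty_or_nonempty with rfl | ⟨i0, hi0⟩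
  · exact absurd ⟨by simp, by simp⟩ hV
  have hpos : 0 < (R.w - ω) * (R.h - η) :=
    lt_of_lt_of_le (lt_of_lt_of_le (h1 i0 hi0).2.2
      (Finset.single_le_sum (f := fun i => w i * h i) (fun _ _ => Nat.zero_le _) hi0)) h2
  have hp1 : 0 < R.w - ω := Nat.pos_of_mul_pos_right hpos
  have hp2 : 0 < R.h - η := Nat.pos_of_mul_pos_left hpos
  obtain ⟨x, y, h3, h4⟩ := nfdh w h R.w ω (by omega) S.card S le_rfl (R.h - η) η
    (fun i hi => ⟨(h1 i hi).1, (h1 i hi).2.1⟩) h2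
  refine ⟨fun i => R.x + x i, fun i => R.y + y i, ?_, ?_, fun h => absurd h hV, fun _ h => absurd h hH⟩
  · intro i hi
    have := h3 i hi
    simp only
    omega
  · intro i hi j hj hij
    have := h4 i hi j hj hij
    unfold ISep at *
    beta_reduce
    omega

/-- Packing all items into pairwise disjoint boxes. -/
theorem boxes_pack {ι σ : Type*} [Fintype ι] (w h : ι → ℕ) (hpos : ∀ i, 0 < w i ∧ 0 < h i)
    (a : ι → σ) (R : σ → Rec)
    (hR : ∀ i j, a i ≠ a j → (R (a i)).Dj (R (a j)))
    (hfit : ∀ s, VFit (Finset.univ.filter (fun i => a i = s)) w h (R s) ∨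
      HFit (Finset.univ.filter (fun i => a i = s)) w h (R s) ∨
      AFit (Finset.univ.filter (fun i => a i = s)) w h (R s)) :
    ∃ x y : ι → ℕ, (∀ i, (R (a i)).x ≤ x i ∧ x i + w i ≤ (R (a i)).x + (R (a i)).w ∧
        (R (a i)).y ≤ y i ∧ y i + h i ≤ (R (a i)).y + (R (a i)).h) ∧
      (∀ i j, i ≠ j → ISep x w i j ∨ ISep y h i j) ∧
      (∀ s, VFit (Finset.univ.filter (fun i => a i = s)) w h (R s) →
        ∀ i j, a i = s → a j = s → i ≠ j → ISep x w i j) ∧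
      (∀ s, ¬ VFit (Finset.univ.filter (fun i => a i = s)) w h (R s) →
        HFit (Finset.univ.filter (fun i => a i = s)) w h (R s) →
        ∀ i j, a i = s → a j = s → i ≠ j → ISep y h i j) := by
  choose x y h1 h2 h3 h4 using fun s => box_pack (Finset.univ.filter (fun i => a i = s)) w h (R s) (hfit s)
  have hm : ∀ i s, a i = s → i ∈ Finset.univ.filter (fun i => a i = s) := by
    intro i s h; simp [h]
  have hin := fun i => h1 (a i) i (hm i _ rfl)
  refine ⟨fun i => x (a i) i, fun i => y (a i) i, hin, ?_, ?_, ?_⟩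
  · intro i j hij
    by_cases hs : a i = a j
    · have := h2 (a j) i (hm i _ hs) j (hm j _ rfl) hij
      unfold ISep at *
      simpa only [hs] using this
    · have e1 := hin i
      have e2 := hin j
      have p1 := hpos i
      have p2 := hpos j
      have := (hR i j hs).sep (by omega) (by omega) (by omega) (by omega)
      unfold ISep
      simp only
      omega
  · intro s hV i j hi hj hij
    have := h3 s hV i (hm i _ hi) j (hm j _ hj) hij
    unfold ISep at *
    simpa only [hi, hj] using this
  · intro s hV hH i j hi hj hij
    have := h4 s hV hH i (hm i _ hi) j (hm j _ hj) hij
    unfold ISep at *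
    simpa only [hi, hj] using this



/-- grid points of a rectangle -/
def Rec.pts (r : Rec) : Finset (ℕ × ℕ) := Finset.Ico r.x (r.x + r.w) ×ˢ Finset.Ico r.y (r.y + r.h)

theorem Rec.card_pts (r : Rec) : r.pts.card = r.w * r.h := by
  simp [Rec.pts]

theorem Rec.mem_pts (r : Rec) (p : ℕ × ℕ) : p ∈ r.pts ↔ r.mem p.1 p.2 := by
  simp [Rec.pts, Rec.mem]; tauto

theorem AFit.of_empty {ι : Type*} (w h : ι → ℕ) (R : Rec) : AFit ∅ w h R := ⟨0, 0, by simp, by simp⟩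

theorem sub_mul_sub_ge (a b ω η : ℕ) : a * b ≤ (a - ω) * (b - η) + (ω * b + η * a) := by
  rcases le_total a ω with h | h
  · have := Nat.mul_le_mul_right b h
    omega
  rcases le_total b η with h' | h'
  · have := Nat.mul_le_mul_left a h'
    rw [Nat.mul_comm a η] at this
    omega
  obtain ⟨c, rfl⟩ := Nat.exists_eq_add_of_le h
  obtain ⟨d, rfl⟩ := Nat.exists_eq_add_of_le h'
  simp only [Nat.add_sub_cancel_left]
  nlinarith

theorem cells {ι σ : Type*} (MB : Finset σ) (R : σ → Rec) (W T : ℕ)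
    (hR : ∀ s ∈ MB, (R s).x + (R s).w ≤ W ∧ (R s).y + (R s).h ≤ T)
    (S : Finset ι) (w h : ι → ℕ) (ω η M : ℕ) (hM : (2 * MB.card + 2) * (2 * MB.card + 2) ≤ M)
    (hS : ∀ i ∈ S, w i ≤ ω ∧ h i ≤ η ∧ 0 < w i * h i)
    (hsum : ∑ i ∈ S, w i * h i + ∑ s ∈ MB, (R s).w * (R s).h + M * (ω * T + η * W + ω * η) ≤ W * T) :
    ∃ (f : ι → ℕ × ℕ) (Q : ℕ × ℕ → Rec),
      (∀ i ∈ S, ∀ s ∈ MB, (Q (f i)).Dj (R s)) ∧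
      (∀ i ∈ S, ∀ j ∈ S, f i ≠ f j → (Q (f i)).Dj (Q (f j))) ∧
      (∀ i ∈ S, (Q (f i)).x + (Q (f i)).w ≤ W ∧ (Q (f i)).y + (Q (f i)).h ≤ T) ∧
      ∀ s, AFit (S.filter (fun i => f i = s)) w h (Q s) := by
  set X : Finset ℕ := {0, W} ∪ (MB.image (fun s => (R s).x) ∪ MB.image (fun s => (R s).x + (R s).w)) with hX
  set Y : Finset ℕ := {0, T} ∪ (MB.image (fun s => (R s).y) ∪ MB.image (fun s => (R s).y + (R s).h)) with hY
  have hX0 : 0 ∈ X := by simp [hX]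
  have hXW : W ∈ X := by simp [hX]
  have hY0 : 0 ∈ Y := by simp [hY]
  have hYT : T ∈ Y := by simp [hY]
  have hXa : ∀ s ∈ MB, (R s).x ∈ X ∧ (R s).x + (R s).w ∈ X := by
    intro s hs
    constructor <;> simp only [hX, Finset.mem_union, Finset.mem_image]
    · right; left; exact ⟨s, hs, rfl⟩
    · right; right; exact ⟨s, hs, rfl⟩
  have hYa : ∀ s ∈ MB, (R s).y ∈ Y ∧ (R s).y + (R s).h ∈ Y := by
    intro s hs
    constructor <;> simp only [hY, Finset.mem_union, Finset.mem_image]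
    · right; left; exact ⟨s, hs, rfl⟩
    · right; right; exact ⟨s, hs, rfl⟩
  have hXc : X.card ≤ 2 * MB.card + 2 := by
    have h1 := Finset.card_union_le ({0, W} : Finset ℕ) (MB.image (fun s => (R s).x) ∪ MB.image (fun s => (R s).x + (R s).w))
    have h2 := Finset.card_union_le (MB.image (fun s => (R s).x)) (MB.image (fun s => (R s).x + (R s).w))
    have h3 := Finset.card_image_le (s := MB) (f := fun s => (R s).x)
    have h4 := Finset.card_image_le (s := MB) (f := fun s => (R s).x + (R s).w)
    have h5 := Finset.card_le_two (a := 0) (b := W)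
    rw [← hX] at h1
    omega
  have hYc : Y.card ≤ 2 * MB.card + 2 := by
    have h1 := Finset.card_union_le ({0, T} : Finset ℕ) (MB.image (fun s => (R s).y) ∪ MB.image (fun s => (R s).y + (R s).h))
    have h2 := Finset.card_union_le (MB.image (fun s => (R s).y)) (MB.image (fun s => (R s).y + (R s).h))
    have h3 := Finset.card_image_le (s := MB) (f := fun s => (R s).y)
    have h4 := Finset.card_image_le (s := MB) (f := fun s => (R s).y + (R s).h)
    have h5 := Finset.card_le_two (a := 0) (b := T)
    rw [← hY] at h1
    omega
  let Q : ℕ × ℕ → Rec := fun c => ⟨c.1, c.2, hi X c.1 - c.1, hi Y c.2 - c.2⟩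
  let P : Finset (ℕ × ℕ) := (X.filter (· < W)) ×ˢ (Y.filter (· < T))
  let F : Finset (ℕ × ℕ) := P.filter (fun c => ∀ s ∈ MB, ¬ (R s).mem c.1 c.2)
  have hP : ∀ c ∈ P, c.1 ∈ X ∧ c.1 < W ∧ c.2 ∈ Y ∧ c.2 < T := by
    intro c hc
    simp only [P, Finset.mem_product, Finset.mem_filter] at hc
    tauto
  have hQ : ∀ c ∈ P, c.1 < hi X c.1 ∧ hi X c.1 ≤ W ∧ c.2 < hi Y c.2 ∧ hi Y c.2 ≤ T := by
    intro c hc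
    obtain ⟨h1, h2, h3, h4⟩ := hP c hc
    exact ⟨(hi_spec hXW h2).2, hi_le hXW h2, (hi_spec hYT h4).2, hi_le hYT h4⟩
  have hFP : ∀ c ∈ F, c ∈ P := fun c hc => (Finset.mem_filter.1 hc).1
  -- points of a cell
  have hcell : ∀ c ∈ P, ∀ i j, (Q c).mem i j → lo X i = c.1 ∧ lo Y j = c.2 := by
    intro c hc i j hm
    obtain ⟨h1, h2, h3, h4⟩ := hP c hc
    have hq := hQ c hc
    simp only [Rec.mem, Q] at hm
    exact ⟨(slab_eq hXW h2 h1 hm.1 (by omega)).1, (slab_eq hYT h4 h3 (by omega) (by omega)).1⟩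
  have hcov : ∀ s ∈ MB, ∀ i j, i < W → j < T → ((R s).mem i j ↔ (R s).mem (lo X i) (lo Y j)) := by
    intro s hs i j hiW hjT
    have a := hXa s hs
    have b := hYa s hs
    have e1 := lo_le X i
    have e2 := lo_le Y j
    have f1 := lo_hi hX0 hXW hiW
    have f2 := lo_hi hY0 hYT hjT
    constructor
    · intro hm
      have g1 := le_lo a.1 hm.1
      have g2 := le_lo b.1 hm.2.2.1
      have := hm.2.1
      have := hm.2.2.2
      unfold Rec.mem
      omega
    · intro hm
      have g1 : hi X (lo X i) ≤ _ := hi_le a.2 hm.2.1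
      have g2 : hi Y (lo Y j) ≤ _ := hi_le b.2 hm.2.2.2
      have := hm.1
      have := hm.2.2.1
      unfold Rec.mem
      omega
  -- area
  have harea : W * T ≤ ∑ c ∈ F, (Q c).w * (Q c).h + ∑ s ∈ MB, (R s).w * (R s).h := by
    have hsub : (Finset.range W ×ˢ Finset.range T) ⊆
        (F.biUnion fun c => (Q c).pts) ∪ (MB.biUnion fun s => (R s).pts) := by
      intro p hp
      simp only [Finset.mem_product, Finset.mem_range] at hp
      have e1 := lo_le X p.1
      have e2 := lo_le Y p.2
      have f1 := lo_hi hX0 hXW hp.1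
      have f2 := lo_hi hY0 hYT hp.2
      simp only [Finset.mem_union, Finset.mem_biUnion, Rec.mem_pts]
      by_cases hc : ∃ s ∈ MB, (R s).mem p.1 p.2
      · exact Or.inr hc
      · left
        push Not at hc
        refine ⟨(lo X p.1, lo Y p.2), ?_, ?_⟩
        · simp only [F, P, Finset.mem_filter, Finset.mem_product]
          refine ⟨⟨⟨lo_mem hX0 _, by omega⟩, lo_mem hY0 _, by omega⟩, ?_⟩
          intro s hs hm
          exact hc s hs ((hcov s hs _ _ hp.1 hp.2).2 hm)
        · simp only [Rec.mem, Q]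
          omega
    have h1 := Finset.card_le_card hsub
    rw [Finset.card_product, Finset.card_range, Finset.card_range] at h1
    have h2 := Finset.card_union_le (F.biUnion fun c => (Q c).pts) (MB.biUnion fun s => (R s).pts)
    have h3 := Finset.card_biUnion_le (s := F) (t := fun c => (Q c).pts)
    have h4 := Finset.card_biUnion_le (s := MB) (t := fun s => (R s).pts)
    simp only [Rec.card_pts] at h3 h4
    omega
  have hFc : F.card ≤ M := by
    refine le_trans ?_ hM
    calc F.card ≤ P.card := Finset.card_filter_le _ _
      _ = (X.filter (· < W)).card * (Y.filter (· < T)).card := Finset.card_product _ _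
      _ ≤ X.card * Y.card := Nat.mul_le_mul (Finset.card_filter_le _ _) (Finset.card_filter_le _ _)
      _ ≤ _ := Nat.mul_le_mul hXc hYc
  have hcap : ∑ c ∈ F, (Q c).w * (Q c).h ≤ ∑ c ∈ F, ((Q c).w - ω) * ((Q c).h - η) + F.card * (ω * T + η * W) := by
    rw [← smul_eq_mul, ← Finset.sum_const, ← Finset.sum_add_distrib]
    apply Finset.sum_le_sum
    intro c hc
    have hq := hQ c (hFP c hc)
    have h1 : (Q c).h ≤ T := by simp only [Q]; omega
    have h2 : (Q c).w ≤ W := by simp only [Q]; omega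
    have h3 := sub_mul_sub_ge (Q c).w (Q c).h ω η
    have h4 := Nat.mul_le_mul_left ω h1
    have h5 := Nat.mul_le_mul_left η h2
    omega
  obtain ⟨f, hf1, hf2⟩ := fill_all S F (fun i => w i * h i) (fun c => ((Q c).w - ω) * ((Q c).h - η)) (ω * η)
    (fun i hi => Nat.mul_le_mul (hS i hi).1 (hS i hi).2.1) (fun i hi => (hS i hi).2.2) (by
      have := Nat.mul_le_mul_right (ω * T + η * W) hFc
      have := Nat.mul_le_mul_right (ω * η) hFc
      rw [Nat.mul_add M] at hsum
      omega)
  refine ⟨f, Q, ?_, ?_, ?_, ?_⟩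
  · intro i hi s hs a b h1 h2
    have hF := hf1 i hi
    have hP' := hFP _ hF
    have hl := hcell _ hP' a b h1
    have hr := hR s hs
    have e1 := h2.2.1
    have e2 := h2.2.2.2
    have := (hcov s hs a b (by omega) (by omega)).1 h2
    rw [hl.1, hl.2] at this
    exact (Finset.mem_filter.1 hF).2 s hs this
  · intro i hi j hj hij a b h1 h2
    have l1 := hcell _ (hFP _ (hf1 i hi)) a b h1
    have l2 := hcell _ (hFP _ (hf1 j hj)) a b h2
    exact hij (Prod.ext (l1.1.symm.trans l2.1) (l1.2.symm.trans l2.2))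
  · intro i hi
    have hq := hQ _ (hFP _ (hf1 i hi))
    simp only [Q]
    omega
  · intro s
    by_cases hs : s ∈ F
    · refine ⟨ω, η, fun i hi => hS i (Finset.mem_filter.1 hi).1, ?_⟩
      convert hf2 s hs
    · have : S.filter (fun i => f i = s) = ∅ := by
        apply Finset.filter_eq_empty_iff.2
        intro i hi he
        exact hs (he ▸ hf1 i hi)
      rw [this]
      exact AFit.of_empty _ _ _



theorem key_exists {ι : Type*} (Th : Finset ι) (w : ι → ℕ) :
    ∃ key : ι → ℕ, (∀ i ∈ Th, ∀ j ∈ Th, key i = key j → i = j) ∧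
      ∀ i ∈ Th, ∀ j ∈ Th, key j < key i → w i ≤ w j := by
  let idx : ι → ℕ := fun i => if h : i ∈ Th then (Th.equivFin ⟨i, h⟩).val else 0
  have hidx : ∀ i ∈ Th, idx i < Th.card := by
    intro i hi
    simp only [idx, hi, dif_pos]
    exact (Th.equivFin ⟨i, hi⟩).isLt
  have hM : ∀ i ∈ Th, w i ≤ Th.sup w := fun i hi => Finset.le_sup hi
  have hlt : ∀ i ∈ Th, ∀ j ∈ Th, (Th.sup w - w i) * Th.card + idx i ≤ (Th.sup w - w j) * Th.card + idx j →
      Th.sup w - w i ≤ Th.sup w - w j := by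
    intro i hi j hj h
    by_contra hc
    push Not at hc
    have := Nat.mul_le_mul_right Th.card (Nat.succ_le_of_lt hc)
    rw [Nat.succ_mul] at this
    have := hidx j hj
    omega
  refine ⟨fun i => (Th.sup w - w i) * Th.card + idx i, ?_, ?_⟩
  · intro i hi j hj h
    simp only at h
    have h1 := hlt i hi j hj (by omega)
    have h2 := hlt j hj i hi (by omega)
    have h3 : Th.sup w - w i = Th.sup w - w j := le_antisymm h1 h2
    rw [h3] at h
    have h4 : idx i = idx j := by omega
    simp only [idx, hi, hj, dif_pos] at h4
    have := Th.equivFin.injective (Fin.ext h4)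
    exact congrArg Subtype.val this
  · intro i hi j hj h
    simp only at h
    have h1 := hlt j hj i hi (by omega)
    have := hM i hi
    have := hM j hj
    omega

theorem grouping {ι : Type*} (Th : Finset ι) (w h : ι → ℕ) (τ η G : ℕ) (hτ : 0 < τ)
    (hη : ∀ i ∈ Th, h i ≤ η) (hG : ∑ i ∈ Th, h i < G * τ) :
    ∃ grp : ι → ℕ, (∀ i ∈ Th, grp i < G) ∧ (∀ i ∈ Th, ∀ j ∈ Th, grp j < grp i → w i ≤ w j) ∧
      (∑ i ∈ Th.filter (fun i => grp i = 0), h i ≤ τ + η) ∧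
      ∀ g, ∑ i ∈ Th.filter (fun i => grp i = g + 1), h i ≤ ∑ i ∈ Th.filter (fun i => grp i = g), h i + 2 * η := by
  obtain ⟨key, hinj, hkey⟩ := key_exists Th w
  let pos : ι → ℕ := fun i => ∑ j ∈ Th.filter (fun j => key j < key i), h j
  let C : ℕ → ℕ := fun t => ∑ j ∈ Th.filter (fun j => pos j < t), h j
  have hpos : ∀ i ∈ Th, ∀ j ∈ Th, pos j < pos i → key j < key i := by
    intro i _ j _ hlt
    by_contra hc
    push Not at hc
    have : pos i ≤ pos j := by
      apply Finset.sum_le_sum_of_subset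
      intro k hk
      simp only [Finset.mem_filter] at hk ⊢
      exact ⟨hk.1, by omega⟩
    omega
  have CU : ∀ t, C t ≤ t + η := by
    intro t
    rcases (Th.filter (fun j => pos j < t)).eq_empty_or_nonempty with he | hne
    · simp only [C, he, Finset.sum_empty]; omega
    obtain ⟨i, hi, hmax⟩ := Finset.exists_max_image _ key hne
    have hi' := Finset.mem_filter.1 hi
    have hsub : Th.filter (fun j => pos j < t) ⊆ insert i (Th.filter (fun j => key j < key i)) := by
      intro j hj
      by_cases hji : j = i
      · simp [hji]
      · have hj' := Finset.mem_filter.1 hj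
        refine Finset.mem_insert_of_mem (Finset.mem_filter.2 ⟨hj'.1, ?_⟩)
        exact lt_of_le_of_ne (hmax j hj) (fun he => hji (hinj j hj'.1 i hi'.1 he))
    have h1 : C t ≤ ∑ j ∈ insert i (Th.filter (fun j => key j < key i)), h j :=
      Finset.sum_le_sum_of_subset hsub
    rw [Finset.sum_insert (by simp)] at h1
    have h2 := hη i hi'.1
    have h3 : ∑ j ∈ Th.filter (fun j => key j < key i), h j < t := hi'.2
    omega
  have CL : ∀ t, (∃ i ∈ Th, t ≤ pos i) → t ≤ C t := by
    rintro t ⟨i0, hi0, hp0⟩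
    obtain ⟨i, hi, hmin⟩ := Finset.exists_min_image (Th.filter (fun j => t ≤ pos j)) key ⟨i0, by simp [hi0, hp0]⟩
    have hi' := Finset.mem_filter.1 hi
    refine hi'.2.trans ?_
    apply Finset.sum_le_sum_of_subset
    intro j hj
    have hj' := Finset.mem_filter.1 hj
    refine Finset.mem_filter.2 ⟨hj'.1, ?_⟩
    by_contra hc
    push Not at hc
    have := hmin j (Finset.mem_filter.2 ⟨hj'.1, hc⟩)
    omega
  have hC : ∀ g, C (g * τ) + ∑ i ∈ Th.filter (fun i => pos i / τ = g), h i = C ((g + 1) * τ) := by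
    intro g
    simp only [C]
    rw [← Finset.sum_union]
    · congr 1
      ext i
      simp only [Finset.mem_union, Finset.mem_filter, ← and_or_left]
      have e1 : pos i < g * τ ↔ pos i / τ < g := (Nat.div_lt_iff_lt_mul hτ).symm
      have e2 : pos i < (g + 1) * τ ↔ pos i / τ < g + 1 := (Nat.div_lt_iff_lt_mul hτ).symm
      rw [e1, e2]
      have : pos i / τ < g ∨ pos i / τ = g ↔ pos i / τ < g + 1 := by omega
      rw [this]
    · apply Finset.disjoint_filter.2
      intro i _ h1 h2
      have := (Nat.div_lt_iff_lt_mul hτ).2 h1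
      omega
  refine ⟨fun i => pos i / τ, ?_, ?_, ?_, ?_⟩
  · intro i hi
    refine (Nat.div_lt_iff_lt_mul hτ).2 (lt_of_le_of_lt ?_ hG)
    exact Finset.sum_le_sum_of_subset (Finset.filter_subset _ _)
  · intro i hi j hj hlt
    apply hkey i hi j hj
    apply hpos i hi j hj
    by_contra hc
    push Not at hc
    have := Nat.div_le_div_right (c := τ) hc
    simp only at hlt
    omega
  · have h1 := hC 0
    have h2 := CU ((0 + 1) * τ)
    simp only [zero_add, one_mul] at h1 h2
    beta_reduce
    omega
  · intro g
    by_cases hne : ∃ i ∈ Th, pos i / τ = g + 1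
    · obtain ⟨i, hi, hg⟩ := hne
      have hp : (g + 1) * τ ≤ pos i := by
        have := Nat.div_mul_le_self (pos i) τ
        rwa [hg] at this
      have h1 := CL _ ⟨i, hi, hp⟩
      have h2 := hC g
      have h3 := hC (g + 1)
      have h4 := CU (g * τ)
      have h5 := CU ((g + 1 + 1) * τ)
      simp only [Nat.add_mul, one_mul] at h1 h2 h3 h4 h5 ⊢
      omega
    · push Not at hne
      have : Th.filter (fun i => pos i / τ = g + 1) = ∅ := Finset.filter_eq_empty_iff.2 (fun i hi => hne i hi)
      simp only [this, Finset.sum_empty]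
      omega

theorem enc_exists (G l : ℕ) : ∃ (enc : (ℕ → ℕ) → ℕ) (dec : ℕ → ℕ → ℕ),
    (∀ f, enc f < (l + 1) ^ G) ∧ (∀ κ g, dec κ g ≤ l) ∧
    (∀ f, (∀ g < G, f g ≤ l) → ∀ g < G, dec (enc f) g = f g) := by
  let e : (Fin G → Fin (l + 1)) ≃ Fin ((l + 1) ^ G) := Fintype.equivFinOfCardEq (by simp)
  refine ⟨fun f => (e (fun g => ⟨min (f g) l, by omega⟩)).val,
    fun κ g => if hg : g < G ∧ κ < (l + 1) ^ G then (e.symm ⟨κ, hg.2⟩ ⟨g, hg.1⟩).val else 0, ?_, ?_, ?_⟩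
  · intro f
    exact (e (fun g => ⟨min (f g) l, by omega⟩)).isLt
  · intro κ g
    simp only
    split_ifs with h
    · have := (e.symm ⟨κ, h.2⟩ ⟨g, h.1⟩).isLt
      omega
    · omega
  · intro f hf g hg
    simp only [hg, true_and, Fin.is_lt, dif_pos, Fin.eta, Equiv.symm_apply_apply]
    have := hf g hg
    omega



/-- number of slots per horizontal box -/
def hN (l G : ℕ) : ℕ := (l + 1) ^ G * (G * l)

theorem sum_ind (y h H : ℕ) (hh : y + h ≤ H) :
    ∑ t ∈ Finset.Ico 0 H, (if y ≤ t ∧ t < y + h then 1 else 0) = h := by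
  rw [← Finset.sum_filter, Finset.sum_const, smul_eq_mul, mul_one]
  have : (Finset.Ico 0 H).filter (fun t => y ≤ t ∧ t < y + h) = Finset.Ico y (y + h) := by
    ext t; simp only [Finset.mem_filter, Finset.mem_Ico]; omega
  rw [this]; simp

theorem sum_if_lt (l d c : ℕ) (hd : d ≤ l) : ∑ j ∈ Finset.range l, (if j < d then c else 0) = d * c := by
  rw [← Finset.sum_filter, Finset.sum_const, smul_eq_mul]
  have : (Finset.range l).filter (fun j => j < d) = Finset.range d := by
    ext t; simp only [Finset.mem_filter, Finset.mem_range]; omega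
  rw [this]; simp

theorem hpart {ι S : Type} [Nonempty S] (Th : Finset ι) (HB : Finset S) (box : ι → S) (wd : S → ℕ)
    (W H l τ η G : ℕ) (x y w h : ι → ℕ) (hτ : 0 < τ) (hG : ∑ i ∈ Th, h i < G * τ)
    (hin : ∀ i ∈ Th, box i ∈ HB ∧ x i + w i ≤ wd (box i) ∧ y i + h i ≤ H ∧ 0 < h i ∧ h i ≤ η ∧ W < w i * l)
    (hwd : ∀ s ∈ HB, wd s ≤ W)
    (hdj : ∀ i ∈ Th, ∀ j ∈ Th, i ≠ j → box i = box j → ISep x w i j ∨ ISep y h i j) :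
    ∃ (Lost : Finset ι) (a : ι → S × ℕ × ℕ × ℕ) (R : S × ℕ × ℕ × ℕ → Rec),
      Lost ⊆ Th ∧ ∑ i ∈ Lost, h i ≤ τ + η * (1 + 2 * G + HB.card * hN l G) ∧
      (∀ i ∈ Th \ Lost, (a i).1 ∈ HB ∧ (R (a i)).x + (R (a i)).w ≤ wd (a i).1 ∧
        (R (a i)).y + (R (a i)).h ≤ H ∧ w i ≤ (R (a i)).w) ∧
      (∀ σ, ∑ i ∈ (Th \ Lost).filter (fun i => a i = σ), h i ≤ (R σ).h) ∧
      (∀ i ∈ Th \ Lost, ∀ j ∈ Th \ Lost, a i ≠ a j → (a i).1 = (a j).1 → (R (a i)).Dj (R (a j))) ∧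
      ((Th \ Lost).image a).card ≤ HB.card * hN l G ∧
      ∑ σ ∈ (Th \ Lost).image a, (R σ).w * (R σ).h ≤ ∑ i ∈ Th, w i * h i := by
  obtain ⟨grp, hg1, hg2, hg3, hg4⟩ := grouping Th w h τ η G hτ (fun i hi => (hin i hi).2.2.2.2.1) hG
  obtain ⟨enc, dec, he1, he2, he3⟩ := enc_exists G l
  let N := (l + 1) ^ G
  let om : ℕ → ℕ := fun g => (Th.filter (fun i => g < grp i)).sup w
  have hom1 : ∀ i ∈ Th, ∀ g, g < grp i → w i ≤ om g := fun i hi g hg =>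
    Finset.le_sup (Finset.mem_filter.2 ⟨hi, hg⟩)
  have hom2 : ∀ i ∈ Th, om (grp i) ≤ w i := fun i hi =>
    Finset.sup_le (fun j hj => hg2 j (Finset.mem_filter.1 hj).1 i hi (Finset.mem_filter.1 hj).2)
  let Ln : S → ℕ → Finset ι := fun s t => Th.filter (fun i => box i = s ∧ y i ≤ t ∧ t < y i + h i)
  let cnt : S → ℕ → ℕ → ℕ := fun s t g => ((Ln s t).filter (fun i => grp i = g)).card
  have hLw : ∀ s t, ∑ i ∈ Ln s t, w i ≤ wd s := by
    intro s t
    have := sum_intervals (Ln s t) x w 0 (wd s) (by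
      intro i hi
      have hi' := Finset.mem_filter.1 hi
      have := (hin i hi'.1).2.1
      rw [hi'.2.1] at this
      omega) (by
      intro i hi j hj hij
      have hi' := Finset.mem_filter.1 hi
      have hj' := Finset.mem_filter.1 hj
      have := hdj i hi'.1 j hj'.1 hij (hi'.2.1.trans hj'.2.1.symm)
      unfold ISep at this
      omega)
    omega
  have hLc : ∀ s t, (Ln s t).card ≤ l := by
    intro s t
    rcases (Ln s t).eq_empty_or_nonempty with he | ⟨i0, hi0⟩
    · rw [he]; simp
    have hi0' := Finset.mem_filter.1 hi0
    have hs : wd s ≤ W := by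
      have := hwd _ (hin i0 hi0'.1).1
      rwa [hi0'.2.1] at this
    have h1 : (Ln s t).card * (W + 1) ≤ ∑ i ∈ Ln s t, w i * l := by
      rw [← smul_eq_mul, ← Finset.sum_const]
      apply Finset.sum_le_sum
      intro i hi
      exact (hin i (Finset.mem_filter.1 hi).1).2.2.2.2.2
    rw [← Finset.sum_mul] at h1
    have h2 : (∑ i ∈ Ln s t, w i) * l ≤ (W + 1) * l := Nat.mul_le_mul_right _ ((hLw s t).trans (by omega))
    have h3 : (W + 1) * (Ln s t).card ≤ (W + 1) * l := by
      rw [Nat.mul_comm (W+1) (Ln s t).card]; omega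
    exact Nat.le_of_mul_le_mul_left h3 (by omega)
  have hcl : ∀ s t g, cnt s t g ≤ l := fun s t g => (Finset.card_filter_le _ _).trans (hLc s t)
  let key : S → ℕ → ℕ := fun s t => enc (cnt s t)
  have hdec : ∀ s t, ∀ g < G, dec (key s t) g = cnt s t g := fun s t g hg =>
    he3 (cnt s t) (fun g _ => hcl s t g) g hg
  have hcnt : ∀ s t, ∑ g ∈ Finset.range G, cnt s t g * om g ≤ wd s := by
    intro s t
    refine le_trans ?_ (hLw s t)
    rw [← Finset.sum_fiberwise_of_maps_to (s := Ln s t) (t := Finset.range G) (g := grp)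
      (fun i hi => Finset.mem_range.2 (hg1 i (Finset.mem_filter.1 hi).1))]
    apply Finset.sum_le_sum
    intro g _
    rw [← smul_eq_mul, ← Finset.sum_const]
    apply Finset.sum_le_sum
    intro i hi
    have hi' := Finset.mem_filter.1 hi
    have := hom2 i (Finset.mem_filter.1 hi'.1).1
    rwa [hi'.2] at this
  let off : ℕ → ℕ → ℕ → ℕ := fun κ g j => ∑ g' ∈ Finset.range g, dec κ g' * om g' + j * om g
  have hoff : ∀ κ g j, j < dec κ g → off κ g j + om g ≤ ∑ g' ∈ Finset.range (g + 1), dec κ g' * om g' := by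
    intro κ g j hj
    rw [Finset.sum_range_succ]
    have := Nat.mul_le_mul_right (om g) (Nat.succ_le_of_lt hj)
    rw [Nat.succ_mul] at this
    simp only [off]
    omega
  let cap : S × ℕ × ℕ × ℕ → ℕ := fun σ => if σ.2.2.2 < dec σ.2.1 σ.2.2.1 then ctt 0 H (key σ.1) σ.2.1 else 0
  let R : S × ℕ × ℕ × ℕ → Rec := fun σ =>
    ⟨off σ.2.1 σ.2.2.1 σ.2.2.2, stt 0 H (key σ.1) σ.2.1, om σ.2.2.1, cap σ⟩
  have hpre : ∀ κ g g', g ≤ g' → ∑ k ∈ Finset.range g, dec κ k * om k ≤ ∑ k ∈ Finset.range g', dec κ k * om k :=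
    fun κ g g' hgg => Finset.sum_le_sum_of_subset (Finset.range_subset_range.2 hgg)
  -- inside
  have hRin : ∀ σ : S × ℕ × ℕ × ℕ, σ.2.2.1 < G → 0 < cap σ → (R σ).x + (R σ).w ≤ wd σ.1 ∧ (R σ).y + (R σ).h ≤ H := by
    intro σ hg hc
    have hj : σ.2.2.2 < dec σ.2.1 σ.2.2.1 := by
      by_contra hc'
      simp [cap, hc'] at hc
    have hcc : cap σ = ctt 0 H (key σ.1) σ.2.1 := by simp [cap, hj]
    constructor
    · obtain ⟨t, _, _, ht⟩ := ctt_pos (p := 0) (q := H) (key := key σ.1) (c := σ.2.1) le_rfl (by omega)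
      have h1 := hoff _ _ _ hj
      have h2 := hpre σ.2.1 _ _ (Nat.succ_le_of_lt hg)
      have h3 : ∑ k ∈ Finset.range G, dec σ.2.1 k * om k ≤ wd σ.1 := by
        refine le_trans (le_of_eq ?_) (hcnt σ.1 t)
        apply Finset.sum_congr rfl
        intro k hk
        rw [← ht, hdec _ _ _ (Finset.mem_range.1 hk)]
      exact (h1.trans h2).trans h3
    · have := stt_succ 0 H (key σ.1) σ.2.1
      have h2 := stt_le (Nat.zero_le H) (key σ.1) (σ.2.1 + 1)
      simp only [R, hcc]
      omega
  -- disjoint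
  have hRdj : ∀ σ ρ : S × ℕ × ℕ × ℕ, σ ≠ ρ → σ.1 = ρ.1 → (R σ).Dj (R ρ) := by
    rintro ⟨s, κ, g, j⟩ ⟨s', κ', g', j'⟩ hne hs c d h1 h2
    simp only at hs
    subst hs
    simp only [R, Rec.mem, cap] at h1 h2
    have hj : j < dec κ g := by
      by_contra hc
      simp only [hc, if_false] at h1
      omega
    have hj' : j' < dec κ' g' := by
      by_contra hc
      simp only [hc, if_false] at h2
      omega
    simp only [hj, hj', if_true] at h1 h2
    have hκ := stt_dj 0 H (key s) h1.2.2.1 h1.2.2.2 h2.2.2.1 h2.2.2.2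
    subst hκ
    have o1 := hoff κ g j hj
    have o2 := hoff κ g' j' hj'
    rcases lt_trichotomy g g' with hgg | hgg | hgg
    · have := hpre κ _ _ (Nat.succ_le_of_lt hgg)
      have e : off κ g' j' = ∑ k ∈ Finset.range g', dec κ k * om k + j' * om g' := rfl
      simp only [Nat.succ_eq_add_one] at this
      omega
    · subst hgg
      have hjj : j ≠ j' := fun h => hne (by rw [h])
      have e : off κ g j = ∑ k ∈ Finset.range g, dec κ k * om k + j * om g := rfl
      have e' : off κ g j' = ∑ k ∈ Finset.range g, dec κ k * om k + j' * om g := rfl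
      rcases lt_or_gt_of_ne hjj with hlt | hlt
      · have := Nat.mul_le_mul_right (om g) (Nat.succ_le_of_lt hlt)
        rw [Nat.succ_mul] at this
        omega
      · have := Nat.mul_le_mul_right (om g) (Nat.succ_le_of_lt hlt)
        rw [Nat.succ_mul] at this
        omega
    · have := hpre κ _ _ (Nat.succ_le_of_lt hgg)
      have e : off κ g j = ∑ k ∈ Finset.range g, dec κ k * om k + j * om g := rfl
      simp only [Nat.succ_eq_add_one] at this
      omega
  let B : ℕ → Finset (S × ℕ × ℕ × ℕ) := fun g => HB ×ˢ (Finset.range N ×ˢ ({g} ×ˢ Finset.range l))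
  have hBc : ∀ g, (B g).card = HB.card * (N * l) := by
    intro g; simp [B, Finset.card_product]
  -- total capacity of class g
  have hcapsum : ∀ g < G, ∑ σ ∈ B g, cap σ = ∑ i ∈ Th.filter (fun i => grp i = g), h i := by
    intro g hg
    rw [Finset.sum_product]
    rw [← Finset.sum_fiberwise_of_maps_to (s := Th.filter (fun i => grp i = g)) (t := HB) (g := box)
      (fun i hi => (hin i (Finset.mem_filter.1 hi).1).1)]
    apply Finset.sum_congr rfl
    intro s hs
    rw [Finset.sum_product]
    simp only [Finset.sum_product, Finset.sum_singleton, cap]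
    rw [Finset.sum_congr rfl (g := fun κ => dec κ g * ctt 0 H (key s) κ)
      (fun κ _ => sum_if_lt l (dec κ g) _ (he2 κ g))]
    rw [CoreIn.sum_by_key 0 H (key s) N (fun t => he1 _) (fun κ => dec κ g)]
    rw [Finset.sum_congr rfl (g := fun t => cnt s t g) (fun t _ => hdec s t g hg)]
    have e : ∀ t, cnt s t g = ∑ i ∈ (Th.filter (fun i => grp i = g)).filter (fun i => box i = s),
        (if y i ≤ t ∧ t < y i + h i then 1 else 0) := by
      intro t
      rw [← Finset.sum_filter, Finset.sum_const, smul_eq_mul, mul_one]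
      simp only [cnt, Ln, Finset.filter_filter]
      congr 1
      ext i
      simp only [Finset.mem_filter]
      tauto
    rw [Finset.sum_congr rfl (fun t _ => e t), Finset.sum_comm]
    apply Finset.sum_congr rfl
    intro i hi
    exact sum_ind _ _ _ (hin i (Finset.mem_filter.1 (Finset.mem_filter.1 hi).1).1).2.2.1
  -- fill
  choose A' f hf1 hf2 hf3 hf4 using fun g => fill_lemma (Th.filter (fun i => grp i = g + 1)) (B g) h cap η
    (fun i hi => by have := (hin i (Finset.mem_filter.1 hi).1).2.2.2.2.1; omega)
  let Kept : Finset ι := Th.filter (fun i => 0 < grp i ∧ i ∈ A' (grp i - 1))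
  let a : ι → S × ℕ × ℕ × ℕ := fun i => f (grp i - 1) i
  have hKT : Th \ (Th \ Kept) = Kept := by
    rw [Finset.sdiff_sdiff_eq_self (Finset.filter_subset _ _)]
  have hK : ∀ i ∈ Kept, i ∈ Th ∧ 0 < grp i ∧ i ∈ A' (grp i - 1) := fun i hi => by
    have := Finset.mem_filter.1 hi
    tauto
  have haB : ∀ i ∈ Kept, a i ∈ B (grp i - 1) := fun i hi => hf2 _ i (hK i hi).2.2
  have ha : ∀ i ∈ Kept, (a i).1 ∈ HB ∧ (a i).2.1 < N ∧ (a i).2.2.1 = grp i - 1 ∧ (a i).2.2.2 < l := by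
    intro i hi
    have := haB i hi
    simp only [B, Finset.mem_product, Finset.mem_range, Finset.mem_singleton] at this
    tauto
  have hfit : ∀ σ, ∑ i ∈ Kept.filter (fun i => a i = σ), h i ≤ (R σ).h := by
    intro σ
    rcases (Kept.filter (fun i => a i = σ)).eq_empty_or_nonempty with he | ⟨i0, hi0⟩
    · rw [he]; simp
    have hi0' := Finset.mem_filter.1 hi0
    have hσ := haB i0 hi0'.1
    rw [hi0'.2] at hσ
    have hf3' : ∑ i ∈ (A' (grp i0 - 1)).filter (fun i => f (grp i0 - 1) i = σ), h i ≤ cap σ := by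
      convert hf3 (grp i0 - 1) σ hσ
    refine le_trans ?_ hf3'
    apply Finset.sum_le_sum_of_subset
    intro i hi
    have hi' := Finset.mem_filter.1 hi
    have e : grp i - 1 = grp i0 - 1 := by
      rw [← (ha i hi'.1).2.2.1, ← (ha i0 hi0'.1).2.2.1, hi'.2, hi0'.2]
    refine Finset.mem_filter.2 ⟨?_, ?_⟩
    · rw [← e]; exact (hK i hi'.1).2.2
    · rw [← e]; exact hi'.2
  have hcappos : ∀ i ∈ Kept, 0 < cap (a i) := by
    intro i hi
    have h1 := hfit (a i)
    have h2 : h i ≤ ∑ i' ∈ Kept.filter (fun i' => a i' = a i), h i' :=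
      Finset.single_le_sum (f := h) (fun _ _ => Nat.zero_le _) (Finset.mem_filter.2 ⟨hi, rfl⟩)
    have h3 := (hin i (hK i hi).1).2.2.2.1
    simp only [R] at h1
    omega
  have hgG : ∀ i ∈ Kept, (a i).2.2.1 < G := by
    intro i hi
    rw [(ha i hi).2.2.1]
    have := hg1 i (hK i hi).1
    omega
  let SL : Finset (S × ℕ × ℕ × ℕ) := HB ×ˢ (Finset.range N ×ˢ (Finset.range G ×ˢ Finset.range l))
  have hSL : Kept.image a ⊆ SL := by
    intro σ hσ
    obtain ⟨i, hi, rfl⟩ := Finset.mem_image.1 hσ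
    have h1 := ha i hi
    have h2 := hgG i hi
    simp only [SL, Finset.mem_product, Finset.mem_range]
    tauto
  refine ⟨Th \ Kept, a, R, Finset.sdiff_subset, ?_, ?_, ?_, ?_, ?_, ?_⟩
  · -- lost
    have hsub : Th \ Kept ⊆ (Th.filter (fun i => grp i = 0)) ∪
        (Finset.range G).biUnion (fun g => (Th.filter (fun i => grp i = g + 1)) \ A' g) := by
      intro i hi
      rw [Finset.mem_sdiff] at hi
      rw [Finset.mem_union, Finset.mem_biUnion]
      by_cases h0 : grp i = 0
      · left; exact Finset.mem_filter.2 ⟨hi.1, h0⟩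
      · right
        have hG' := hg1 i hi.1
        refine ⟨grp i - 1, Finset.mem_range.2 (by omega), Finset.mem_sdiff.2 ⟨Finset.mem_filter.2 ⟨hi.1, by omega⟩, ?_⟩⟩
        intro hA
        exact hi.2 (Finset.mem_filter.2 ⟨hi.1, by omega, hA⟩)
    have h1 : ∑ i ∈ Th \ Kept, h i ≤ ∑ i ∈ Th.filter (fun i => grp i = 0), h i +
        ∑ i ∈ (Finset.range G).biUnion (fun g => (Th.filter (fun i => grp i = g + 1)) \ A' g), h i := by
      refine (Finset.sum_le_sum_of_subset hsub).trans ?_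
      rw [← Finset.sum_union_inter]
      omega
    have h2 : ∑ i ∈ (Finset.range G).biUnion (fun g => (Th.filter (fun i => grp i = g + 1)) \ A' g), h i
        ≤ ∑ g ∈ Finset.range G, (2 * η + HB.card * (N * l) * η) := by
      rw [Finset.sum_biUnion]
      · apply Finset.sum_le_sum
        intro g hg
        have e1 := Finset.sum_sdiff (hf1 g) (f := h)
        have e2 := hcapsum g (Finset.mem_range.1 hg)
        have e3 := hg4 g
        rcases hf4 g with e4 | e4
        · rw [e4]; simp
        · rw [hBc] at e4
          omega
      · intro g _ g' _ hgg
        simp only [Function.onFun]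
        rw [Finset.disjoint_left]
        intro i hi hi'
        have e1 := (Finset.mem_filter.1 (Finset.mem_sdiff.1 hi).1).2
        have e2 := (Finset.mem_filter.1 (Finset.mem_sdiff.1 hi').1).2
        omega
    rw [Finset.sum_const, Finset.card_range, smul_eq_mul] at h2
    have e : η * (1 + 2 * G + HB.card * hN l G) = η + G * (2 * η + HB.card * (N * l) * η) := by
      simp only [hN, N]; ring
    omega
  · rw [hKT]
    intro i hi
    obtain ⟨h1, h2⟩ := hRin (a i) (hgG i hi) (hcappos i hi)
    refine ⟨(ha i hi).1, h1, h2, ?_⟩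
    have := hom1 i (hK i hi).1 (a i).2.2.1 (by
      have := (ha i hi).2.2.1
      have := (hK i hi).2.1
      omega)
    exact this
  · rw [hKT]; exact hfit
  · intro i _ j _ hij hs
    exact hRdj _ _ hij hs
  · rw [hKT]
    refine (Finset.card_le_card hSL).trans (le_of_eq ?_)
    simp only [SL, Finset.card_product, Finset.card_range, hN, N]
  · rw [hKT]
    refine (Finset.sum_le_sum_of_subset hSL).trans ?_
    have e : SL = (Finset.range G).biUnion B := by
      ext σ
      simp only [SL, B, Finset.mem_biUnion, Finset.mem_product, Finset.mem_range, Finset.mem_singleton]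
      constructor
      · rintro ⟨h1, h2, h3, h4⟩
        exact ⟨_, h3, h1, h2, rfl, h4⟩
      · rintro ⟨g, h3, h1, h2, h5, h4⟩
        exact ⟨h1, h2, by omega, h4⟩
    rw [e, Finset.sum_biUnion]
    · rw [← Finset.sum_fiberwise_of_maps_to (s := Th) (t := Finset.range G) (g := grp)
        (fun i hi => Finset.mem_range.2 (hg1 i hi))]
      apply Finset.sum_le_sum
      intro g hg
      calc ∑ σ ∈ B g, (R σ).w * (R σ).h = ∑ σ ∈ B g, om g * cap σ := by
            apply Finset.sum_congr rfl
            intro σ hσ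
            simp only [B, Finset.mem_product, Finset.mem_singleton] at hσ
            simp only [R, hσ.2.2.1]
        _ = om g * ∑ i ∈ Th.filter (fun i => grp i = g), h i := by
            rw [← Finset.mul_sum, hcapsum g (Finset.mem_range.1 hg)]
        _ ≤ _ := by
            rw [Finset.mul_sum]
            apply Finset.sum_le_sum
            intro i hi
            have hi' := Finset.mem_filter.1 hi
            have := hom2 i hi'.1
            rw [hi'.2] at this
            exact Nat.mul_le_mul_right _ this
    · intro g _ g' _ hgg
      simp only [Function.onFun]
      rw [Finset.disjoint_left]
      intro σ hσ hσ'
      simp only [B, Finset.mem_product, Finset.mem_singleton] at hσ hσ'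
      omega



/-- total area of disjoint rectangles -/
theorem area_le {σ : Type*} (S : Finset σ) (R : σ → Rec) (W T : ℕ)
    (hin : ∀ s ∈ S, (R s).x + (R s).w ≤ W ∧ (R s).y + (R s).h ≤ T)
    (hdj : ∀ s ∈ S, ∀ t ∈ S, s ≠ t → (R s).Dj (R t)) : ∑ s ∈ S, (R s).w * (R s).h ≤ W * T := by
  have h1 : (S.biUnion (fun s => (R s).pts)).card = ∑ s ∈ S, (R s).w * (R s).h := by
    rw [Finset.card_biUnion]
    · exact Finset.sum_congr rfl (fun s _ => Rec.card_pts _)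
    · intro s hs t ht hst
      simp only [Function.onFun]
      rw [Finset.disjoint_left]
      intro p hp hp'
      rw [Rec.mem_pts] at hp hp'
      exact hdj s hs t ht hst _ _ hp hp'
  have h2 : (S.biUnion (fun s => (R s).pts)) ⊆ Finset.range W ×ˢ Finset.range T := by
    intro p hp
    obtain ⟨s, hs, hp⟩ := Finset.mem_biUnion.1 hp
    rw [Rec.mem_pts] at hp
    have := hin s hs
    unfold Rec.mem at hp
    simp only [Finset.mem_product, Finset.mem_range]
    omega
  have h3 := Finset.card_le_card h2
  rw [h1] at h3
  simpa using h3

/-- geometric data: a packing and parameters -/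
structure Geo (ι : Type) where
  x : ι → ℕ
  y : ι → ℕ
  w : ι → ℕ
  h : ι → ℕ
  W : ℕ
  H : ℕ
  A : ℕ
  q : ℕ
  p : ℕ
  l : ℕ
  l2 : ℕ
  e : ℕ
  hW : 0 < W
  hH : 0 < H
  hA : 1 ≤ A
  hp : 1 ≤ p
  hq : 2 * p ≤ 3 * q
  he : 1 ≤ e
  hin : ∀ i, x i + w i ≤ W ∧ y i + h i ≤ H ∧ 0 < w i ∧ 0 < h i
  hdj : ∀ i j, i ≠ j → ISep x w i j ∨ ISep y h i j

namespace Geo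

variable {ι : Type} (D : Geo ι)

/-- third of the number of rows -/
def m : ℕ := D.q * (8 * D.A + 1)
/-- scaling factor -/
def b : ℕ := 24 * D.A * D.q

theorem hm3 : 3 * D.m = D.b + 3 * D.q := by unfold m b; ring

theorem hqpos : 1 ≤ D.q := by have := D.hp; have := D.hq; omega

theorem hm2 : 2 ≤ D.m := by
  have h1 := D.hqpos
  have h2 := D.hA
  unfold m
  nlinarith

theorem hbpos : 1 ≤ D.b := by
  have h1 := D.hqpos
  have h2 := D.hA
  unfold b
  nlinarith

/-- ceiling rows -/
def r (i : ι) : ℕ := (3 * D.m * D.y i + (D.H - 1)) / D.H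
def k (i : ι) : ℕ := (D.b * D.h i + (D.H - 1)) / D.H

theorem ceil_spec (a H : ℕ) (hH : 0 < H) : a ≤ (a + (H - 1)) / H * H ∧ (a + (H - 1)) / H * H < a + H := by
  have h1 := Nat.div_add_mod (a + (H - 1)) H
  have h2 := Nat.mod_lt (a + (H - 1)) hH
  rw [Nat.mul_comm H] at h1
  omega

theorem r_spec (i : ι) : 3 * D.m * D.y i ≤ D.r i * D.H ∧ D.r i * D.H < 3 * D.m * D.y i + D.H :=
  ceil_spec _ _ D.hH
theorem k_spec (i : ι) : D.b * D.h i ≤ D.k i * D.H ∧ D.k i * D.H < D.b * D.h i + D.H :=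
  ceil_spec _ _ D.hH

/-- row items -/
def Row (i : ι) : Prop := D.H < D.p * D.h i

theorem rk_le {i : ι} (hi : D.Row i) : (D.r i + D.k i) * D.H ≤ 3 * D.m * (D.y i + D.h i) := by
  have h1 := D.r_spec i
  have h2 := D.k_spec i
  have h3 : D.b * D.h i + 3 * D.q * D.h i = 3 * D.m * D.h i := by rw [D.hm3]; ring
  have h4 := Nat.mul_le_mul_right (D.h i) D.hq
  unfold Row at hi
  have h5 : 2 * D.p * D.h i = 2 * (D.p * D.h i) := by ring
  rw [Nat.add_mul, Nat.mul_add]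
  omega

theorem k_pos (i : ι) : 0 < D.k i := by
  have h1 := (D.k_spec i).1
  have h2 := Nat.mul_pos D.hbpos (D.hin i).2.2.2
  by_contra hc
  have : D.k i = 0 := by omega
  rw [this] at h1
  omega

theorem rk_le3m {i : ι} (hi : D.Row i) : D.r i + D.k i ≤ 3 * D.m := by
  have h1 := D.rk_le hi
  have h2 := Nat.mul_le_mul_left (3 * D.m) (D.hin i).2.1
  exact Nat.le_of_mul_le_mul_right (h1.trans h2) D.hH

theorem row_row {i j : ι} (hi : D.Row i) (hij : D.y i + D.h i ≤ D.y j) :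
    D.r i + D.k i ≤ D.r j := by
  have h1 := D.rk_le hi
  have h2 := Nat.mul_le_mul_left (3 * D.m) hij
  have h3 := (D.r_spec j).1
  exact Nat.le_of_mul_le_mul_right ((h1.trans h2).trans h3) D.hH

/-- the row of a thin item -/
def rw (i : ι) : ℕ := 3 * D.m * D.y i / D.H

theorem rw_spec (i : ι) : D.rw i * D.H ≤ 3 * D.m * D.y i ∧ 3 * D.m * D.y i < (D.rw i + 1) * D.H := by
  have h1 := Nat.div_add_mod (3 * D.m * D.y i) D.H
  have h2 := Nat.mod_lt (3 * D.m * D.y i) D.hH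
  rw [Nat.mul_comm D.H] at h1
  unfold rw
  rw [Nat.add_mul]
  omega

theorem rw_lt (i : ι) : D.rw i < 3 * D.m := by
  have h1 := D.rw_spec i
  have h2 : D.y i + 1 ≤ D.H := by have := D.hin i; omega
  have h3 := Nat.mul_le_mul_left (3 * D.m) h2
  have h4 := D.hm2
  rw [Nat.mul_add] at h3
  exact Nat.lt_of_mul_lt_mul_right (a := D.H) (by omega)

/-- contained in its row -/
def Cont (i : ι) : Prop := 3 * D.m * D.y i + D.b * D.h i ≤ (D.rw i + 1) * D.H

theorem bh_le (i : ι) : D.b * D.h i ≤ 3 * D.m * D.h i := Nat.mul_le_mul_right _ (by have := D.hm3; omega)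

theorem bh_pos (i : ι) : 0 < D.b * D.h i := Nat.mul_pos D.hbpos (D.hin i).2.2.2

/-- stretched separation -/
theorem str_sep {i j : ι} (hij : D.y i + D.h i ≤ D.y j) : 3 * D.m * D.y i + D.b * D.h i ≤ 3 * D.m * D.y j := by
  have h2 := Nat.mul_le_mul_left (3 * D.m) hij
  have h3 := D.bh_le i
  rw [Nat.mul_add] at h2
  omega

/-- a contained item is horizontally separated from row items occupying its row -/
theorem cont_row {t i : ι} (_hc : D.Cont t) (hi : D.Row i) (hti : t ≠ i) (h1 : D.r i ≤ D.rw t)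
    (h2 : D.rw t < D.r i + D.k i) : ISep D.x D.w t i := by
  rcases D.hdj t i hti with h | h | h
  · exact h
  · exfalso
    have e1 := D.str_sep h
    have e2 := (D.r_spec i).1
    have e3 := Nat.mul_le_mul_right D.H h1
    have e4 := D.rw_spec t
    have e5 := D.bh_pos t
    omega
  · exfalso
    have e1 := D.rk_le hi
    have e2 := Nat.mul_le_mul_left (3 * D.m) h
    have e3 := Nat.mul_le_mul_right D.H (Nat.succ_le_of_lt h2)
    have e4 := D.rw_spec t
    simp only [Nat.succ_eq_add_one] at e3
    omega

variable [Fintype ι]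

noncomputable def Rows : Finset ι := Finset.univ.filter D.Row

/-- breakpoints of row `ρ` -/
noncomputable def X (ρ : ℕ) : Finset ℕ :=
  {0, D.W} ∪ ((D.Rows.filter (fun i => D.r i ≤ ρ ∧ ρ < D.r i + D.k i)).image D.x ∪
    (D.Rows.filter (fun i => D.r i ≤ ρ ∧ ρ < D.r i + D.k i)).image (fun i => D.x i + D.w i))

theorem X0 (ρ : ℕ) : 0 ∈ D.X ρ := by simp [X]
theorem XW (ρ : ℕ) : D.W ∈ D.X ρ := by simp [X]
theorem Xa {i : ι} {ρ : ℕ} (hi : D.Row i) (h1 : D.r i ≤ ρ) (h2 : ρ < D.r i + D.k i) :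
    D.x i ∈ D.X ρ ∧ D.x i + D.w i ∈ D.X ρ := by
  have hm : i ∈ D.Rows.filter (fun i => D.r i ≤ ρ ∧ ρ < D.r i + D.k i) := by
    simp [Rows, hi, h1, h2]
  constructor <;> simp only [X, Finset.mem_union, Finset.mem_image]
  · right; left; exact ⟨i, hm, rfl⟩
  · right; right; exact ⟨i, hm, rfl⟩

/-- thin, contained items (`W < w l`, `e h ≤ H`, `p h ≤ H`) -/
noncomputable def Thin : Finset ι := Finset.univ.filter (fun i => ¬ D.Row i ∧ D.e * D.h i ≤ D.H ∧ D.W < D.w i * D.l)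
noncomputable def ThC : Finset ι := D.Thin.filter D.Cont
noncomputable def box (i : ι) : ℕ × ℕ := (D.rw i, lo (D.X (D.rw i)) (D.x i))
noncomputable def HB : Finset (ℕ × ℕ) := D.ThC.image D.box
noncomputable def wd (s : ℕ × ℕ) : ℕ := hi (D.X s.1) s.2 - s.2
noncomputable def Big : Finset ι := Finset.univ.filter (fun i => D.Row i ∧ D.W < D.w i * D.l2)
noncomputable def Vs : Finset ι := Finset.univ.filter (fun i => D.Row i ∧ D.w i * D.l2 ≤ D.W)

theorem ThC_spec {t : ι} (ht : t ∈ D.ThC) : ¬ D.Row t ∧ D.e * D.h t ≤ D.H ∧ D.W < D.w t * D.l ∧ D.Cont t := by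
  simp only [ThC, Thin, Finset.mem_filter, Finset.mem_univ, true_and] at ht
  tauto

theorem slab_t {t : ι} (ht : t ∈ D.ThC) : (D.box t).2 ∈ D.X (D.rw t) ∧ (D.box t).2 ≤ D.x t ∧
    D.x t + D.w t ≤ (D.box t).2 + D.wd (D.box t) ∧ (D.box t).2 + D.wd (D.box t) = hi (D.X (D.rw t)) (D.box t).2 ∧
    (D.box t).2 < D.W ∧ hi (D.X (D.rw t)) (D.box t).2 ≤ D.W := by
  have hs := D.ThC_spec ht
  have hin := D.hin t
  have hxW : D.x t < D.W := by omega
  have l1 := lo_le (D.X (D.rw t)) (D.x t)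
  have l2 := lo_hi (D.X0 (D.rw t)) (D.XW (D.rw t)) hxW
  have l3 : hi (D.X (D.rw t)) (lo (D.X (D.rw t)) (D.x t)) ≤ D.W := hi_le (D.XW _) (by omega)
  have l4 := hi_spec (D.XW (D.rw t)) hxW
  have key : D.x t + D.w t ≤ hi (D.X (D.rw t)) (D.x t) := by
    by_contra hc
    push Not at hc
    have hX := l4.1
    simp only [X, Finset.mem_union, Finset.mem_image, Finset.mem_insert, Finset.mem_singleton,
      Finset.mem_filter, Rows, Finset.mem_univ, true_and] at hX
    change (hi (D.X (D.rw t)) (D.x t) = 0 ∨ hi (D.X (D.rw t)) (D.x t) = D.W) ∨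
      (∃ a, (D.Row a ∧ D.r a ≤ D.rw t ∧ D.rw t < D.r a + D.k a) ∧ D.x a = hi (D.X (D.rw t)) (D.x t)) ∨
      (∃ a, (D.Row a ∧ D.r a ≤ D.rw t ∧ D.rw t < D.r a + D.k a) ∧ D.x a + D.w a = hi (D.X (D.rw t)) (D.x t)) at hX
    rcases hX with (h | h) | ⟨a, ⟨ha, h1, h2⟩, h3⟩ | ⟨a, ⟨ha, h1, h2⟩, h3⟩
    · omega
    · omega
    · have hne : t ≠ a := fun h => hs.1 (h ▸ ha)
      have := D.cont_row hs.2.2.2 ha hne h1 h2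
      have := D.hin a
      unfold ISep at *
      omega
    · have hne : t ≠ a := fun h => hs.1 (h ▸ ha)
      have := D.cont_row hs.2.2.2 ha hne h1 h2
      have := D.hin a
      unfold ISep at *
      omega
  have hb : (D.box t).2 = lo (D.X (D.rw t)) (D.x t) := rfl
  have hb1 : (D.box t).1 = D.rw t := rfl
  unfold wd
  rw [hb1, hb]
  refine ⟨lo_mem (D.X0 _) _, l1, ?_, ?_, ?_, l3⟩ <;> omega

theorem HB_spec {s : ℕ × ℕ} (hs : s ∈ D.HB) : s.2 ∈ D.X s.1 ∧ s.2 + D.wd s = hi (D.X s.1) s.2 ∧ s.2 < D.W ∧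
    s.2 + D.wd s ≤ D.W ∧ s.1 < 3 * D.m ∧ D.W < D.wd s * D.l ∧ 0 < D.wd s := by
  obtain ⟨t, ht, rfl⟩ := Finset.mem_image.1 hs
  obtain ⟨h1, h2, h3, h4, h5, h6⟩ := D.slab_t ht
  have h7 := D.hin t
  have h8 := (D.ThC_spec ht).2.2.1
  have h9 : D.w t * D.l ≤ D.wd (D.box t) * D.l := Nat.mul_le_mul_right _ (by omega)
  exact ⟨h1, h4, h5, by omega, D.rw_lt t, by omega, by omega⟩

/-- horizontal boxes avoid row items -/
theorem HB_row {s : ℕ × ℕ} (hs : s ∈ D.HB) {i : ι} (hi' : D.Row i) (h1 : D.r i ≤ s.1) (h2 : s.1 < D.r i + D.k i)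
    {c : ℕ} (hc1 : s.2 ≤ c) (hc2 : c < s.2 + D.wd s) (hd1 : D.x i ≤ c) (hd2 : c < D.x i + D.w i) : False := by
  have hS := D.HB_spec hs
  obtain ⟨t, ht, rfl⟩ := Finset.mem_image.1 hs
  obtain ⟨g1, g2, g3, g4, g5, g6⟩ := D.slab_t ht
  have hX := D.Xa hi' h1 h2
  have hne : t ≠ i := fun h => (D.ThC_spec ht).1 (h ▸ hi')
  have hsep := D.cont_row (D.ThC_spec ht).2.2.2 hi' hne h1 h2
  -- the row item covers the whole slab
  have e := slab_eq (D.XW (D.rw t)) g5 g1 hc1 (by omega)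
  have e1 : D.x i ≤ (D.box t).2 := by
    rw [← e.1]; exact le_lo hX.1 hd1
  have e2 : hi (D.X (D.rw t)) (D.box t).2 ≤ D.x i + D.w i := by
    rw [← e.2]; exact hi_le hX.2 hd2
  have := D.hin t
  unfold ISep at hsep
  omega

theorem HB_HB {s t : ℕ × ℕ} (hs : s ∈ D.HB) (ht : t ∈ D.HB) (hst : s ≠ t) (h1 : s.1 = t.1)
    {c : ℕ} (hc1 : s.2 ≤ c) (hc2 : c < s.2 + D.wd s) (hd1 : t.2 ≤ c) (hd2 : c < t.2 + D.wd t) : False := by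
  have hS := D.HB_spec hs
  have hT := D.HB_spec ht
  have e1 := slab_eq (D.XW s.1) hS.2.2.1 hS.1 hc1 (by omega)
  have e2 := slab_eq (D.XW t.1) hT.2.2.1 hT.1 hd1 (by omega)
  rw [h1] at e1
  exact hst (Prod.ext h1 (e1.1.symm.trans e2.1))

/-- the core instance -/
noncomputable def CI : CoreIn (ι ⊕ (ℕ × ℕ)) where
  m := D.m
  W := D.W
  B := D.Big.disjSum D.HB
  V := D.Vs.disjSum ∅
  x := Sum.elim D.x (fun s => s.2)
  w := Sum.elim D.w D.wd
  r := Sum.elim D.r (fun s => s.1)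
  k := Sum.elim D.k (fun _ => 1)
  hm := D.hm2
  hW := D.hW
  hBV := by
    rw [Finset.disjoint_left]
    rintro (i | s) h1 h2
    · simp only [Finset.inl_mem_disjSum, Big, Vs, Finset.mem_filter] at h1 h2
      omega
    · simp at h2
  hin := by
    rintro (i | s) hi
    · have hr : D.Row i := by
        simp only [Finset.mem_union, Finset.inl_mem_disjSum, Big, Vs, Finset.mem_filter] at hi
        tauto
      simp only [Sum.elim_inl]
      have := D.hin i
      exact ⟨this.1, D.rk_le3m hr, this.2.2.1, D.k_pos i⟩
    · have hs : s ∈ D.HB := by simpa using hi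
      have := D.HB_spec hs
      simp only [Sum.elim_inr]
      omega
  hdj := by
    have hrow : ∀ i, (Sum.inl i : ι ⊕ (ℕ × ℕ)) ∈ D.Big.disjSum D.HB ∨ (Sum.inl i : ι ⊕ (ℕ × ℕ)) ∈ D.Vs.disjSum ∅ → D.Row i := by
      intro i hi
      simp only [Finset.inl_mem_disjSum, Big, Vs, Finset.mem_filter] at hi
      tauto
    have hhb : ∀ s, (Sum.inr s : ι ⊕ (ℕ × ℕ)) ∈ D.Big.disjSum D.HB ∨ (Sum.inr s : ι ⊕ (ℕ × ℕ)) ∈ D.Vs.disjSum ∅ → s ∈ D.HB := by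
      intro i hi
      simpa using hi
    rintro (i | s) hi (j | t) hj hij c h1 h2 h3 h4 <;> simp only [Finset.mem_union] at hi hj
    · simp only [Sum.elim_inl] at *
      have hne : i ≠ j := fun h => hij (by rw [h])
      rcases D.hdj i j hne with h | h | h
      · unfold ISep at h; omega
      · exact Or.inl (D.row_row (hrow i hi) h)
      · exact Or.inr (D.row_row (hrow j hj) h)
    · simp only [Sum.elim_inl, Sum.elim_inr] at *
      by_contra hc
      exact D.HB_row (hhb t hj) (hrow i hi) (by omega) (by omega) h3 h4 h1 h2
    · simp only [Sum.elim_inl, Sum.elim_inr] at *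
      by_contra hc
      exact D.HB_row (hhb s hi) (hrow j hj) (by omega) (by omega) h1 h2 h3 h4
    · simp only [Sum.elim_inr] at *
      have hne : s ≠ t := fun h => hij (by rw [h])
      by_contra hc
      exact D.HB_HB (hhb s hi) (hhb t hj) hne (by omega) h1 h2 h3 h4

end Geo



/-- vertical scaling -/
def Rec.sc (H : ℕ) (r : Rec) : Rec := ⟨r.x, r.y * H, r.w, r.h * H⟩

theorem Rec.sc_mem {H : ℕ} (hH : 0 < H) {r : Rec} {i j : ℕ} (h : (r.sc H).mem i j) : r.mem i (j / H) := by
  simp only [Rec.sc, Rec.mem] at h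
  refine ⟨h.1, h.2.1, ?_, ?_⟩
  · exact (Nat.le_div_iff_mul_le hH).2 h.2.2.1
  · rw [Nat.div_lt_iff_lt_mul hH, Nat.add_mul]; exact h.2.2.2

theorem Rec.Dj.sc {H : ℕ} (hH : 0 < H) {r s : Rec} (h : r.Dj s) : (r.sc H).Dj (s.sc H) :=
  fun i j h1 h2 => h i (j / H) (Rec.sc_mem hH h1) (Rec.sc_mem hH h2)

/-- counting by area -/
theorem count_le {σ : Type*} (S : Finset σ) (R : σ → Rec) (W T l : ℕ) (hh : ∀ s ∈ S, (R s).h = 1)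
    (hin : ∀ s ∈ S, (R s).x + (R s).w ≤ W ∧ (R s).y + (R s).h ≤ T)
    (hdj : ∀ s ∈ S, ∀ t ∈ S, s ≠ t → (R s).Dj (R t)) (hw : ∀ s ∈ S, W < (R s).w * l) : S.card ≤ T * l := by
  have h1 := area_le S R W T hin hdj
  have h2 : S.card * (W + 1) ≤ (∑ s ∈ S, (R s).w * (R s).h) * l := by
    rw [Finset.sum_mul, ← smul_eq_mul, ← Finset.sum_const]
    apply Finset.sum_le_sum
    intro s hs
    rw [hh s hs, mul_one]
    exact hw s hs
  have h3 : S.card * (W + 1) ≤ T * l * (W + 1) := by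
    calc S.card * (W + 1) ≤ W * T * l := h2.trans (Nat.mul_le_mul_right _ h1)
      _ ≤ T * l * (W + 1) := by nlinarith
  exact Nat.le_of_mul_le_mul_right h3 (by omega)

namespace Geo

variable {ι : Type} (D : Geo ι) [Fintype ι]

theorem area_tot : ∑ i, D.w i * D.h i ≤ D.W * D.H := by
  have := area_le Finset.univ (fun i => (⟨D.x i, D.y i, D.w i, D.h i⟩ : Rec)) D.W D.H
    (fun i _ => ⟨(D.hin i).1, (D.hin i).2.1⟩) (by
      intro i _ j _ hij c d h1 h2
      have := D.hdj i j hij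
      simp only [ISep, Rec.mem] at *
      omega)
  exact this

theorem HB_card : D.HB.card ≤ 3 * D.m * D.l := by
  refine count_le D.HB (fun s => ⟨s.2, s.1, D.wd s, 1⟩) D.W (3 * D.m) D.l (fun _ _ => rfl) ?_ ?_ ?_
  · intro s hs
    have := D.HB_spec hs
    simp only
    omega
  · intro s hs t ht hst c d h1 h2
    simp only [Rec.mem] at h1 h2
    exact D.HB_HB hs ht hst (by omega) h1.1 h1.2.1 h2.1 h2.2.1
  · intro s hs
    exact (D.HB_spec hs).2.2.2.2.2.1

theorem cross_card : (D.Thin \ D.ThC).card ≤ 3 * D.m * D.l := by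
  have hsp : ∀ t ∈ D.Thin \ D.ThC, D.W < D.w t * D.l ∧ ¬ D.Cont t := by
    intro t ht
    simp only [Finset.mem_sdiff, ThC, Thin, Finset.mem_filter, Finset.mem_univ, true_and] at ht
    tauto
  refine count_le _ (fun s => ⟨D.x s, D.rw s, D.w s, 1⟩) D.W (3 * D.m) D.l (fun _ _ => rfl) ?_ ?_ ?_
  · intro s hs
    have := D.hin s
    have := D.rw_lt s
    simp only
    omega
  · intro s hs t ht hst c d h1 h2
    simp only [Rec.mem] at h1 h2
    have hst' : D.rw s = D.rw t := by omega
    have c1 := (hsp s hs).2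
    have c2 := (hsp t ht).2
    unfold Cont at c1 c2
    have e1 := D.rw_spec s
    have e2 := D.rw_spec t
    rw [hst'] at c1 e1
    rcases D.hdj s t hst with h | h | h
    · unfold ISep at h; omega
    · have := D.str_sep h
      omega
    · have := D.str_sep h
      omega
  · intro s hs
    exact (hsp s hs).1

theorem count_row (S : Finset ι) (L : ℕ) (hS : ∀ i ∈ S, D.Row i ∧ D.W < D.w i * L) (Z : ℕ)
    (hZ : Z * ∑ i ∈ S, D.w i * D.h i ≤ D.W * D.H) : Z * S.card ≤ D.p * L := by
  have h2 : S.card * (D.W * D.H) ≤ (∑ i ∈ S, D.w i * D.h i) * (D.p * L) := by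
    rw [Finset.sum_mul, ← smul_eq_mul, ← Finset.sum_const]
    apply Finset.sum_le_sum
    intro i hi
    obtain ⟨h3, h4⟩ := hS i hi
    unfold Row at h3
    calc D.W * D.H ≤ (D.w i * L) * (D.p * D.h i) := Nat.mul_le_mul h4.le h3.le
      _ = _ := by ring
  have h3 : Z * S.card * (D.W * D.H) ≤ D.p * L * (D.W * D.H) := by
    calc Z * S.card * (D.W * D.H) = Z * (S.card * (D.W * D.H)) := by ring
      _ ≤ Z * ((∑ i ∈ S, D.w i * D.h i) * (D.p * L)) := Nat.mul_le_mul_left _ h2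
      _ = (Z * ∑ i ∈ S, D.w i * D.h i) * (D.p * L) := by ring
      _ ≤ D.W * D.H * (D.p * L) := Nat.mul_le_mul_right _ hZ
      _ = _ := by ring
  exact Nat.le_of_mul_le_mul_right h3 (Nat.mul_pos D.hW D.hH)

theorem area_sub (S : Finset ι) : ∑ i ∈ S, D.w i * D.h i ≤ D.W * D.H :=
  (Finset.sum_le_sum_of_subset (Finset.subset_univ S)).trans D.area_tot

theorem Big_card : D.Big.card ≤ D.p * D.l2 := by
  have := D.count_row D.Big D.l2 (fun i hi => (Finset.mem_filter.1 hi).2) 1 (by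
    rw [one_mul]; exact D.area_sub _)
  rwa [one_mul] at this

theorem Thin_sum : ∑ i ∈ D.Thin, D.b * D.h i < (D.b * D.l + 1) * D.H := by
  have h1 : (∑ i ∈ D.Thin, D.h i) * D.W ≤ (∑ i ∈ D.Thin, D.w i * D.h i) * D.l := by
    rw [Finset.sum_mul, Finset.sum_mul]
    apply Finset.sum_le_sum
    intro i hi
    have : D.W < D.w i * D.l := (Finset.mem_filter.1 hi).2.2.2
    calc D.h i * D.W ≤ D.h i * (D.w i * D.l) := Nat.mul_le_mul_left _ this.le
      _ = _ := by ring
  have h2 := Nat.mul_le_mul_right D.l (D.area_sub D.Thin)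
  have h3 : (∑ i ∈ D.Thin, D.h i) ≤ D.l * D.H := by
    have : (∑ i ∈ D.Thin, D.h i) * D.W ≤ (D.l * D.H) * D.W := by
      calc _ ≤ _ := h1.trans h2
        _ = _ := by ring
    exact Nat.le_of_mul_le_mul_right this D.hW
  rw [← Finset.mul_sum]
  have := Nat.mul_le_mul_left D.b h3
  have := D.hH
  calc _ ≤ D.b * (D.l * D.H) := Nat.mul_le_mul_left D.b h3
    _ < _ := by rw [Nat.add_mul, mul_assoc]; omega

/-- the horizontal part -/
theorem hres : ∃ (Lost : Finset ι) (a : ι → (ℕ × ℕ) × ℕ × ℕ × ℕ) (R : (ℕ × ℕ) × ℕ × ℕ × ℕ → Rec),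
      Lost ⊆ D.ThC ∧ ∑ i ∈ Lost, D.b * D.h i ≤ D.H + (D.b * D.H / D.e) *
        (1 + 2 * (D.b * D.l + 1) + D.HB.card * hN D.l (D.b * D.l + 1)) ∧
      (∀ i ∈ D.ThC \ Lost, (a i).1 ∈ D.HB ∧ (R (a i)).x + (R (a i)).w ≤ D.wd (a i).1 ∧
        (R (a i)).y + (R (a i)).h ≤ D.H ∧ D.w i ≤ (R (a i)).w) ∧
      (∀ σ, ∑ i ∈ (D.ThC \ Lost).filter (fun i => a i = σ), D.b * D.h i ≤ (R σ).h) ∧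
      (∀ i ∈ D.ThC \ Lost, ∀ j ∈ D.ThC \ Lost, a i ≠ a j → (a i).1 = (a j).1 → (R (a i)).Dj (R (a j))) ∧
      ((D.ThC \ Lost).image a).card ≤ D.HB.card * hN D.l (D.b * D.l + 1) ∧
      ∑ σ ∈ (D.ThC \ Lost).image a, (R σ).w * (R σ).h ≤ ∑ i ∈ D.ThC, D.w i * (D.b * D.h i) := by
  have hsum : ∑ i ∈ D.ThC, D.b * D.h i < (D.b * D.l + 1) * D.H :=
    lt_of_le_of_lt (Finset.sum_le_sum_of_subset (Finset.filter_subset _ _)) D.Thin_sum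
  have := hpart D.ThC D.HB D.box D.wd D.W D.H D.l D.H (D.b * D.H / D.e) (D.b * D.l + 1)
    (fun i => D.x i - (D.box i).2) (fun i => 3 * D.m * D.y i - D.rw i * D.H) D.w (fun i => D.b * D.h i)
    D.hH hsum (by
      intro i hi
      have h1 := D.slab_t hi
      have h2 := D.ThC_spec hi
      have h3 := D.rw_spec i
      have h4 := h2.2.2.2
      unfold Cont at h4
      have h5 := D.bh_pos i
      refine ⟨Finset.mem_image_of_mem _ hi, ?_, ?_, h5, ?_, h2.2.2.1⟩
      · omega
      · rw [Nat.add_mul] at h4; omega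
      · rw [Nat.le_div_iff_mul_le D.he]
        calc D.b * D.h i * D.e = D.b * (D.e * D.h i) := by ring
          _ ≤ _ := Nat.mul_le_mul_left _ h2.2.1) (by
      intro s hs
      have := D.HB_spec hs
      omega) (by
      intro i hi j hj hij hb
      have hi1 := D.slab_t hi
      have hj1 := D.slab_t hj
      have hi3 := D.rw_spec i
      have hj3 := D.rw_spec j
      have hr : D.rw i = D.rw j := congrArg Prod.fst hb
      rw [hb] at hi1
      rw [hr] at hi3
      unfold ISep
      simp only
      rw [hb, hr]
      rcases D.hdj i j hij with h | h | h
      · unfold ISep at h; omega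
      · have := D.str_sep h
        omega
      · have := D.str_sep h
        omega)
  obtain ⟨Lost, a, R, h1, h2, h3, h4, h5, h6, h7⟩ := this
  exact ⟨Lost, a, R, h1, h2, h3, fun σ => by convert h4 σ, h5, by convert h6, by convert h7⟩

end Geo


theorem Rec.in_of_mem {r : Rec} {W T : ℕ} (hw : 0 < r.w) (hh : 0 < r.h)
    (h : ∀ j ρ, r.mem j ρ → j < W ∧ ρ < T) : r.x + r.w ≤ W ∧ r.y + r.h ≤ T := by
  have := h (r.x + r.w - 1) (r.y + r.h - 1) ⟨by omega, by omega, by omega, by omega⟩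
  omega

/-- box names in the main region -/
abbrev Bx (ι : Type) := ι ⊕ (Cid (ι ⊕ (ℕ × ℕ)) ⊕ ((ℕ × ℕ) × ℕ × ℕ × ℕ))

namespace Geo

variable {ι : Type} [Fintype ι] (D : Geo ι)

noncomputable def base : Bx ι → Rec
  | .inl i => ⟨D.x i, D.CI.r' (Sum.inl i), D.w i, D.k i⟩
  | .inr (.inl c) => D.CI.CR c
  | .inr (.inr σ) => ⟨σ.1.2, D.CI.r' (Sum.inr σ.1), D.wd σ.1, 1⟩

def Good : Bx ι → Prop
  | .inl i => i ∈ D.Big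
  | .inr (.inl c) => D.CI.Ok c
  | .inr (.inr σ) => σ.1 ∈ D.HB

theorem CI_B_inl {i : ι} (h : i ∈ D.Big) : (Sum.inl i : ι ⊕ (ℕ × ℕ)) ∈ D.CI.B := by
  show _ ∈ D.Big.disjSum D.HB
  simpa using h
theorem CI_B_inr {s : ℕ × ℕ} (h : s ∈ D.HB) : (Sum.inr s : ι ⊕ (ℕ × ℕ)) ∈ D.CI.B := by
  show _ ∈ D.Big.disjSum D.HB
  simpa using h

theorem blk_dj {a b : ι ⊕ (ℕ × ℕ)} (ha : a ∈ D.CI.B) (hb : b ∈ D.CI.B) (hab : a ≠ b) :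
    (⟨D.CI.x a, D.CI.r' a, D.CI.w a, D.CI.k a⟩ : Rec).Dj ⟨D.CI.x b, D.CI.r' b, D.CI.w b, D.CI.k b⟩ := by
  intro j ρ h1 h2
  simp only [Rec.mem] at h1 h2
  have := D.CI.r'_dj (D.CI.memJB ha) (D.CI.memJB hb) hab (c := j) ⟨h1.1, h1.2.1⟩ ⟨h2.1, h2.2.1⟩
  omega

theorem base_in {s : Bx ι} (hs : D.Good s) {j ρ : ℕ} (h : (D.base s).mem j ρ) : j < D.W ∧ ρ < 4 * D.m := by
  have blk : ∀ a ∈ D.CI.B, (⟨D.CI.x a, D.CI.r' a, D.CI.w a, D.CI.k a⟩ : Rec).mem j ρ → j < D.W ∧ ρ < 4 * D.m := by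
    intro a ha h
    have h1 := D.CI.r'_le (D.CI.memJB ha)
    have h2 := D.CI.hin a (D.CI.memJB ha)
    simp only [Rec.mem] at h
    have e1 : D.CI.m = D.m := rfl
    have e2 : D.CI.W = D.W := rfl
    omega
  match s, hs, h with
  | .inl i, hs, h => exact blk _ (D.CI_B_inl hs) h
  | .inr (.inl c), hs, h => exact D.CI.CR_in hs h
  | .inr (.inr σ), hs, h => exact blk _ (D.CI_B_inr hs) h

theorem base_dj {s t : Bx ι} (hs : D.Good s) (ht : D.Good t) (hst : s ≠ t)
    (hh : ∀ σ τ, s = .inr (.inr σ) → t = .inr (.inr τ) → σ.1 ≠ τ.1) : (D.base s).Dj (D.base t) := by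
  match s, t, hs, ht, hst, hh with
  | .inl i, .inl j, hs, ht, hst, _ =>
    exact D.blk_dj (D.CI_B_inl hs) (D.CI_B_inl ht) (fun h => hst (by simpa using h))
  | .inl i, .inr (.inl c), hs, ht, _, _ => exact (D.CI.CR_block ht (D.CI_B_inl hs)).symm
  | .inl i, .inr (.inr σ), hs, ht, _, _ => exact D.blk_dj (D.CI_B_inl hs) (D.CI_B_inr ht) (by simp)
  | .inr (.inl c), .inl j, hs, ht, _, _ => exact (D.CI.CR_block hs (D.CI_B_inl ht))
  | .inr (.inl c), .inr (.inl c'), hs, ht, hst, _ =>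
    exact D.CI.CR_dj hs ht (fun h => hst (by rw [h]))
  | .inr (.inl c), .inr (.inr σ), hs, ht, _, _ => exact (D.CI.CR_block hs (D.CI_B_inr ht))
  | .inr (.inr σ), .inl j, hs, ht, _, _ => exact D.blk_dj (D.CI_B_inr hs) (D.CI_B_inl ht) (by simp)
  | .inr (.inr σ), .inr (.inl c), hs, ht, _, _ => exact (D.CI.CR_block ht (D.CI_B_inr hs)).symm
  | .inr (.inr σ), .inr (.inr τ), hs, ht, _, hh =>
    exact D.blk_dj (D.CI_B_inr hs) (D.CI_B_inr ht) (fun h => hh σ τ rfl rfl (by simpa using h))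

/-- the core part, restated -/
theorem vres (hnb : CC D.m * (D.Big.card + D.HB.card + 1) ≤ D.l2) :
    ∃ a : ι → Cid (ι ⊕ (ℕ × ℕ)), (∀ v ∈ D.Vs, D.CI.Ok (a v) ∧ D.k v ≤ (D.CI.CR (a v)).h) ∧
      (D.Vs.image a).card ≤ KC D.m * (D.Big.card + D.HB.card + 1) ∧
      (∀ s, ∑ v ∈ D.Vs.filter (fun v => a v = s), D.w v ≤ (D.CI.CR s).w) ∧
      ∑ v ∈ D.Vs, D.w v * (D.CI.CR (a v)).h ≤ ∑ v ∈ D.Vs, D.w v * D.k v + D.W := by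
  have hl2 : 0 ≤ D.l2 := Nat.zero_le _
  obtain ⟨a, h1, h2, h3, h4⟩ := D.CI.core (nb := D.Big.card + D.HB.card + 1) (β := D.W / D.l2) (by
      show (D.Big.disjSum D.HB).card + 1 ≤ _
      rw [Finset.card_disjSum]) (by
      intro i hi
      rcases i with i | s
      · have hi' : i ∈ D.Vs := by
          have : (Sum.inl i : ι ⊕ (ℕ × ℕ)) ∈ D.Vs.disjSum ∅ := hi
          simpa using this
        have h1 : D.w i * D.l2 ≤ D.W := (Finset.mem_filter.1 hi').2.2
        show D.w i ≤ _
        by_cases h0 : D.l2 = 0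
        · exfalso
          have : 1 ≤ CC D.m := by unfold CC; have := D.hm2; exact Nat.mul_pos (by omega) (by omega)
          have := Nat.mul_pos this (Nat.succ_pos (D.Big.card + D.HB.card))
          simp only [Nat.succ_eq_add_one] at this
          omega
        · exact (Nat.le_div_iff_mul_le (by omega)).2 h1
      · have : (Sum.inr s : ι ⊕ (ℕ × ℕ)) ∈ D.Vs.disjSum ∅ := hi
        simp at this) (by
      show CC D.m * _ * _ ≤ D.W
      exact (Nat.mul_le_mul_right _ hnb).trans (Nat.mul_div_le _ _))
  have hV : D.CI.V = D.Vs.map Function.Embedding.inl := by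
    show D.Vs.disjSum ∅ = _
    simp
  refine ⟨fun i => a (Sum.inl i), ?_, ?_, ?_, ?_⟩
  · intro v hv
    have := h1 (Sum.inl v) (by rw [hV]; simpa using hv)
    exact this
  · rw [hV] at h2
    refine le_trans (Finset.card_le_card ?_) h2
    intro c hc
    obtain ⟨v, hv, rfl⟩ := Finset.mem_image.1 hc
    exact Finset.mem_image.2 ⟨Sum.inl v, by simpa using hv, rfl⟩
  · intro s
    have := h3 s
    rw [hV, Finset.filter_map, Finset.sum_map] at this
    convert this using 1
    apply Finset.sum_congr
    · ext v; rw [Finset.mem_filter, Finset.mem_filter]; rfl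
    · intro v _; rfl
  · rw [hV, Finset.sum_map, Finset.sum_map] at h4
    exact h4

noncomputable def MainS (Lost : Finset ι) : Finset ι := D.Big ∪ D.Vs ∪ (D.Thin \ Lost)

theorem region (hnb : CC D.m * (D.Big.card + D.HB.card + 1) ≤ D.l2) :
    ∃ (Lost : Finset ι) (a : ι → Bx ι) (R : Bx ι → Rec),
      Lost ⊆ D.Thin ∧
      ∑ i ∈ Lost, D.b * D.h i ≤ D.H + (D.b * D.H / D.e) *
        (1 + 2 * (D.b * D.l + 1) + 3 * D.m * D.l * (hN D.l (D.b * D.l + 1) + 1)) ∧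
      (∀ i ∈ D.MainS Lost, (R (a i)).x + (R (a i)).w ≤ D.W ∧ (R (a i)).y + (R (a i)).h ≤ 4 * D.m * D.H) ∧
      (∀ i ∈ D.MainS Lost, ∀ j ∈ D.MainS Lost, a i ≠ a j → (R (a i)).Dj (R (a j))) ∧
      (∀ s, VFit ((D.MainS Lost).filter (fun i => a i = s)) D.w (fun i => D.b * D.h i) (R s) ∨
        HFit ((D.MainS Lost).filter (fun i => a i = s)) D.w (fun i => D.b * D.h i) (R s)) ∧
      ((D.MainS Lost).image a).card ≤ D.p * D.l2 + KC D.m * (D.p * D.l2 + 3 * D.m * D.l + 1) +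
        3 * D.m * D.l * hN D.l (D.b * D.l + 1) ∧
      ∑ s ∈ (D.MainS Lost).image a, (R s).w * (R s).h ≤
        (D.b + D.p) * ∑ i ∈ D.Big ∪ D.Vs, D.w i * D.h i + D.b * ∑ i ∈ D.Thin, D.w i * D.h i + D.W * D.H := by
  obtain ⟨aC, c1, c2, c3, c4⟩ := D.vres hnb
  obtain ⟨LH, aH, RH, l1, l2, l3, l4, l5, l6, l7⟩ := D.hres
  have hBV : Disjoint D.Big D.Vs := by
    rw [Finset.disjoint_left]
    intro i h1 h2
    simp only [Big, Vs, Finset.mem_filter] at h1 h2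
    omega
  have hRow : ∀ i, i ∈ D.Big ∨ i ∈ D.Vs → D.Row i := by
    intro i hi
    simp only [Big, Vs, Finset.mem_filter] at hi
    tauto
  have hTh : ∀ i ∈ D.Thin, i ∉ D.Big ∧ i ∉ D.Vs := by
    intro i hi
    have : ¬ D.Row i := (Finset.mem_filter.1 hi).2.1
    exact ⟨fun h => this (hRow i (Or.inl h)), fun h => this (hRow i (Or.inr h))⟩
  set Lost := (D.Thin \ D.ThC) ∪ LH with hLost
  have hMT : ∀ i, i ∈ D.Thin \ Lost ↔ i ∈ D.ThC \ LH := by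
    intro i
    have : i ∈ D.ThC → i ∈ D.Thin := fun h => (Finset.mem_filter.1 h).1
    simp only [hLost, Finset.mem_sdiff, Finset.mem_union]
    tauto
  let a : ι → Bx ι := fun i => if i ∈ D.Big then .inl i else if i ∈ D.Vs then .inr (.inl (aC i)) else .inr (.inr (aH i))
  have aB : ∀ i ∈ D.Big, a i = .inl i := fun i hi => if_pos hi
  have aV : ∀ i ∈ D.Vs, a i = .inr (.inl (aC i)) := by
    intro i hi
    have : i ∉ D.Big := fun h => Finset.disjoint_left.1 hBV h hi
    simp only [a, if_neg this, if_pos hi]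
  have aT : ∀ i ∈ D.ThC \ LH, a i = .inr (.inr (aH i)) := by
    intro i hi
    have h1 := hTh i (Finset.mem_filter.1 (Finset.mem_sdiff.1 hi).1).1
    simp only [a, if_neg h1.1, if_neg h1.2]
  let R : Bx ι → Rec := fun s => match s with
    | .inl i => ⟨D.x i, D.CI.r' (Sum.inl i) * D.H, D.w i, D.k i * D.H⟩
    | .inr (.inl c) => ⟨(D.CI.CR c).x, (D.CI.CR c).y * D.H, ∑ v ∈ D.Vs.filter (fun v => aC v = c), D.w v, (D.CI.CR c).h * D.H⟩
    | .inr (.inr σ) => ⟨σ.1.2 + (RH σ).x, D.CI.r' (Sum.inr σ.1) * D.H + (RH σ).y, (RH σ).w, (RH σ).h⟩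
  have hcase : ∀ i ∈ D.MainS Lost, i ∈ D.Big ∨ i ∈ D.Vs ∨ i ∈ D.ThC \ LH := by
    intro i hi
    simp only [MainS, Finset.mem_union] at hi
    rw [hMT] at hi
    tauto
  have hfull : ∀ i ∈ D.MainS Lost, D.Good (a i) ∧ (R (a i)).Sub ((D.base (a i)).sc D.H) ∧
      0 < (R (a i)).w ∧ 0 < (R (a i)).h := by
    intro i hi
    have hpos := D.hin i
    rcases hcase i hi with h | h | h
    · rw [aB i h]
      refine ⟨h, fun j ρ h' => h', hpos.2.2.1, Nat.mul_pos (D.k_pos i) D.hH⟩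
    · rw [aV i h]
      have := c1 i h
      have hk := D.k_pos i
      refine ⟨this.1, ?_, ?_, Nat.mul_pos (by omega) D.hH⟩
      · intro j ρ h'
        have := c3 (aC i)
        simp only [R, Rec.mem, base, Rec.sc] at h' ⊢
        omega
      · show 0 < ∑ v ∈ D.Vs.filter (fun v => aC v = aC i), D.w v
        exact lt_of_lt_of_le hpos.2.2.1 (Finset.single_le_sum (f := fun v => D.w v) (fun _ _ => Nat.zero_le _)
          (Finset.mem_filter.2 ⟨h, rfl⟩))
    · rw [aT i h]
      have h3 := l3 i h
      have h4 := l4 (aH i)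
      refine ⟨h3.1, ?_, ?_, ?_⟩
      · intro j ρ h'
        simp only [R, Rec.mem, base, Rec.sc] at h' ⊢
        omega
      · simp only [R]; omega
      · simp only [R]
        refine lt_of_lt_of_le (D.bh_pos i) (le_trans ?_ h4)
        exact Finset.single_le_sum (f := fun v => D.b * D.h v) (fun _ _ => Nat.zero_le _)
          (Finset.mem_filter.2 ⟨h, rfl⟩)
  refine ⟨Lost, a, R, ?_, ?_, ?_, ?_, ?_, ?_, ?_⟩
  · intro i hi
    rcases Finset.mem_union.1 hi with h | h
    · exact (Finset.mem_sdiff.1 h).1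
    · exact (Finset.mem_filter.1 (l1 h)).1
  · have e1 : ∑ i ∈ D.Thin \ D.ThC, D.b * D.h i ≤ (D.b * D.H / D.e) * (3 * D.m * D.l) := by
      calc ∑ i ∈ D.Thin \ D.ThC, D.b * D.h i ≤ ∑ i ∈ D.Thin \ D.ThC, (D.b * D.H / D.e) := by
            apply Finset.sum_le_sum
            intro i hi
            have h2 : D.e * D.h i ≤ D.H := (Finset.mem_filter.1 (Finset.mem_sdiff.1 hi).1).2.2.1
            rw [Nat.le_div_iff_mul_le D.he]
            calc D.b * D.h i * D.e = D.b * (D.e * D.h i) := by ring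
              _ ≤ _ := Nat.mul_le_mul_left _ h2
        _ = (D.b * D.H / D.e) * (D.Thin \ D.ThC).card := by rw [Finset.sum_const, smul_eq_mul, mul_comm]
        _ ≤ _ := Nat.mul_le_mul_left _ D.cross_card
    have e2 : ∑ i ∈ Lost, D.b * D.h i ≤ ∑ i ∈ D.Thin \ D.ThC, D.b * D.h i + ∑ i ∈ LH, D.b * D.h i := by
      rw [hLost, ← Finset.sum_union_inter]
      exact Nat.le_add_right _ _
    have e3 : (D.b * D.H / D.e) * (1 + 2 * (D.b * D.l + 1) + D.HB.card * hN D.l (D.b * D.l + 1)) ≤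
        (D.b * D.H / D.e) * (1 + 2 * (D.b * D.l + 1) + (3 * D.m * D.l) * hN D.l (D.b * D.l + 1)) := by
      gcongr
      exact D.HB_card
    have e4 : (D.b * D.H / D.e) * (1 + 2 * (D.b * D.l + 1) + 3 * D.m * D.l * (hN D.l (D.b * D.l + 1) + 1)) =
      (D.b * D.H / D.e) * (3 * D.m * D.l) + (D.b * D.H / D.e) * (1 + 2 * (D.b * D.l + 1) + (3 * D.m * D.l) * hN D.l (D.b * D.l + 1)) := by ring
    rw [e4]
    omega
  · intro i hi
    obtain ⟨g1, g2, g3, g4⟩ := hfull i hi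
    apply Rec.in_of_mem g3 g4
    intro j ρ h
    have h1 := Rec.sc_mem D.hH (g2 j ρ h)
    have h2 := D.base_in g1 h1
    refine ⟨h2.1, ?_⟩
    exact (Nat.div_lt_iff_lt_mul D.hH).1 h2.2
  · intro i hi j hj hij
    obtain ⟨g1, g2, g3, g4⟩ := hfull i hi
    obtain ⟨g1', g2', g3', g4'⟩ := hfull j hj
    by_cases hh : ∀ σ τ, a i = .inr (.inr σ) → a j = .inr (.inr τ) → σ.1 ≠ τ.1
    · exact ((D.base_dj g1 g1' hij hh).sc D.hH).mono g2 g2'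
    · push Not at hh
      obtain ⟨σ, τ, h1, h2, h3⟩ := hh
      have hi' : i ∈ D.ThC \ LH ∧ aH i = σ := by
        rcases hcase i hi with h | h | h
        · rw [aB i h] at h1; simp at h1
        · rw [aV i h] at h1; simp at h1
        · rw [aT i h] at h1; exact ⟨h, by simpa using h1⟩
      have hj' : j ∈ D.ThC \ LH ∧ aH j = τ := by
        rcases hcase j hj with h | h | h
        · rw [aB j h] at h2; simp at h2
        · rw [aV j h] at h2; simp at h2
        · rw [aT j h] at h2; exact ⟨h, by simpa using h2⟩
      have hne : aH i ≠ aH j := by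
        intro h; apply hij; rw [h1, h2, ← hi'.2, ← hj'.2, h]
      have hd := l5 i hi'.1 j hj'.1 hne (by rw [hi'.2, hj'.2]; exact h3)
      rw [hi'.2, hj'.2] at hd
      rw [h1, h2]
      intro c ρ m1 m2
      simp only [R, Rec.mem, h3] at m1 m2
      apply hd (c - τ.1.2) (ρ - D.CI.r' (Sum.inr τ.1) * D.H)
      · simp only [Rec.mem]; omega
      · simp only [Rec.mem]; omega
  · intro s
    match s with
    | .inl i =>
      left
      have hs : (D.MainS Lost).filter (fun j => a j = .inl i) ⊆ {i} := by
        intro j hj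
        obtain ⟨hj, hji⟩ := Finset.mem_filter.1 hj
        rcases hcase j hj with h | h | h
        · rw [aB j h] at hji; simpa using hji
        · rw [aV j h] at hji; simp at hji
        · rw [aT j h] at hji; simp at hji
      refine ⟨?_, ?_⟩
      · refine (Finset.sum_le_sum_of_subset hs).trans ?_
        simp [R]
      · intro j hj
        have := hs hj
        rw [Finset.mem_singleton] at this
        subst this
        exact (D.k_spec j).1
    | .inr (.inl c) =>
      left
      have hs : ∀ j ∈ (D.MainS Lost).filter (fun j => a j = .inr (.inl c)), j ∈ D.Vs ∧ aC j = c := by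
        intro j hj
        obtain ⟨hj, hji⟩ := Finset.mem_filter.1 hj
        rcases hcase j hj with h | h | h
        · rw [aB j h] at hji; simp at hji
        · rw [aV j h] at hji; exact ⟨h, by simpa using hji⟩
        · rw [aT j h] at hji; simp at hji
      refine ⟨?_, ?_⟩
      · exact Finset.sum_le_sum_of_subset (fun j hj => Finset.mem_filter.2 (hs j hj))
      · intro j hj
        obtain ⟨h1, h2⟩ := hs j hj
        have := (c1 j h1).2
        rw [h2] at this
        exact (D.k_spec j).1.trans (Nat.mul_le_mul_right _ this)
    | .inr (.inr σ) =>
      right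
      have hs : ∀ j ∈ (D.MainS Lost).filter (fun j => a j = .inr (.inr σ)), j ∈ D.ThC \ LH ∧ aH j = σ := by
        intro j hj
        obtain ⟨hj, hji⟩ := Finset.mem_filter.1 hj
        rcases hcase j hj with h | h | h
        · rw [aB j h] at hji; simp at hji
        · rw [aV j h] at hji; simp at hji
        · rw [aT j h] at hji; exact ⟨h, by simpa using hji⟩
      refine ⟨?_, ?_⟩
      · exact (Finset.sum_le_sum_of_subset (fun j hj => Finset.mem_filter.2 (hs j hj))).trans (l4 σ)
      · intro j hj
        obtain ⟨h1, h2⟩ := hs j hj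
        have := (l3 j h1).2.2.2
        rw [h2] at this
        exact this
  all_goals
    have hsub : (D.MainS Lost).image a ⊆ D.Big.disjSum ((D.Vs.image aC).disjSum ((D.ThC \ LH).image aH)) := by
      intro s hs
      obtain ⟨i, hi, rfl⟩ := Finset.mem_image.1 hs
      rcases hcase i hi with h | h | h
      · rw [aB i h]; simpa using h
      · rw [aV i h]
        rw [Finset.inr_mem_disjSum, Finset.inl_mem_disjSum]
        exact Finset.mem_image_of_mem _ h
      · rw [aT i h]
        rw [Finset.inr_mem_disjSum, Finset.inr_mem_disjSum]
        exact Finset.mem_image_of_mem _ h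
  · refine (Finset.card_le_card hsub).trans ?_
    rw [Finset.card_disjSum, Finset.card_disjSum]
    have e1 := D.Big_card
    have e2 := D.HB_card
    have e3 : KC D.m * (D.Big.card + D.HB.card + 1) ≤ KC D.m * (D.p * D.l2 + 3 * D.m * D.l + 1) :=
      Nat.mul_le_mul_left _ (by omega)
    have e4 := Nat.mul_le_mul_right (hN D.l (D.b * D.l + 1)) e2
    omega
  · refine (Finset.sum_le_sum_of_subset hsub).trans ?_
    rw [Finset.sum_disjSum, Finset.sum_disjSum]
    have kH : ∀ i, i ∈ D.Big ∨ i ∈ D.Vs → D.w i * (D.k i * D.H) ≤ (D.b + D.p) * (D.w i * D.h i) := by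
      intro i hi
      have h1 := (D.k_spec i).2
      have h2 : D.H < D.p * D.h i := hRow i hi
      have : D.k i * D.H ≤ (D.b + D.p) * D.h i := by rw [Nat.add_mul]; omega
      calc _ ≤ D.w i * ((D.b + D.p) * D.h i) := Nat.mul_le_mul_left _ this
        _ = _ := by ring
    have e1 : ∑ i ∈ D.Big, (R (.inl i)).w * (R (.inl i)).h ≤ (D.b + D.p) * ∑ i ∈ D.Big, D.w i * D.h i := by
      rw [Finset.mul_sum]
      exact Finset.sum_le_sum (fun i hi => kH i (Or.inl hi))
    have e2 : ∑ c ∈ D.Vs.image aC, (R (.inr (.inl c))).w * (R (.inr (.inl c))).h ≤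
        (D.b + D.p) * ∑ i ∈ D.Vs, D.w i * D.h i + D.W * D.H := by
      calc ∑ c ∈ D.Vs.image aC, (R (.inr (.inl c))).w * (R (.inr (.inl c))).h
          = ∑ c ∈ D.Vs.image aC, ∑ v ∈ D.Vs.filter (fun v => aC v = c), D.w v * (D.CI.CR (aC v)).h * D.H := by
            apply Finset.sum_congr rfl
            intro c _
            simp only [R]
            rw [Finset.sum_mul]
            apply Finset.sum_congr rfl
            intro v hv
            rw [(Finset.mem_filter.1 hv).2]
            ring
        _ = ∑ v ∈ D.Vs, D.w v * (D.CI.CR (aC v)).h * D.H :=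
            Finset.sum_fiberwise_of_maps_to (fun v hv => Finset.mem_image_of_mem _ hv) _
        _ = (∑ v ∈ D.Vs, D.w v * (D.CI.CR (aC v)).h) * D.H := by rw [Finset.sum_mul]
        _ ≤ (∑ v ∈ D.Vs, D.w v * D.k v + D.W) * D.H := Nat.mul_le_mul_right _ c4
        _ = ∑ v ∈ D.Vs, D.w v * (D.k v * D.H) + D.W * D.H := by
            rw [Nat.add_mul, Finset.sum_mul]
            congr 1
            apply Finset.sum_congr rfl
            intro v _
            ring
        _ ≤ _ := by
            rw [Finset.mul_sum]
            exact Nat.add_le_add_right (Finset.sum_le_sum (fun i hi => kH i (Or.inr hi))) _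
    have e3 : ∑ σ ∈ (D.ThC \ LH).image aH, (R (.inr (.inr σ))).w * (R (.inr (.inr σ))).h ≤
        D.b * ∑ i ∈ D.Thin, D.w i * D.h i := by
      refine l7.trans ?_
      rw [Finset.mul_sum]
      calc ∑ i ∈ D.ThC, D.w i * (D.b * D.h i) = ∑ i ∈ D.ThC, D.b * (D.w i * D.h i) :=
            Finset.sum_congr rfl (fun i _ => by ring)
        _ ≤ _ := Finset.sum_le_sum_of_subset (Finset.filter_subset _ _)
    rw [Finset.sum_union hBV, Nat.mul_add]
    omega

end Geo


/-- number of main boxes -/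
noncomputable def nBf (m b p l l2 : ℕ) : ℕ := p * l2 + KC m * (p * l2 + 3 * m * l + 1) + 3 * m * l * hN l (b * l + 1)
/-- number of lost layers -/
noncomputable def NLf (m b l : ℕ) : ℕ := 1 + 2 * (b * l + 1) + 3 * m * l * (hN l (b * l + 1) + 1)
noncomputable def l2f (m p l : ℕ) : ℕ := 2 * (CC m * (p * l + 3 * m * l + 1))
noncomputable def Mf (n : ℕ) : ℕ := (2 * n + 2) * (2 * n + 2)

theorem VFit.mono {ι : Type*} {S S' : Finset ι} {w h : ι → ℕ} {R : Rec} (hf : VFit S w h R) (hs : S' ⊆ S) : VFit S' w h R :=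
  ⟨(Finset.sum_le_sum_of_subset hs).trans hf.1, fun i hi => hf.2 i (hs hi)⟩
theorem HFit.mono {ι : Type*} {S S' : Finset ι} {w h : ι → ℕ} {R : Rec} (hf : HFit S w h R) (hs : S' ⊆ S) : HFit S' w h R :=
  ⟨(Finset.sum_le_sum_of_subset hs).trans hf.1, fun i hi => hf.2 i (hs hi)⟩
theorem AFit.mono {ι : Type*} {S S' : Finset ι} {w h : ι → ℕ} {R : Rec} (hf : AFit S w h R) (hs : S' ⊆ S) : AFit S' w h R := by
  obtain ⟨ω, η, h1, h2⟩ := hf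
  exact ⟨ω, η, fun i hi => h1 i (hs hi), (Finset.sum_le_sum_of_subset hs).trans h2⟩

abbrev FB (ι : Type) := Bx ι ⊕ (Bool ⊕ (ℕ × ℕ))

namespace Geo

variable {ι : Type} [Fintype ι] (D : Geo ι)

theorem mem_Big {i : ι} : i ∈ D.Big ↔ D.H < D.p * D.h i ∧ D.W < D.w i * D.l2 := by
  simp only [Big, Finset.mem_filter, Finset.mem_univ, true_and]; rfl
theorem mem_Vs {i : ι} : i ∈ D.Vs ↔ D.H < D.p * D.h i ∧ D.w i * D.l2 ≤ D.W := by
  simp only [Vs, Finset.mem_filter, Finset.mem_univ, true_and]; rfl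
theorem mem_Thin {i : ι} : i ∈ D.Thin ↔ D.p * D.h i ≤ D.H ∧ D.e * D.h i ≤ D.H ∧ D.W < D.w i * D.l := by
  simp only [Thin, Finset.mem_filter, Finset.mem_univ, true_and, Row, not_lt]

theorem hnb_of {l3 : ℕ} (hl2 : D.l2 = l2f D.m D.p D.l) (hl3 : D.l2 ≤ l3)
    (hmed2 : (2 * CC D.m * D.p + 64 * D.A) *
      ∑ i ∈ Finset.univ.filter (fun i => D.w i * D.l ≤ D.W ∧ D.W < D.w i * l3), D.w i * D.h i ≤ D.W * D.H) :
    CC D.m * (D.Big.card + D.HB.card + 1) ≤ D.l2 := by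
  set B1 := Finset.univ.filter (fun i => D.Row i ∧ D.W < D.w i * D.l) with hB1
  set B2 := Finset.univ.filter (fun i => D.Row i ∧ D.w i * D.l ≤ D.W ∧ D.W < D.w i * D.l2) with hB2
  have hsub : D.Big ⊆ B1 ∪ B2 := by
    intro i hi
    simp only [Big, Finset.mem_filter, Finset.mem_univ, true_and] at hi
    simp only [hB1, hB2, Finset.mem_union, Finset.mem_filter, Finset.mem_univ, true_and]
    by_cases h : D.W < D.w i * D.l
    · exact Or.inl ⟨hi.1, h⟩
    · exact Or.inr ⟨hi.1, by omega, hi.2⟩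
  have c0 : D.Big.card ≤ B1.card + B2.card := (Finset.card_le_card hsub).trans (Finset.card_union_le _ _)
  have c1 : 1 * B1.card ≤ D.p * D.l := D.count_row B1 D.l (fun i hi => (Finset.mem_filter.1 hi).2) 1 (by
    rw [one_mul]; exact D.area_sub _)
  have c2 : 2 * CC D.m * D.p * B2.card ≤ D.p * D.l2 := D.count_row B2 D.l2 (fun i hi => by
      have := (Finset.mem_filter.1 hi).2
      exact ⟨this.1, this.2.2⟩) _ (by
    refine le_trans (Nat.mul_le_mul (Nat.le_add_right _ (64 * D.A)) (Finset.sum_le_sum_of_subset ?_)) hmed2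
    intro i hi
    have := (Finset.mem_filter.1 hi).2
    refine Finset.mem_filter.2 ⟨Finset.mem_univ _, this.2.1, lt_of_lt_of_le this.2.2 (Nat.mul_le_mul_left _ hl3)⟩)
  have c3 : 2 * CC D.m * B2.card ≤ D.l2 := by
    apply Nat.le_of_mul_le_mul_left (c := D.p) _ D.hp
    calc D.p * (2 * CC D.m * B2.card) = 2 * CC D.m * D.p * B2.card := by ring
      _ ≤ _ := c2
  have c4 := D.HB_card
  have c5 : CC D.m * (D.Big.card + D.HB.card + 1) ≤ CC D.m * ((D.p * D.l + 3 * D.m * D.l + 1) + B2.card) :=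
    Nat.mul_le_mul_left _ (by omega)
  rw [Nat.mul_add (CC D.m) (D.p * D.l + 3 * D.m * D.l + 1)] at c5
  have c6 : 2 * CC D.m * B2.card = 2 * (CC D.m * B2.card) := by ring
  unfold l2f at hl2
  omega

set_option maxHeartbeats 2000000 in
theorem assemble {l3 : ℕ} (h1 : 8 * D.A ≤ D.p) (hl : 2 * D.A ≤ D.l) (hl2 : D.l2 = l2f D.m D.p D.l) (hl3 : D.l2 ≤ l3)
    (hl3' : 4 * D.m * Mf (nBf D.m D.b D.p D.l D.l2) ≤ l3)
    (he1 : D.b * NLf D.m D.b D.l ≤ D.e) (he2 : D.b * Mf (nBf D.m D.b D.p D.l D.l2) ≤ D.e)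
    (hmed1 : 64 * D.A * D.A *
      ∑ i ∈ Finset.univ.filter (fun i => D.p * D.h i ≤ D.H ∧ D.H < D.e * D.h i), D.w i * D.h i ≤ D.W * D.H)
    (hmed2 : (2 * CC D.m * D.p + 64 * D.A) *
      ∑ i ∈ Finset.univ.filter (fun i => D.w i * D.l ≤ D.W ∧ D.W < D.w i * l3), D.w i * D.h i ≤ D.W * D.H) :
    ∃ (a : ι → FB ι) (R : FB ι → Rec) (C : Finset (FB ι)),
      (∀ i, (R (a i)).x + (R (a i)).w ≤ D.W ∧ (R (a i)).y + (R (a i)).h ≤ (4 * D.m + 20 * D.q) * D.H) ∧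
      (∀ i j, a i ≠ a j → (R (a i)).Dj (R (a j))) ∧
      (∀ s, VFit (Finset.univ.filter (fun i => a i = s)) D.w (fun i => D.b * D.h i) (R s) ∨
        HFit (Finset.univ.filter (fun i => a i = s)) D.w (fun i => D.b * D.h i) (R s) ∨
        AFit (Finset.univ.filter (fun i => a i = s)) D.w (fun i => D.b * D.h i) (R s)) ∧
      (∀ i, D.H < D.A * D.h i ∨ D.W < D.A * D.w i → a i ∈ C) ∧
      (∀ s ∈ C, (∃ i, a i = s) ∧
        (VFit (Finset.univ.filter (fun i => a i = s)) D.w (fun i => D.b * D.h i) (R s) ∨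
        HFit (Finset.univ.filter (fun i => a i = s)) D.w (fun i => D.b * D.h i) (R s))) ∧
      C.card ≤ nBf D.m D.b D.p D.l D.l2 + 1 := by
  obtain ⟨Lost, a0, R0, r1, r2, r3, r4, r5, r6, r7⟩ := D.region (D.hnb_of hl2 hl3 hmed2)
  have hA := D.hA
  have hq := D.hqpos
  have hW := D.hW
  have hH := D.hH
  have hb := D.hbpos
  -- classes
  let Md1 : Finset ι := Finset.univ.filter (fun i => D.p * D.h i ≤ D.H ∧ D.H < D.e * D.h i)
  let Md2 : Finset ι := Finset.univ.filter (fun i => D.w i * D.l ≤ D.W ∧ D.W < D.w i * l3)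
  let Wide : Finset ι := Md1.filter (fun i => D.W < D.w i * (2 * D.A))
  let Tiny : Finset ι := Finset.univ.filter (fun i => D.p * D.h i ≤ D.H ∧ D.e * D.h i ≤ D.H ∧ D.w i * D.l ≤ D.W ∧ D.w i * l3 ≤ D.W)
  let Stk : Finset ι := Wide ∪ Lost
  have hLT : ∀ i ∈ Lost, D.p * D.h i ≤ D.H ∧ D.e * D.h i ≤ D.H ∧ D.W < D.w i * D.l := by
    intro i hi
    have := r1 hi
    simp only [D.mem_Thin, Finset.mem_filter, Finset.mem_univ, true_and, not_lt] at this
    exact this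
  have hMainRow : ∀ i ∈ D.MainS Lost, (D.H < D.p * D.h i) ∨
      (D.p * D.h i ≤ D.H ∧ D.e * D.h i ≤ D.H ∧ D.W < D.w i * D.l ∧ i ∉ Lost) := by
    intro i hi
    simp only [MainS, Finset.mem_union, Finset.mem_sdiff, D.mem_Big, D.mem_Vs, D.mem_Thin, Finset.mem_filter, Finset.mem_univ, true_and, not_lt] at hi
    rcases hi with (hi | hi) | hi
    · exact Or.inl hi.1
    · exact Or.inl hi.1
    · exact Or.inr ⟨hi.1.1, hi.1.2.1, hi.1.2.2, hi.2⟩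
  have hMainTiny : ∀ i ∈ Tiny, i ∉ D.MainS Lost := by
    intro i hi hm
    have h1 := (Finset.mem_filter.1 hi).2
    rcases hMainRow i hm with h | h <;> omega
  -- scaled heights
  have hbe : ∀ i, D.e * D.h i ≤ D.H → D.b * D.h i ≤ D.b * D.H / D.e := by
    intro i hi
    rw [Nat.le_div_iff_mul_le D.he]
    calc D.b * D.h i * D.e = D.b * (D.e * D.h i) := by ring
      _ ≤ _ := Nat.mul_le_mul_left _ hi
  have hηe : ∀ N, D.b * N ≤ D.e → (D.b * D.H / D.e) * N ≤ D.H := by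
    intro N hN
    apply Nat.le_of_mul_le_mul_left (c := D.e) _ D.he
    calc D.e * ((D.b * D.H / D.e) * N) = (D.e * (D.b * D.H / D.e)) * N := by ring
      _ ≤ (D.b * D.H) * N := Nat.mul_le_mul_right _ (Nat.mul_div_le _ _)
      _ = (D.b * N) * D.H := by ring
      _ ≤ _ := Nat.mul_le_mul_right _ hN
  -- stack
  have hLostS : ∑ i ∈ Lost, D.b * D.h i ≤ 2 * D.H := by
    have := hηe _ he1
    unfold NLf at this
    omega
  have hWideS : ∑ i ∈ Wide, D.b * D.h i ≤ D.q * D.H := by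
    have e1 : (∑ i ∈ Wide, D.h i) * D.W ≤ (∑ i ∈ Wide, D.w i * D.h i) * (2 * D.A) := by
      rw [Finset.sum_mul, Finset.sum_mul]
      apply Finset.sum_le_sum
      intro i hi
      have : D.W < D.w i * (2 * D.A) := (Finset.mem_filter.1 hi).2
      calc D.h i * D.W ≤ D.h i * (D.w i * (2 * D.A)) := Nat.mul_le_mul_left _ this.le
        _ = _ := by ring
    have e2 : ∑ i ∈ Wide, D.w i * D.h i ≤ ∑ i ∈ Md1, D.w i * D.h i :=
      Finset.sum_le_sum_of_subset (Finset.filter_subset _ _)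
    have e3 : 32 * D.A * (∑ i ∈ Wide, D.h i) ≤ D.H := by
      apply Nat.le_of_mul_le_mul_left (c := 2 * D.A * D.W) _ (by positivity)
      calc 2 * D.A * D.W * (32 * D.A * (∑ i ∈ Wide, D.h i)) = 64 * D.A * D.A * ((∑ i ∈ Wide, D.h i) * D.W) := by ring
        _ ≤ 64 * D.A * D.A * ((∑ i ∈ Md1, D.w i * D.h i) * (2 * D.A)) :=
          Nat.mul_le_mul_left _ (e1.trans (Nat.mul_le_mul_right _ e2))
        _ = (64 * D.A * D.A * (∑ i ∈ Md1, D.w i * D.h i)) * (2 * D.A) := by ring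
        _ ≤ (D.W * D.H) * (2 * D.A) := Nat.mul_le_mul_right _ hmed1
        _ = _ := by ring
    rw [← Finset.mul_sum]
    have e4 := Nat.mul_le_mul_left D.q e3
    unfold b
    have e5 : D.q * (32 * D.A * ∑ i ∈ Wide, D.h i) = 24 * D.A * D.q * (∑ i ∈ Wide, D.h i) + 8 * D.A * D.q * (∑ i ∈ Wide, D.h i) := by ring
    omega
  have hqH : D.H ≤ D.q * D.H := Nat.le_mul_of_pos_left _ hq
  have hStkS : ∑ i ∈ Stk, D.b * D.h i ≤ 10 * D.q * D.H := by
    have : ∑ i ∈ Stk, D.b * D.h i ≤ ∑ i ∈ Wide, D.b * D.h i + ∑ i ∈ Lost, D.b * D.h i := by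
      rw [← Finset.sum_union_inter]; exact Nat.le_add_right _ _
    have e : 10 * D.q * D.H = 10 * (D.q * D.H) := by ring
    omega
  -- cells
  obtain ⟨f, Q, q1, q2, q3, q4⟩ := cells ((D.MainS Lost).image a0) R0 D.W (4 * D.m * D.H) (by
      intro s hs
      obtain ⟨i, hi, rfl⟩ := Finset.mem_image.1 hs
      exact r3 i hi) Tiny D.w (fun i => D.b * D.h i) (D.W / l3) (D.b * D.H / D.e) (Mf (nBf D.m D.b D.p D.l D.l2)) (by
      have : (2 * ((D.MainS Lost).image a0).card + 2) ≤ 2 * nBf D.m D.b D.p D.l D.l2 + 2 := by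
        unfold nBf; omega
      exact Nat.mul_le_mul this this) (by
      intro i hi
      have h := (Finset.mem_filter.1 hi).2
      have hp := D.hin i
      refine ⟨?_, hbe i h.2.1, Nat.mul_pos hp.2.2.1 (D.bh_pos i)⟩
      have : 0 < Mf (nBf D.m D.b D.p D.l D.l2) := by unfold Mf; positivity
      have := D.hm2
      have : 0 < l3 := lt_of_lt_of_le (by positivity) hl3'
      exact (Nat.le_div_iff_mul_le this).2 h.2.2.2) (by
      set M := Mf (nBf D.m D.b D.p D.l D.l2) with hM
      have hMp : 1 ≤ M := by
        have : 0 < M := by rw [hM]; unfold Mf; positivity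
        omega
      have hm2 := D.hm2
      have hl3p : 0 < l3 := lt_of_lt_of_le (by positivity) hl3'
      have t1 : M * (D.b * D.H / D.e) ≤ D.H := by rw [mul_comm]; exact hηe M he2
      have t2 : 4 * D.m * M * (D.W / l3) ≤ D.W := (Nat.mul_le_mul_right _ hl3').trans (Nat.mul_div_le _ _)
      have t3 : D.W / l3 ≤ D.W := Nat.div_le_self _ _
      have u1 : M * ((D.W / l3) * (4 * D.m * D.H)) ≤ D.W * D.H := by
        calc _ = (4 * D.m * M * (D.W / l3)) * D.H := by ring
          _ ≤ _ := Nat.mul_le_mul_right _ t2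
      have u2 : M * ((D.b * D.H / D.e) * D.W) ≤ D.W * D.H := by
        calc _ = (M * (D.b * D.H / D.e)) * D.W := by ring
          _ ≤ D.H * D.W := Nat.mul_le_mul_right _ t1
          _ = _ := by ring
      have u3 : M * ((D.W / l3) * (D.b * D.H / D.e)) ≤ D.W * D.H := by
        calc _ = (D.W / l3) * (M * (D.b * D.H / D.e)) := by ring
          _ ≤ _ := Nat.mul_le_mul t3 t1
      -- areas
      have v0 : ∑ i ∈ Tiny, D.w i * (D.b * D.h i) = D.b * ∑ i ∈ Tiny, D.w i * D.h i := by
        rw [Finset.mul_sum]; exact Finset.sum_congr rfl (fun i _ => by ring)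
      have d1 : Disjoint (D.Big ∪ D.Vs) D.Thin := by
        rw [Finset.disjoint_left]
        intro i h1 h2
        simp only [Finset.mem_union, D.mem_Big, D.mem_Vs, D.mem_Thin, Finset.mem_filter, Finset.mem_univ, true_and] at h1 h2
        omega
      have d2 : Disjoint (D.Big ∪ D.Vs ∪ D.Thin) Tiny := by
        rw [Finset.disjoint_left]
        intro i h1 h2
        simp only [Finset.mem_union, Tiny, D.mem_Big, D.mem_Vs, D.mem_Thin, Finset.mem_filter, Finset.mem_univ, true_and] at h1 h2
        omega
      have v1 := D.area_sub (D.Big ∪ D.Vs ∪ D.Thin ∪ Tiny)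
      rw [Finset.sum_union d2, Finset.sum_union d1] at v1
      have v2 := Nat.mul_le_mul_left D.b v1
      have v3 := Nat.mul_le_mul_left D.p (D.area_sub (D.Big ∪ D.Vs))
      rw [v0]
      have hq' := D.hq
      have v4 : 4 * D.m = D.b + (8 * D.A + 4) * D.q := by unfold m b; ring
      have v5 : D.p + 4 ≤ (8 * D.A + 4) * D.q := by
        have x1 : 1 * D.q ≤ D.A * D.q := Nat.mul_le_mul_right _ hA
        have x2 : (8 * D.A + 4) * D.q = 8 * (D.A * D.q) + 4 * D.q := by ring
        omega
      have v6 : D.b * (D.W * D.H) + D.p * (D.W * D.H) + 4 * (D.W * D.H) ≤ D.W * (4 * D.m * D.H) := by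
        calc _ = (D.b + (D.p + 4)) * (D.W * D.H) := by ring
          _ ≤ (D.b + (8 * D.A + 4) * D.q) * (D.W * D.H) := Nat.mul_le_mul_right _ (by omega)
          _ = _ := by rw [← v4]; ring
      have v7 : M * (D.W / l3 * (4 * D.m * D.H) + D.b * D.H / D.e * D.W + D.W / l3 * (D.b * D.H / D.e)) =
        M * ((D.W / l3) * (4 * D.m * D.H)) + M * ((D.b * D.H / D.e) * D.W) + M * ((D.W / l3) * (D.b * D.H / D.e)) := by ring
      rw [v7]
      rw [Nat.mul_add, Nat.mul_add] at v2
      rw [Nat.add_mul D.b D.p] at r7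
      omega)
  -- strip items
  let a : ι → FB ι := fun i => if i ∈ D.MainS Lost then .inl (a0 i) else if i ∈ Stk then .inr (.inl true)
    else if i ∈ Tiny then .inr (.inr (f i)) else .inr (.inl false)
  let R : FB ι → Rec := fun s => match s with
    | .inl s => R0 s
    | .inr (.inl true) => ⟨0, 4 * D.m * D.H, D.W, 10 * D.q * D.H⟩
    | .inr (.inl false) => ⟨0, 4 * D.m * D.H + 10 * D.q * D.H, D.W, 10 * D.q * D.H⟩
    | .inr (.inr c) => Q c
  have hex : ∀ i, (i ∈ D.MainS Lost ∧ a i = .inl (a0 i)) ∨ (i ∈ Stk ∧ a i = .inr (.inl true)) ∨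
      (i ∈ Tiny ∧ a i = .inr (.inr (f i))) ∨ ((i ∉ D.MainS Lost ∧ i ∉ Stk ∧ i ∉ Tiny) ∧ a i = .inr (.inl false)) := by
    intro i
    by_cases g1 : i ∈ D.MainS Lost
    · left; exact ⟨g1, if_pos g1⟩
    · by_cases g2 : i ∈ Stk
      · right; left; exact ⟨g2, by simp only [a, if_neg g1, if_pos g2]⟩
      · by_cases g3 : i ∈ Tiny
        · right; right; left; exact ⟨g3, by simp only [a, if_neg g1, if_neg g2, if_pos g3]⟩
        · right; right; right; exact ⟨⟨g1, g2, g3⟩, by simp only [a, if_neg g1, if_neg g2, if_neg g3]⟩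
  have hStrip : ∀ i, i ∉ D.MainS Lost → i ∉ Stk → i ∉ Tiny →
      D.p * D.h i ≤ D.H ∧ D.w i * (2 * D.A) ≤ D.W ∧ (i ∈ Md1 ∨ i ∈ Md2) := by
    intro i g1 g2 g3
    have k1 : D.w i * (2 * D.A) ≤ D.w i * D.l := Nat.mul_le_mul_left _ hl
    have hLo : i ∉ Lost := fun h => g2 (Finset.mem_union_right _ h)
    simp only [MainS, Stk, Wide, Md1, Md2, Tiny, Finset.mem_union, Finset.mem_sdiff, D.mem_Big, D.mem_Vs, D.mem_Thin, Finset.mem_filter, Finset.mem_univ, true_and, hLo, not_false_eq_true, and_true, or_false] at g1 g2 g3 ⊢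
    omega
  have hcR : ∀ i, (i ∈ D.MainS Lost ∨ i ∈ Tiny) → (R (a i)).x + (R (a i)).w ≤ D.W ∧ (R (a i)).y + (R (a i)).h ≤ 4 * D.m * D.H := by
    intro i hi
    rcases hex i with ⟨g, e⟩ | ⟨g, e⟩ | ⟨g, e⟩ | ⟨g, e⟩
    · rw [e]; exact r3 i g
    · exfalso
      rcases hi with hi | hi
      · have := hMainRow i hi
        simp only [Stk, Wide, Md1, Finset.mem_union, Finset.mem_filter, Finset.mem_univ, true_and] at g
        rcases g with g | g
        · omega
        · have := hLT i g
          rcases hMainRow i hi with h | h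
          · omega
          · exact h.2.2.2 ‹_›
      · simp only [Tiny, Finset.mem_filter, Finset.mem_univ, true_and] at hi
        simp only [Stk, Wide, Md1, Finset.mem_union, Finset.mem_filter, Finset.mem_univ, true_and] at g
        rcases g with g | g
        · omega
        · have := hLT i g
          omega
    · rw [e]; exact q3 i g
    · exfalso; tauto
  have hT : (4 * D.m + 20 * D.q) * D.H = 4 * D.m * D.H + 10 * D.q * D.H + 10 * D.q * D.H := by ring
  have fM : ∀ s, VFit (Finset.univ.filter (fun i => a i = .inl s)) D.w (fun i => D.b * D.h i) (R (.inl s)) ∨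
        HFit (Finset.univ.filter (fun i => a i = .inl s)) D.w (fun i => D.b * D.h i) (R (.inl s)) := by
    intro s
    have hs : Finset.univ.filter (fun i => a i = .inl s) ⊆ (D.MainS Lost).filter (fun i => a0 i = s) := by
      intro i hi
      have hi := (Finset.mem_filter.1 hi).2
      rcases hex i with ⟨g, e⟩ | ⟨g, e⟩ | ⟨g, e⟩ | ⟨g, e⟩ <;> rw [e] at hi <;> simp at hi
      exact Finset.mem_filter.2 ⟨g, hi⟩
    rcases r5 s with h | h
    · exact Or.inl (h.mono hs)
    · exact Or.inr (h.mono hs)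
  have fS : HFit (Finset.univ.filter (fun i => a i = .inr (.inl true))) D.w (fun i => D.b * D.h i) (R (.inr (.inl true))) := by
    have hs : Finset.univ.filter (fun i => a i = .inr (.inl true)) ⊆ Stk := by
      intro i hi
      have hi := (Finset.mem_filter.1 hi).2
      rcases hex i with ⟨g, e⟩ | ⟨g, e⟩ | ⟨g, e⟩ | ⟨g, e⟩ <;> rw [e] at hi <;> simp at hi
      exact g
    refine HFit.mono ⟨hStkS, ?_⟩ hs
    intro i _
    have := D.hin i
    simp only [R]; omega
  have fC : ∀ c, AFit (Finset.univ.filter (fun i => a i = .inr (.inr c))) D.w (fun i => D.b * D.h i) (R (.inr (.inr c))) := by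
    intro c
    refine (q4 c).mono ?_
    intro i hi
    have hi := (Finset.mem_filter.1 hi).2
    rcases hex i with ⟨g, e⟩ | ⟨g, e⟩ | ⟨g, e⟩ | ⟨g, e⟩ <;> rw [e] at hi <;> simp at hi
    exact Finset.mem_filter.2 ⟨g, by rw [← hi]⟩
  have fT : AFit (Finset.univ.filter (fun i => a i = .inr (.inl false))) D.w (fun i => D.b * D.h i) (R (.inr (.inl false))) := by
    have hs : ∀ i ∈ Finset.univ.filter (fun i => a i = .inr (.inl false)),
        D.p * D.h i ≤ D.H ∧ D.w i * (2 * D.A) ≤ D.W ∧ (i ∈ Md1 ∨ i ∈ Md2) := by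
      intro i hi
      have hi := (Finset.mem_filter.1 hi).2
      rcases hex i with ⟨g, e⟩ | ⟨g, e⟩ | ⟨g, e⟩ | ⟨g, e⟩ <;> rw [e] at hi <;> simp at hi
      exact hStrip i g.1 g.2.1 g.2.2
    refine ⟨D.W / 2, 3 * D.q * D.H, ?_, ?_⟩
    · intro i hi
      have h := hs i hi
      have hp := D.hin i
      refine ⟨?_, ?_, Nat.mul_pos hp.2.2.1 (D.bh_pos i)⟩
      · rw [Nat.le_div_iff_mul_le (by omega)]
        exact (Nat.mul_le_mul_left _ (by omega)).trans h.2.1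
      · have z : 8 * D.A * D.h i ≤ D.H := (Nat.mul_le_mul_right _ h1).trans h.1
        calc D.b * D.h i = 3 * D.q * (8 * D.A * D.h i) := by unfold b; ring
          _ ≤ _ := Nat.mul_le_mul_left _ z
    · have z1 : ∑ i ∈ Finset.univ.filter (fun i => a i = .inr (.inl false)), D.w i * (D.b * D.h i) ≤
          D.b * (∑ i ∈ Md1, D.w i * D.h i + ∑ i ∈ Md2, D.w i * D.h i) := by
        calc ∑ i ∈ Finset.univ.filter (fun i => a i = .inr (.inl false)), D.w i * (D.b * D.h i)
            ≤ ∑ i ∈ Md1 ∪ Md2, D.w i * (D.b * D.h i) := Finset.sum_le_sum_of_subset (by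
              intro i hi; exact Finset.mem_union.2 (hs i hi).2.2)
          _ = D.b * ∑ i ∈ Md1 ∪ Md2, D.w i * D.h i := by
              rw [Finset.mul_sum]; exact Finset.sum_congr rfl (fun i _ => by ring)
          _ ≤ _ := Nat.mul_le_mul_left _ (by rw [← Finset.sum_union_inter]; exact Nat.le_add_right _ _)
      have z2 : 64 * D.A * ∑ i ∈ Md1, D.w i * D.h i ≤ D.W * D.H := le_trans (Nat.mul_le_mul_right _ (by nlinarith)) hmed1
      have z3 : 64 * D.A * ∑ i ∈ Md2, D.w i * D.h i ≤ D.W * D.H := le_trans (Nat.mul_le_mul_right _ (Nat.le_add_left _ _)) hmed2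
      have z4 : D.b * (∑ i ∈ Md1, D.w i * D.h i + ∑ i ∈ Md2, D.w i * D.h i) ≤ D.q * (D.W * D.H) := by
        have : 32 * D.A * (∑ i ∈ Md1, D.w i * D.h i + ∑ i ∈ Md2, D.w i * D.h i) ≤ D.W * D.H := by
          rw [Nat.mul_add]
          have e1 : 64 * D.A * ∑ i ∈ Md1, D.w i * D.h i = 2 * (32 * D.A * ∑ i ∈ Md1, D.w i * D.h i) := by ring
          have e2 : 64 * D.A * ∑ i ∈ Md2, D.w i * D.h i = 2 * (32 * D.A * ∑ i ∈ Md2, D.w i * D.h i) := by ring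
          omega
        calc _ ≤ D.q * (32 * D.A * (∑ i ∈ Md1, D.w i * D.h i + ∑ i ∈ Md2, D.w i * D.h i)) := by
              unfold b
              calc _ ≤ 32 * D.A * D.q * (∑ i ∈ Md1, D.w i * D.h i + ∑ i ∈ Md2, D.w i * D.h i) := by gcongr; omega
                _ = _ := by ring
          _ ≤ _ := Nat.mul_le_mul_left _ this
      refine (z1.trans z4).trans ?_
      have y1 : D.W ≤ 2 * (D.W - D.W / 2) := by omega
      have y2 : 10 * D.q * D.H - 3 * D.q * D.H = 7 * (D.q * D.H) := by
        have : 10 * D.q * D.H = 10 * (D.q * D.H) := by ring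
        have : 3 * D.q * D.H = 3 * (D.q * D.H) := by ring
        omega
      show _ ≤ (D.W - D.W / 2) * (10 * D.q * D.H - 3 * D.q * D.H)
      rw [y2]
      calc D.q * (D.W * D.H) = D.W * (D.q * D.H) := by ring
        _ ≤ (2 * (D.W - D.W / 2)) * (D.q * D.H) := Nat.mul_le_mul_right _ y1
        _ ≤ (7 * (D.W - D.W / 2)) * (D.q * D.H) := Nat.mul_le_mul_right _ (by omega)
        _ = _ := by ring
  refine ⟨a, R, (Finset.univ.filter (fun i => i ∈ D.MainS Lost ∨ i ∈ Stk)).image a, ?_, ?_, ?_, ?_, ?_, ?_⟩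
  · intro i
    rw [hT]
    rcases hex i with ⟨g, e⟩ | ⟨g, e⟩ | ⟨g, e⟩ | ⟨g, e⟩
    · have := hcR i (Or.inl g); omega
    · rw [e]; simp only [R]; omega
    · have := hcR i (Or.inr g); omega
    · rw [e]; simp only [R]; omega
  · have key : ∀ i j, (i ∈ D.MainS Lost ∨ i ∈ Tiny) → ∀ b', a j = .inr (.inl b') → (R (a i)).Dj (R (a j)) := by
      intro i j hi b' hj c d m1 m2
      have := hcR i hi
      rw [hj] at m2
      unfold Rec.mem at m1 m2
      cases b' <;> simp only [R] at m2 <;> omega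
    intro i j hij
    rcases hex i with ⟨g, e⟩ | ⟨g, e⟩ | ⟨g, e⟩ | ⟨g, e⟩ <;> rcases hex j with ⟨g', e'⟩ | ⟨g', e'⟩ | ⟨g', e'⟩ | ⟨g', e'⟩
    · rw [e, e'] at hij ⊢
      exact r4 i g j g' (fun h => hij (by rw [h]))
    · exact key i j (Or.inl g) _ e'
    · rw [e, e']
      exact (q1 j g' _ (Finset.mem_image_of_mem _ g)).symm
    · exact key i j (Or.inl g) _ e'
    · exact (key j i (Or.inl g') _ e).symm
    · rw [e, e'] at hij; exact absurd rfl hij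
    · exact (key j i (Or.inr g') _ e).symm
    · rw [e, e']; intro c d m1 m2; simp only [R, Rec.mem] at m1 m2; omega
    · rw [e, e']
      exact q1 i g _ (Finset.mem_image_of_mem _ g')
    · exact key i j (Or.inr g) _ e'
    · rw [e, e'] at hij ⊢
      exact q2 i g j g' (fun h => hij (by rw [h]))
    · exact key i j (Or.inr g) _ e'
    · exact (key j i (Or.inl g') _ e).symm
    · rw [e, e']; intro c d m1 m2; simp only [R, Rec.mem] at m1 m2; omega
    · exact (key j i (Or.inr g') _ e).symm
    · rw [e, e'] at hij; exact absurd rfl hij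
  · intro s
    match s with
    | .inl s => rcases fM s with h | h
                · exact Or.inl h
                · exact Or.inr (Or.inl h)
    | .inr (.inl true) => exact Or.inr (Or.inl fS)
    | .inr (.inl false) => exact Or.inr (Or.inr fT)
    | .inr (.inr c) => exact Or.inr (Or.inr (fC c))
  · intro i hi
    rcases hex i with ⟨g, e⟩ | ⟨g, e⟩ | ⟨g, e⟩ | ⟨g, e⟩
    · exact Finset.mem_image_of_mem _ (Finset.mem_filter.2 ⟨Finset.mem_univ _, Or.inl g⟩)
    · exact Finset.mem_image_of_mem _ (Finset.mem_filter.2 ⟨Finset.mem_univ _, Or.inr g⟩)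
    · exfalso
      simp only [Tiny, Finset.mem_filter, Finset.mem_univ, true_and] at g
      have z1 : D.A * D.h i ≤ D.p * D.h i := Nat.mul_le_mul_right _ (by omega)
      have z2 : D.w i * (2 * D.A) ≤ D.w i * D.l := Nat.mul_le_mul_left _ hl
      have z3 : D.A * D.w i ≤ D.w i * (2 * D.A) := by nlinarith
      omega
    · exfalso
      have := hStrip i g.1 g.2.1 g.2.2
      have z1 : D.A * D.h i ≤ D.p * D.h i := Nat.mul_le_mul_right _ (by omega)
      have z3 : D.A * D.w i ≤ D.w i * (2 * D.A) := by nlinarith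
      omega
  · intro s hs
    obtain ⟨i, hi, rfl⟩ := Finset.mem_image.1 hs
    refine ⟨⟨i, rfl⟩, ?_⟩
    have hi := (Finset.mem_filter.1 hi).2
    rcases hex i with ⟨g, e⟩ | ⟨g, e⟩ | ⟨g, e⟩ | ⟨g, e⟩
    · rw [e]; exact fM _
    · rw [e]; exact Or.inr fS
    · exfalso
      rcases hi with hi | hi
      · exact hMainTiny i g hi
      · simp only [Tiny, Finset.mem_filter, Finset.mem_univ, true_and] at g
        simp only [Stk, Wide, Md1, Finset.mem_union, Finset.mem_filter, Finset.mem_univ, true_and] at hi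
        rcases hi with hi | hi
        · omega
        · have := hLT i hi
          omega
    · exfalso; tauto
  · have hsub : (Finset.univ.filter (fun i => i ∈ D.MainS Lost ∨ i ∈ Stk)).image a ⊆
        insert (.inr (.inl true)) (((D.MainS Lost).image a0).image Sum.inl) := by
      intro s hs
      obtain ⟨i, hi, rfl⟩ := Finset.mem_image.1 hs
      have hi := (Finset.mem_filter.1 hi).2
      rw [Finset.mem_insert]
      by_cases g1 : i ∈ D.MainS Lost
      · right
        have : a i = .inl (a0 i) := if_pos g1
        rw [this]
        exact Finset.mem_image_of_mem _ (Finset.mem_image_of_mem _ g1)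
      · left
        have g2 : i ∈ Stk := by tauto
        simp only [a, if_neg g1, if_pos g2]
    refine (Finset.card_le_card hsub).trans ((Finset.card_insert_le _ _).trans ?_)
    have := (Finset.card_image_le (s := (D.MainS Lost).image a0) (f := (Sum.inl : Bx ι → FB ι)))
    unfold nBf
    omega

end Geo


theorem pigeon {ι : Type*} [Fintype ι] (g : ι → ℕ) (P : ℕ → ι → Prop) (hP : ∀ k i, P (k + 1) i → P k i)
    (N T : ℕ) (hN : 0 < N) (hT : ∑ i, g i ≤ T) :
    ∃ k < N, N * ∑ i ∈ Finset.univ.filter (fun i => P k i ∧ ¬ P (k + 1) i), g i ≤ T := by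
  have step : ∀ k, ∑ i ∈ Finset.univ.filter (fun i => P k i), g i =
      ∑ i ∈ Finset.univ.filter (fun i => P k i ∧ ¬ P (k + 1) i), g i + ∑ i ∈ Finset.univ.filter (fun i => P (k + 1) i), g i := by
    intro k
    rw [Finset.sum_filter, Finset.sum_filter, Finset.sum_filter, ← Finset.sum_add_distrib]
    apply Finset.sum_congr rfl
    intro i _
    have := hP k i
    by_cases h1 : P k i <;> by_cases h2 : P (k + 1) i <;> simp_all
  have tel : ∀ n, ∑ k ∈ Finset.range n, ∑ i ∈ Finset.univ.filter (fun i => P k i ∧ ¬ P (k + 1) i), g i +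
      ∑ i ∈ Finset.univ.filter (fun i => P n i), g i ≤ T := by
    intro n
    induction n with
    | zero => simpa using (Finset.sum_le_sum_of_subset (Finset.filter_subset _ _)).trans hT
    | succ n ih =>
      rw [Finset.sum_range_succ]
      have := step n
      omega
  by_contra hc
  push Not at hc
  have h1 : ∑ k ∈ Finset.range N, (T + 1) ≤
      ∑ k ∈ Finset.range N, N * ∑ i ∈ Finset.univ.filter (fun i => P k i ∧ ¬ P (k + 1) i), g i :=
    Finset.sum_le_sum (fun k hk => hc k (Finset.mem_range.1 hk))
  rw [Finset.sum_const, Finset.card_range, smul_eq_mul, ← Finset.mul_sum] at h1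
  have h2 := Nat.le_of_mul_le_mul_left h1 hN
  have h3 := tel N
  omega

/-- parameters -/
noncomputable def pm (A p : ℕ) : ℕ := p * (8 * A + 1)
noncomputable def pb (A p : ℕ) : ℕ := 24 * A * p
noncomputable def pn (A p l : ℕ) : ℕ := nBf (pm A p) (pb A p) p l (l2f (pm A p) p l)
noncomputable def lseq (A p : ℕ) : ℕ → ℕ
  | 0 => 2 * A
  | j + 1 => lseq A p j + l2f (pm A p) p (lseq A p j) + 4 * pm A p * Mf (pn A p (lseq A p j))
noncomputable def pD (A p : ℕ) : ℕ := 2 * CC (pm A p) * p + 64 * A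
noncomputable def pE (A p : ℕ) : ℕ := p + ∑ j ∈ Finset.range (pD A p),
  (pb A p * NLf (pm A p) (pb A p) (lseq A p j) + pb A p * Mf (pn A p (lseq A p j)))
noncomputable def pseq (A : ℕ) : ℕ → ℕ
  | 0 => 8 * A
  | k + 1 => pE A (pseq A k)
noncomputable def pK (A : ℕ) : ℕ := 1 + ∑ k ∈ Finset.range (64 * A * A),
  ∑ j ∈ Finset.range (pD A (pseq A k)), (pn A (pseq A k) (lseq A (pseq A k) j) + 1)

theorem lseq_ge (A p j : ℕ) : 2 * A ≤ lseq A p j := by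
  induction j with
  | zero => simp [lseq]
  | succ j ih => rw [lseq]; omega

theorem pseq_ge (A k : ℕ) : 8 * A ≤ pseq A k := by
  induction k with
  | zero => simp [pseq]
  | succ k ih => rw [pseq, pE]; omega

theorem natassemble {ι : Type} [Fintype ι] (A W H : ℕ) (hA : 1 ≤ A) (hW : 0 < W) (hH : 0 < H) (x y w h : ι → ℕ)
    (hin : ∀ i, x i + w i ≤ W ∧ y i + h i ≤ H ∧ 0 < w i ∧ 0 < h i)
    (hdj : ∀ i j, i ≠ j → ISep x w i j ∨ ISep y h i j) :
    ∃ (p : ℕ) (a : ι → FB ι) (R : FB ι → Rec) (C : Finset (FB ι)), 0 < p ∧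
      (∀ i, (R (a i)).x + (R (a i)).w ≤ W ∧ (R (a i)).y + (R (a i)).h ≤ ((32 * A + 24) * p) * H) ∧
      (∀ i j, a i ≠ a j → (R (a i)).Dj (R (a j))) ∧
      (∀ s, VFit (Finset.univ.filter (fun i => a i = s)) w (fun i => pb A p * h i) (R s) ∨
        HFit (Finset.univ.filter (fun i => a i = s)) w (fun i => pb A p * h i) (R s) ∨
        AFit (Finset.univ.filter (fun i => a i = s)) w (fun i => pb A p * h i) (R s)) ∧
      (∀ i, H < A * h i ∨ W < A * w i → a i ∈ C) ∧
      (∀ s ∈ C, (∃ i, a i = s) ∧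
        (VFit (Finset.univ.filter (fun i => a i = s)) w (fun i => pb A p * h i) (R s) ∨
        HFit (Finset.univ.filter (fun i => a i = s)) w (fun i => pb A p * h i) (R s))) ∧
      C.card ≤ pK A := by
  have harea : ∑ i, w i * h i ≤ W * H :=
    Geo.area_tot {
      x := x, y := y, w := w, h := h, W := W, H := H, A := A, q := 1, p := 1, l := 0, l2 := 0, e := 1,
      hW := hW, hH := hH, hA := hA, hp := le_rfl, hq := by omega, he := le_rfl, hin := hin, hdj := hdj }
  obtain ⟨k, hk, hk'⟩ := pigeon (fun i => w i * h i) (fun k i => pseq A k * h i ≤ H) (by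
    intro k i hi
    refine le_trans (Nat.mul_le_mul_right _ ?_) hi
    rw [pseq, pE]; omega) (64 * A * A) (W * H) (by positivity) harea
  set p := pseq A k with hp
  have hp8 : 8 * A ≤ p := pseq_ge A k
  have he : pseq A (k + 1) = pE A p := rfl
  rw [he] at hk'
  obtain ⟨j, hj, hj'⟩ := pigeon (fun i => w i * h i) (fun k i => w i * lseq A p k ≤ W) (by
    intro k i hi
    refine le_trans (Nat.mul_le_mul_left _ ?_) hi
    rw [lseq]; omega) (pD A p) (W * H) (by unfold pD; omega) harea
  set l := lseq A p j with hl
  have hl3 : lseq A p (j + 1) = l + l2f (pm A p) p l + 4 * pm A p * Mf (pn A p l) := rfl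
  have hEj : pb A p * NLf (pm A p) (pb A p) l + pb A p * Mf (pn A p l) ≤ pE A p := by
    have := Finset.single_le_sum (f := fun j => pb A p * NLf (pm A p) (pb A p) (lseq A p j) + pb A p * Mf (pn A p (lseq A p j)))
      (fun _ _ => Nat.zero_le _) (Finset.mem_range.2 hj)
    unfold pE
    simp only [← hl] at this
    omega
  let D : Geo ι := {
    x := x, y := y, w := w, h := h, W := W, H := H, A := A, q := p, p := p, l := l, l2 := l2f (pm A p) p l,
    e := pE A p, hW := hW, hH := hH, hA := hA, hp := by omega, hq := by omega, he := by unfold pE; omega, hin := hin, hdj := hdj }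
  have := D.assemble (l3 := lseq A p (j + 1)) hp8 (lseq_ge A p j) rfl (by
      show l2f (pm A p) p l ≤ _
      rw [hl3]; omega) (by
      show 4 * pm A p * Mf (pn A p l) ≤ _
      rw [hl3]; omega) (by
      show pb A p * NLf (pm A p) (pb A p) l ≤ pE A p
      omega) (by
      show pb A p * Mf (pn A p l) ≤ pE A p
      omega) (by
      simp only [not_le] at hk'
      convert hk') (by
      simp only [not_le] at hj'
      convert hj'
      rfl)
  obtain ⟨a, R, C, t1, t2, t3, t4, t5, t6⟩ := this
  refine ⟨p, a, R, C, by omega, ?_, t2, t3, t4, t5, ?_⟩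
  · intro i
    have := t1 i
    have e : (4 * D.m + 20 * D.q) = (32 * A + 24) * p := by
      show 4 * (p * (8 * A + 1)) + 20 * p = _
      ring
    rw [e] at this
    exact this
  · refine t6.trans ?_
    show pn A p l + 1 ≤ _
    have s1 := Finset.single_le_sum (f := fun j => pn A p (lseq A p j) + 1)
      (fun _ _ => Nat.zero_le _) (Finset.mem_range.2 hj)
    have s2 := Finset.single_le_sum (f := fun k => ∑ j ∈ Finset.range (pD A (pseq A k)), (pn A (pseq A k) (lseq A (pseq A k) j) + 1))
      (fun _ _ => Nat.zero_le _) (Finset.mem_range.2 hk)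
    simp only [← hl, ← hp] at s1 s2
    unfold pK
    omega

theorem natmain {ι : Type} [Fintype ι] (A W H : ℕ) (hA : 1 ≤ A) (hW : 0 < W) (hH : 0 < H) (x y w h : ι → ℕ)
    (hin : ∀ i, x i + w i ≤ W ∧ y i + h i ≤ H ∧ 0 < w i ∧ 0 < h i)
    (hdj : ∀ i j, i ≠ j → ISep x w i j ∨ ISep y h i j) :
    ∃ (x' y' : ι → ℕ) (a : ι → FB ι) (R : FB ι → Rec) (C : Finset (FB ι)) (vert : FB ι → Bool),
      (∀ i, x' i + w i ≤ W ∧ 24 * A * (y' i + h i) ≤ (32 * A + 24) * H) ∧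
      (∀ i j, i ≠ j → ISep x' w i j ∨ ISep y' h i j) ∧ C.card ≤ pK A ∧
      (∀ s ∈ C, (R s).x + (R s).w ≤ W ∧ 24 * A * ((R s).y + (R s).h) ≤ (32 * A + 24) * H) ∧
      (∀ s ∈ C, ∀ t ∈ C, s ≠ t → (R s).x + (R s).w ≤ (R t).x ∨ (R t).x + (R t).w ≤ (R s).x ∨
        (R s).y + (R s).h ≤ (R t).y ∨ (R t).y + (R t).h ≤ (R s).y) ∧
      (∀ i, H < A * h i ∨ W < A * w i → a i ∈ C) ∧
      (∀ i, (R (a i)).x ≤ x' i ∧ x' i + w i ≤ (R (a i)).x + (R (a i)).w ∧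
        (R (a i)).y ≤ y' i ∧ y' i + h i ≤ (R (a i)).y + (R (a i)).h) ∧
      (∀ i j, a i ∈ C → i ≠ j → a i = a j → (vert (a i) = true → ISep x' w i j) ∧
        (vert (a i) = false → ISep y' h i j)) := by
  obtain ⟨p, a, R, C, hp, t1, t2, t3, t4, t5, t6⟩ := natassemble A W H hA hW hH x y w h hin hdj
  have hb : 0 < pb A p := by unfold pb; positivity
  set b := pb A p with hbdef
  have hpos : ∀ i, 0 < w i ∧ 0 < b * h i := fun i => ⟨(hin i).2.2.1, Nat.mul_pos hb (hin i).2.2.2⟩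
  obtain ⟨x', yy, u1, u2, u3, u4⟩ := boxes_pack w (fun i => b * h i) hpos a R t2 t3
  have hdiv : ∀ i, yy i / b + h i = (yy i + b * h i) / b := by
    intro i; rw [Nat.add_mul_div_left _ _ hb]
  have hsep : ∀ i j, ISep yy (fun i => b * h i) i j → ISep (fun i => yy i / b) h i j := by
    intro i j hij
    unfold ISep at hij ⊢
    beta_reduce at hij ⊢
    rw [hdiv, hdiv]
    rcases hij with h | h
    · exact Or.inl (Nat.div_le_div_right h)
    · exact Or.inr (Nat.div_le_div_right h)
  have htop : ∀ z, z ≤ ((32 * A + 24) * p) * H → 24 * A * (z / b) ≤ (32 * A + 24) * H := by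
    intro z hz
    apply Nat.le_of_mul_le_mul_left (c := p) _ hp
    calc p * (24 * A * (z / b)) = b * (z / b) := by rw [hbdef]; unfold pb; ring
      _ ≤ z := Nat.mul_div_le _ _
      _ ≤ _ := hz
      _ = _ := by ring
  let R' : FB ι → Rec := fun s => ⟨(R s).x, (R s).y / b, (R s).w, ((R s).y + (R s).h) / b - (R s).y / b⟩
  have hR' : ∀ s, (R' s).y + (R' s).h = ((R s).y + (R s).h) / b := by
    intro s
    have : (R s).y / b ≤ ((R s).y + (R s).h) / b := Nat.div_le_div_right (Nat.le_add_right _ _)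
    simp only [R']; omega
  refine ⟨x', fun i => yy i / b, a, R', C,
    fun s => decide (VFit (Finset.univ.filter (fun i => a i = s)) w (fun i => b * h i) (R s)), ?_, ?_, t6, ?_, ?_, t4, ?_, ?_⟩
  · intro i
    have h1 := u1 i
    have h2 := t1 i
    beta_reduce at h1 ⊢
    refine ⟨by omega, ?_⟩
    rw [hdiv]
    exact htop _ (by omega)
  · intro i j hij
    rcases u2 i j hij with h | h
    · exact Or.inl h
    · exact Or.inr (hsep i j h)
  · intro s hs
    obtain ⟨⟨i, rfl⟩, _⟩ := t5 s hs
    rw [hR']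
    exact ⟨(t1 i).1, htop _ (t1 i).2⟩
  · intro s hs t ht hst
    obtain ⟨⟨i, rfl⟩, _⟩ := t5 s hs
    obtain ⟨⟨j, rfl⟩, _⟩ := t5 t ht
    rw [hR', hR']
    have h1 := u1 i
    have h2 := u1 j
    have h3 := hpos i
    have h4 := hpos j
    beta_reduce at h1 h2
    rcases (t2 i j hst).sep (by omega) (by omega) (by omega) (by omega) with h | h | h | h
    · exact Or.inl h
    · exact Or.inr (Or.inl h)
    · exact Or.inr (Or.inr (Or.inl (Nat.div_le_div_right h)))
    · exact Or.inr (Or.inr (Or.inr (Nat.div_le_div_right h)))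
  · intro i
    have h1 := u1 i
    rw [hR']
    refine ⟨h1.1, h1.2.1, Nat.div_le_div_right h1.2.2.1, ?_⟩
    rw [hdiv]
    exact Nat.div_le_div_right h1.2.2.2
  · intro i j hi hij haij
    refine ⟨?_, ?_⟩
    · intro hv
      exact u3 (a i) (of_decide_eq_true hv) i j rfl haij.symm hij
    · intro hv
      have hv := of_decide_eq_false hv
      have hh := (t5 _ hi).2.resolve_left hv
      exact hsep i j (u4 (a i) hv hh i j rfl haij.symm hij)


/-- Structural form of Theorem 2 (strip packing with 90° rotations): for every `ε ∈ (0,1)`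
there is a constant `K = K(ε)` such that whenever some choice of orientations of the
rectangles admits a feasible packing into `[0,W]×[0,H]`, there is a (possibly different)
choice of orientations and a feasible packing of all the rectangles into
`[0,W]×[0,⌈(4/3+ε)·H⌉]` in which every non-small (oriented) rectangle lies in one of at
most `K` horizontal/vertical containers with pairwise disjoint interiors. -/
theorem strip_packing_with_rotations_four_thirds
    (ε : ℝ) (hε : ε ∈ Set.Ioo (0 : ℝ) 1) :
    ∃ K : ℕ, 0 < K ∧
      ∀ (W H : ℕ), 0 < W → 0 < H →
      ∀ (ι : Type) (_ : Fintype ι) (w h : ι → ℕ),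
        (∀ i, 0 < w i ∧ 0 < h i) →
        (∃ σ : ι → Bool,
          (∀ i, orientW (w i) (h i) (σ i) ≤ W) ∧
          ∃ x y : ι → ℕ,
            IsPacking (fun i => orientW (w i) (h i) (σ i))
              (fun i => orientH (w i) (h i) (σ i)) x y W H) →
        ∃ (τ : ι → Bool) (x y : ι → ℕ) (n : ℕ) (cx cy cw ch : ℕ → ℝ)
          (vert : ℕ → Bool) (c : ι → ℕ),
          (∀ i, orientW (w i) (h i) (τ i) ≤ W) ∧
          IsPacking (fun i => orientW (w i) (h i) (τ i))
            (fun i => orientH (w i) (h i) (τ i)) x y W ⌈(4 / 3 + ε) * H⌉₊ ∧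
          n ≤ K ∧
          (∀ m < n, 0 ≤ cx m ∧ 0 ≤ cy m ∧ 0 ≤ cw m ∧ 0 ≤ ch m ∧
            cx m + cw m ≤ W ∧ cy m + ch m ≤ (⌈(4 / 3 + ε) * H⌉₊ : ℝ)) ∧
          (∀ m < n, ∀ m' < n, m ≠ m' →
            RegionDisjoint (cx m) (cy m) (cw m) (ch m) (cx m') (cy m') (cw m') (ch m')) ∧
          (∀ i, (ε * H < (orientH (w i) (h i) (τ i) : ℝ) ∨
                 ε * W < (orientW (w i) (h i) (τ i) : ℝ)) →
            c i < n ∧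
            InRegion (x i) (y i) (orientW (w i) (h i) (τ i)) (orientH (w i) (h i) (τ i))
              (cx (c i)) (cy (c i)) (cw (c i)) (ch (c i))) ∧
          (∀ i j, (ε * H < (orientH (w i) (h i) (τ i) : ℝ) ∨
                   ε * W < (orientW (w i) (h i) (τ i) : ℝ)) →
            (ε * H < (orientH (w j) (h j) (τ j) : ℝ) ∨
             ε * W < (orientW (w j) (h j) (τ j) : ℝ)) → i ≠ j → c i = c j →
            (vert (c i) = true →
              x i + orientW (w i) (h i) (τ i) ≤ x j ∨
              x j + orientW (w j) (h j) (τ j) ≤ x i) ∧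
            (vert (c i) = false →
              y i + orientH (w i) (h i) (τ i) ≤ y j ∨
              y j + orientH (w j) (h j) (τ j) ≤ y i)) := by
  obtain ⟨hε0, hε1⟩ := hε
  obtain ⟨A, hA1, hAε⟩ : ∃ A : ℕ, 1 ≤ A ∧ 1 ≤ (A : ℝ) * ε := by
    refine ⟨⌈1 / ε⌉₊ + 1, by omega, ?_⟩
    have h1 : 1 / ε ≤ (⌈1 / ε⌉₊ : ℝ) := Nat.le_ceil _
    rw [div_le_iff₀ hε0] at h1
    push_cast
    nlinarith
  refine ⟨pK A, by unfold pK; omega, ?_⟩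
  intro W H hW hH ι _ w0 h0 hpos ⟨σ, hσ, x, y, hin, hdj⟩
  obtain ⟨w, hw⟩ : ∃ w : ι → ℕ, w = fun i => orientW (w0 i) (h0 i) (σ i) := ⟨_, rfl⟩
  obtain ⟨h, hh⟩ : ∃ h : ι → ℕ, h = fun i => orientH (w0 i) (h0 i) (σ i) := ⟨_, rfl⟩
  have hwi : ∀ i, orientW (w0 i) (h0 i) (σ i) = w i := fun i => by rw [hw]
  have hhi : ∀ i, orientH (w0 i) (h0 i) (σ i) = h i := fun i => by rw [hh]
  have hp : ∀ i, 0 < w i ∧ 0 < h i := by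
    intro i
    rw [← hwi, ← hhi]
    have := hpos i
    unfold orientW orientH
    cases σ i <;> simp [this]
  simp only [hwi, hhi] at hin hdj hσ
  obtain ⟨x', y', a, R, C, vert, t1, t2, t3, t4, t5, t6, t7, t8⟩ := natmain A W H hA1 hW hH x y w h
    (fun i => ⟨(hin i).1, (hin i).2, hp i⟩) (by
      intro i j hij
      have := hdj hij
      unfold RectDisjoint at this
      unfold ISep
      tauto)
  have htop : ∀ z : ℕ, 24 * A * z ≤ (32 * A + 24) * H → z ≤ ⌈(4 / 3 + ε) * (H : ℝ)⌉₊ := by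
    intro z hz
    have h1 : (24 * A * z : ℝ) ≤ (32 * A + 24) * H := by exact_mod_cast hz
    have hApos : (0 : ℝ) < A := by exact_mod_cast hA1
    have hH0 : (0 : ℝ) ≤ H := Nat.cast_nonneg H
    have h2 : (H : ℝ) ≤ (A * ε) * H := by nlinarith
    have h3 : (z : ℝ) ≤ (4 / 3 + ε) * H := by
      by_contra hc
      push Not at hc
      have := mul_lt_mul_of_pos_left hc hApos
      nlinarith
    exact_mod_cast h3.trans (Nat.le_ceil _)
  have hbig : ∀ i, (ε * H < (h i : ℝ) ∨ ε * W < (w i : ℝ)) → a i ∈ C := by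
    intro i hi
    apply t6 i
    have hApos : (0 : ℝ) < A := by exact_mod_cast hA1
    rcases hi with hi | hi
    · left
      have h2 : (H : ℝ) ≤ (A * ε) * H := by
        have hH0 : (0 : ℝ) ≤ H := Nat.cast_nonneg H
        nlinarith
      have := mul_lt_mul_of_pos_left hi hApos
      have h3 : (H : ℝ) < A * h i := by linarith
      exact_mod_cast h3
    · right
      have h2 : (W : ℝ) ≤ (A * ε) * W := by
        have hH0 : (0 : ℝ) ≤ W := Nat.cast_nonneg W
        nlinarith
      have := mul_lt_mul_of_pos_left hi hApos
      have h3 : (W : ℝ) < A * w i := by linarith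
      exact_mod_cast h3
  let e := C.equivFin
  let s : ℕ → FB ι := fun m => if hm : m < C.card then (e.symm ⟨m, hm⟩ : FB ι) else .inr (.inl true)
  have hs : ∀ m, m < C.card → s m ∈ C := by
    intro m hm
    simp only [s, hm, dif_pos]
    exact (e.symm ⟨m, hm⟩).2
  have hsinj : ∀ m m', m < C.card → m' < C.card → s m = s m' → m = m' := by
    intro m m' hm hm' h
    simp only [s, hm, hm', dif_pos] at h
    have := e.symm.injective (Subtype.ext h)
    simpa using this
  let c : ι → ℕ := fun i => if hi : a i ∈ C then (e ⟨a i, hi⟩ : ℕ) else 0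
  have hc : ∀ i, a i ∈ C → c i < C.card ∧ s (c i) = a i := by
    intro i hi
    have h1 : c i = (e ⟨a i, hi⟩ : ℕ) := by simp only [c, hi, dif_pos]
    have h2 : c i < C.card := by rw [h1]; exact (e ⟨a i, hi⟩).2
    refine ⟨h2, ?_⟩
    simp only [s, h2, dif_pos]
    have : (⟨c i, h2⟩ : Fin C.card) = e ⟨a i, hi⟩ := Fin.ext h1
    rw [this, Equiv.symm_apply_apply]
  refine ⟨σ, x', y', C.card, fun m => ((R (s m)).x : ℝ), fun m => ((R (s m)).y : ℝ), fun m => ((R (s m)).w : ℝ),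
    fun m => ((R (s m)).h : ℝ), fun m => vert (s m), c, ?_⟩
  simp only [hwi, hhi]
  refine ⟨hσ, ⟨fun i => ⟨(t1 i).1, htop _ (t1 i).2⟩, ?_⟩, t3, ?_, ?_, ?_, ?_⟩
  · intro i j hij
    have := t2 i j hij
    unfold ISep at this
    unfold RectDisjoint
    tauto
  · intro m hm
    have h1 := t4 _ (hs m hm)
    have h2 := htop _ h1.2
    refine ⟨Nat.cast_nonneg _, Nat.cast_nonneg _, Nat.cast_nonneg _, Nat.cast_nonneg _, ?_, ?_⟩
    · exact_mod_cast h1.1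
    · exact_mod_cast h2
  · intro m hm m' hm' hne
    have := t5 _ (hs m hm) _ (hs m' hm') (fun h => hne (hsinj m m' hm hm' h))
    unfold RegionDisjoint
    exact_mod_cast this
  · intro i hi
    have h1 := hc i (hbig i hi)
    refine ⟨h1.1, ?_⟩
    rw [h1.2]
    have := t7 i
    unfold InRegion
    exact_mod_cast this
  · intro i j hi hj hij hcij
    have h1 := hc i (hbig i hi)
    have h2 := hc j (hbig j hj)
    have h3 : a i = a j := by rw [← h1.2, ← h2.2, hcij]
    have := t8 i j (hbig i hi) hij h3
    rw [h1.2]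
    exact this
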